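/- Let Ω be the open unit disc. Then the function B ↦ λ₁(B) − B²/4 is concave on (0,∞), so the one-sided derivatives λ₁'₊(B) and λ₁'₋(B) exist and satisfy λ₁'₊(B) ≤ λ₁'₋(B) for all B > 0; moreover liminf_{B→+∞} λ₁'₊(B) ≥ Θ₀ − (3/2)·C₁·|ξ₀|, the number Θ₀ − (3/2)·C₁·|ξ₀| is strictly positive, and in particular there exists B₀ > 0 such that λ₁ is strictly increasing on [B₀, ∞). -/

import Mathlib

open MeasureTheory Filter Set Topology

noncomputable section

namespace SC

/-- The plane `ℝ²`. -/
abbrev Plane := ℝ × ℝ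

/-- Squared Euclidean norm on the plane. -/
def esq (v : Plane) : ℝ := v.1 ^ 2 + v.2 ^ 2

/-- Euclidean dot product on the plane. -/
def dot2 (v w : Plane) : ℝ := v.1 * w.1 + v.2 * w.2

/-- The reference vector potential `F₀(x) = (-x₂/2, x₁/2)`, with `curl F₀ = 1`. -/
def F0 : Plane → Plane := fun x => (-x.2 / 2, x.1 / 2)

/-- `u` is of class `Cⁿ` on a neighborhood of the closure of `Ω`. -/
def CNearCl {E : Type*} [NormedAddCommGroup E] [NormedSpace ℝ E]
    (n : ℕ) (Ω : Set Plane) (u : Plane → E) : Prop :=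
  ∃ U : Set Plane, IsOpen U ∧ closure Ω ⊆ U ∧ ContDiffOn ℝ n u U

/-- The pointwise squared magnetic gradient `|(-i∇ - B·A)u|²`. -/
def magSq (B : ℝ) (A : Plane → Plane) (u : Plane → ℂ) (x : Plane) : ℝ :=
  ‖(-Complex.I) * fderiv ℝ u x ((1 : ℝ), (0 : ℝ)) - ((B * (A x).1 : ℝ) : ℂ) * u x‖ ^ 2 +
  ‖(-Complex.I) * fderiv ℝ u x ((0 : ℝ), (1 : ℝ)) - ((B * (A x).2 : ℝ) : ℂ) * u x‖ ^ 2

/-- `curl A = ∂₁A₂ - ∂₂A₁`. -/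
def curl2 (A : Plane → Plane) (x : Plane) : ℝ :=
  fderiv ℝ (fun y => (A y).2) x ((1 : ℝ), (0 : ℝ)) -
    fderiv ℝ (fun y => (A y).1) x ((0 : ℝ), (1 : ℝ))

/-- The variational ground state energy `λ₁(B·A)` of the magnetic Neumann Laplacian. -/
def lam1A (Ω : Set Plane) (B : ℝ) (A : Plane → Plane) : ℝ :=
  sInf { r : ℝ | ∃ u : Plane → ℂ, CNearCl 1 Ω u ∧ (∫ x in Ω, ‖u x‖ ^ 2) ≠ 0 ∧
    r = (∫ x in Ω, magSq B A u x) / (∫ x in Ω, ‖u x‖ ^ 2) }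

/-- `λ₁(B) = λ₁(B·F₀)`. -/
def lam1 (Ω : Set Plane) (B : ℝ) : ℝ := lam1A Ω B F0

/-- The Ginzburg–Landau energy functional. -/
def GLenergy (Ω : Set Plane) (κ H : ℝ) (ψ : Plane → ℂ) (A : Plane → Plane) : ℝ :=
  ∫ x in Ω, (magSq (κ * H) A ψ x - κ ^ 2 * ‖ψ x‖ ^ 2 + κ ^ 2 / 2 * ‖ψ x‖ ^ 4
    + κ ^ 2 * H ^ 2 * (curl2 A x - 1) ^ 2)

/-- Admissible Ginzburg–Landau configurations. -/
def GLadm (Ω : Set Plane) (ψ : Plane → ℂ) (A : Plane → Plane) : Prop :=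
  CNearCl 1 Ω ψ ∧ CNearCl 1 Ω A

/-- The normal state is a minimizer at `(κ, H)`. -/
def NormalMin (Ω : Set Plane) (κ H : ℝ) : Prop :=
  ∀ ψ A, GLadm Ω ψ A → 0 ≤ GLenergy Ω κ H ψ A

/-- The normal state is the unique minimizer at `(κ, H)`. -/
def NormalUnique (Ω : Set Plane) (κ H : ℝ) : Prop :=
  NormalMin Ω κ H ∧
  ∀ ψ A, GLadm Ω ψ A → (∫ x in Ω, ‖ψ x‖ ^ 2) ≠ 0 → 0 < GLenergy Ω κ H ψ A

/-- `(ψ, A)` is a minimizer of the Ginzburg–Landau energy at `(κ, H)`. -/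
def IsGLMin (Ω : Set Plane) (κ H : ℝ) (ψ : Plane → ℂ) (A : Plane → Plane) : Prop :=
  GLadm Ω ψ A ∧ ∀ ψ' A', GLadm Ω ψ' A' → GLenergy Ω κ H ψ A ≤ GLenergy Ω κ H ψ' A'

/-- Lower global critical field. -/
def HC3low (Ω : Set Plane) (κ : ℝ) : ℝ := sInf {H : ℝ | 0 < H ∧ NormalMin Ω κ H}

/-- Upper global critical field. -/
def HC3up (Ω : Set Plane) (κ : ℝ) : ℝ :=
  sInf {H : ℝ | 0 < H ∧ ∀ H', H < H' → NormalUnique Ω κ H'}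

/-- Lower local critical field. -/
def HlocLow (Ω : Set Plane) (κ : ℝ) : ℝ :=
  sInf {H : ℝ | 0 < H ∧ κ ^ 2 ≤ lam1 Ω (κ * H)}

/-- Upper local critical field. -/
def HlocUp (Ω : Set Plane) (κ : ℝ) : ℝ :=
  sInf {H : ℝ | 0 < H ∧ ∀ H', H < H' → κ ^ 2 ≤ lam1 Ω (κ * H')}

/-- The inward unit normal `ν(s) = (-γ₂'(s), γ₁'(s))`. -/
def nuVec (γ : ℝ → Plane) (s : ℝ) : Plane := (-(deriv γ s).2, (deriv γ s).1)

/-- The curvature `k(s) = ⟨γ''(s), ν(s)⟩`. -/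
def curvOf (γ : ℝ → Plane) (s : ℝ) : ℝ := dot2 (deriv (deriv γ) s) (nuVec γ s)

/-- The maximal curvature. -/
def kmaxOf (γ : ℝ → Plane) : ℝ := sSup (Set.range (curvOf γ))

/-- A smooth counterclockwise arclength parametrization of the boundary of `Ω`. -/
structure BoundaryParam (Ω : Set Plane) where
  γ : ℝ → Plane
  L : ℝ
  L_pos : 0 < L
  smooth : ContDiff ℝ (⊤ : ℕ∞) γ
  periodic : Function.Periodic γ L
  unit_speed : ∀ s, esq (deriv γ s) = 1
  injOn : Set.InjOn γ (Set.Ico 0 L)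
  range_eq : Set.range γ = frontier Ω
  inward : ∀ s, ∃ ε > 0, ∀ t ∈ Set.Ioo (0 : ℝ) ε, γ s + t • nuVec γ s ∈ Ω

/-- The non-degeneracy assumption: finitely many points of maximal curvature,
all of them non-degenerate maxima. -/
def NonDegen {Ω : Set Plane} (P : BoundaryParam Ω) : Prop :=
  ∃ (N : ℕ) (s : Fin N → ℝ), 0 < N ∧ (∀ j, s j ∈ Set.Ico 0 P.L) ∧
    (∀ j, curvOf P.γ (s j) = kmaxOf P.γ) ∧
    (∀ t ∈ Set.Ico 0 P.L, (∀ j, t ≠ s j) → curvOf P.γ t < kmaxOf P.γ) ∧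
    (∀ j, deriv (deriv (curvOf P.γ)) (s j) < 0)

/-- The ground state energy `μ(ζ)` of the de Gennes half-line model operator. -/
def muGen (ζ : ℝ) : ℝ :=
  sInf { r : ℝ | ∃ φ : ℝ → ℝ, ContDiff ℝ 1 φ ∧ HasCompactSupport φ ∧
    (∃ τ, 0 < τ ∧ φ τ ≠ 0) ∧
    r = (∫ τ in Set.Ioi (0 : ℝ), ((deriv φ τ) ^ 2 + (τ + ζ) ^ 2 * (φ τ) ^ 2)) /
        (∫ τ in Set.Ioi (0 : ℝ), (φ τ) ^ 2) }

/-- The de Gennes constant `Θ₀`. -/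
def Theta0 : ℝ := sInf (Set.range muGen)

/-- Standard facts about the de Gennes constant, taken as hypotheses. -/
structure DeGennes where
  ξ₀ : ℝ
  u₀ : ℝ → ℝ
  theta_lb : 1 / 2 < Theta0
  theta_ub : Theta0 < 1
  ξ₀_mem : ξ₀ ∈ Set.Ioo (-1 : ℝ) 0
  ξ₀_min : muGen ξ₀ = Theta0
  ξ₀_uniq : ∀ ζ, muGen ζ = Theta0 → ζ = ξ₀
  ξ₀_sq : ξ₀ ^ 2 = Theta0
  u₀_pos : ∀ τ, 0 ≤ τ → 0 < u₀ τ
  u₀_smooth : ContDiffOn ℝ 2 u₀ (Set.Ici 0)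
  u₀_sq_int : IntegrableOn (fun τ => (u₀ τ) ^ 2) (Set.Ioi 0)
  u₀_normalized : (∫ τ in Set.Ioi (0 : ℝ), (u₀ τ) ^ 2) = 1
  u₀_neumann : derivWithin u₀ (Set.Ici 0) 0 = 0
  u₀_ode : ∀ τ ∈ Set.Ioi (0 : ℝ),
    -(deriv (deriv u₀) τ) + (τ + ξ₀) ^ 2 * u₀ τ = Theta0 * u₀ τ

/-- The universal constant `C₁ = u₀(0)²/3`. -/
def DeGennes.C1 (D : DeGennes) : ℝ := (D.u₀ 0) ^ 2 / 3

/-- Condition (★) on a vector field `A` at field strength `B` with constant `C₀`. -/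
def StarCond (Ω : Set Plane) (C₀ B : ℝ) (A : Plane → Plane) : Prop :=
  CNearCl 2 Ω A ∧
  (∀ x ∈ closure Ω, ‖A x‖ ≤ C₀) ∧
  (∀ x ∈ closure Ω, ‖fderiv ℝ A x‖ ≤ C₀) ∧
  (∀ x ∈ closure Ω, ‖fderiv ℝ (fderiv ℝ A) x‖ ≤ C₀) ∧
  (∀ x ∈ closure Ω, |curl2 A x - 1| ≤ C₀ * B ^ (-(1 : ℝ) / 4)) ∧
  (∀ x ∈ closure Ω, ‖fderiv ℝ (curl2 A) x‖ ≤ C₀ * B ^ (-(1 : ℝ) / 4)) ∧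
  (∀ x ∈ frontier Ω, curl2 A x = 1)

/-- The open unit disc. -/
def unitDisc : Set Plane := {x : Plane | x.1 ^ 2 + x.2 ^ 2 < 1}

/-- `Δ_B`: distance from `B/2 + ξ₀√B + δ₀` to the nearest integer. -/
def DeltaB (ξ₀ δ₀ B : ℝ) : ℝ :=
  sInf (Set.range (fun m : ℤ => |(m : ℝ) - B / 2 - ξ₀ * Real.sqrt B - δ₀|))

/-- Euclidean distance to the boundary of `Ω`. -/
def distBdry (Ω : Set Plane) (x : Plane) : ℝ :=
  sInf ((fun y => Real.sqrt (esq (x - y))) '' frontier Ω)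

end SC

namespace SC

theorem concaveOn_sInf_sub {ι : Type*} {s : Set ℝ} (hs : Convex ℝ s) {I : Set ι}
    (hI : I.Nonempty) {f : ι → ℝ → ℝ} {h : ℝ → ℝ}
    (hc : ∀ i ∈ I, ConcaveOn ℝ s fun x => f i x - h x)
    (hb : ∀ i ∈ I, ∀ x ∈ s, 0 ≤ f i x) :
    ConcaveOn ℝ s fun x => sInf ((fun i => f i x) '' I) - h x := by
  refine ⟨hs, fun x hx y hy a b ha hb' hab => ?_⟩
  have hz : a • x + b • y ∈ s := hs hx hy ha hb' hab
  have bdd : ∀ z ∈ s, BddBelow ((fun i => f i z) '' I) := fun z hz =>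
    ⟨0, by rintro _ ⟨i, hi, rfl⟩; exact hb i hi z hz⟩
  have key : a • (sInf ((fun i => f i x) '' I) - h x) + b • (sInf ((fun i => f i y) '' I) - h y)
      + h (a • x + b • y) ≤ sInf ((fun i => f i (a • x + b • y)) '' I) := by
    refine le_csInf (hI.image _) ?_
    rintro _ ⟨i, hi, rfl⟩
    have h1 := (hc i hi).2 hx hy ha hb' hab
    have h2 : sInf ((fun i => f i x) '' I) ≤ f i x := csInf_le (bdd x hx) ⟨i, hi, rfl⟩
    have h3 : sInf ((fun i => f i y) '' I) ≤ f i y := csInf_le (bdd y hy) ⟨i, hi, rfl⟩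
    simp only [smul_eq_mul] at *
    nlinarith [mul_le_mul_of_nonneg_left h2 ha, mul_le_mul_of_nonneg_left h3 hb']
  simp only at *
  linarith

theorem concaveOn_quadratic {s : Set ℝ} (hs : Convex ℝ s) (a b c : ℝ) (hc : c ≤ 0) :
    ConcaveOn ℝ s fun x => a + b * x + c * x ^ 2 := by
  refine ⟨hs, fun x _ y _ p q hp hq hpq => ?_⟩
  simp only [smul_eq_mul]
  obtain rfl : q = 1 - p := by linarith
  nlinarith [mul_nonneg (mul_nonneg hp hq) (sq_nonneg (x - y)),
    mul_nonneg (neg_nonneg.2 hc) (mul_nonneg (mul_nonneg hp hq) (sq_nonneg (x - y)))]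

theorem isOpen_unitDisc : IsOpen unitDisc :=
  isOpen_lt (by fun_prop) continuous_const

theorem unitDisc_subset : unitDisc ⊆ {x : Plane | x.1 ^ 2 + x.2 ^ 2 ≤ 1} := fun x hx => by
  simp only [unitDisc, mem_ofPred_eq] at *
  exact hx.le

theorem isCompact_closedDisc : IsCompact {x : Plane | x.1 ^ 2 + x.2 ^ 2 ≤ 1} := by
  refine (isCompact_Icc (a := ((-1, -1) : Plane)) (b := (1, 1))).of_isClosed_subset
    (isClosed_le (by fun_prop) continuous_const) ?_
  rintro ⟨x, y⟩ h
  simp only [mem_ofPred_eq] at h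
  refine ⟨⟨?_, ?_⟩, ⟨?_, ?_⟩⟩ <;> simp only <;> nlinarith [sq_nonneg x, sq_nonneg y]

theorem integrableOn_unitDisc {f : Plane → ℝ} (hf : Continuous f) : IntegrableOn f unitDisc :=
  (hf.continuousOn.integrableOn_compact isCompact_closedDisc).mono_set unitDisc_subset

theorem CNearCl.exists_global {u : Plane → ℂ} (hu : CNearCl 1 unitDisc u) :
    ∃ v : Plane → ℂ, ContDiff ℝ 1 v ∧ ∀ x ∈ unitDisc, v x = u x ∧ fderiv ℝ v x = fderiv ℝ u x := by
  obtain ⟨U, hU, hsub, hcd⟩ := hu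
  obtain ⟨χ, h0, h1, -⟩ := exists_contMDiffMap_zero_one_nhds_of_isClosed (n := 1)
    (modelWithCornersSelf ℝ Plane) (s := Uᶜ) (t := closure unitDisc) hU.isClosed_compl
    isClosed_closure (disjoint_compl_left_iff_subset.2 hsub)
  refine ⟨fun x => χ x • u x, ?_, ?_⟩
  · rw [contDiff_iff_contDiffAt]
    intro x
    by_cases hx : x ∈ U
    · exact (χ.contMDiff.contDiff.contDiffAt).smul (hcd.contDiffAt (hU.mem_nhds hx))
    · have : (fun x => χ x • u x) =ᶠ[𝓝 x] fun _ => 0 := by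
        filter_upwards [h0.filter_mono (nhds_le_nhdsSet (show x ∈ Uᶜ from hx))] with y hy
        simp [hy]
      exact contDiffAt_const.congr_of_eventuallyEq this
  · intro x hx
    have : (fun x => χ x • u x) =ᶠ[𝓝 x] u := by
      filter_upwards [h1.filter_mono (nhds_le_nhdsSet (subset_closure hx))] with y hy
      simp [hy]
    exact ⟨this.eq_of_nhds, this.fderiv_eq⟩

/-- The test functions for `lam1 unitDisc`. -/
def discTest : Set (Plane → ℂ) := {u | ContDiff ℝ 1 u ∧ (∫ x in unitDisc, ‖u x‖ ^ 2) ≠ 0}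

/-- The Rayleigh quotient of the magnetic Neumann Laplacian on the disc. -/
def discQuot (u : Plane → ℂ) (B : ℝ) : ℝ :=
  (∫ x in unitDisc, magSq B F0 u x) / (∫ x in unitDisc, ‖u x‖ ^ 2)

theorem lam1_eq (B : ℝ) : lam1 unitDisc B = sInf ((fun u => discQuot u B) '' discTest) := by
  unfold lam1 lam1A
  congr 1
  ext r
  constructor
  · rintro ⟨u, hu, hne, rfl⟩
    obtain ⟨v, hv, h⟩ := hu.exists_global
    have e1 : ∫ x in unitDisc, ‖v x‖ ^ 2 = ∫ x in unitDisc, ‖u x‖ ^ 2 :=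
      setIntegral_congr_fun isOpen_unitDisc.measurableSet fun x hx => by simp [(h x hx).1]
    have e2 : ∫ x in unitDisc, magSq B F0 v x = ∫ x in unitDisc, magSq B F0 u x :=
      setIntegral_congr_fun isOpen_unitDisc.measurableSet fun x hx => by
        simp [magSq, (h x hx).1, (h x hx).2]
    exact ⟨v, ⟨hv, by rwa [e1]⟩, by simp only [discQuot, e1, e2]⟩
  · rintro ⟨u, ⟨hu, hne⟩, rfl⟩
    exact ⟨u, ⟨univ, isOpen_univ, subset_univ _, hu.contDiffOn⟩, hne, rfl⟩

theorem magSq_nonneg (B : ℝ) (A : Plane → Plane) (u : Plane → ℂ) (x : Plane) :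
    0 ≤ magSq B A u x := by unfold magSq; positivity

theorem discQuot_nonneg (u : Plane → ℂ) (B : ℝ) : 0 ≤ discQuot u B :=
  div_nonneg (integral_nonneg fun _ => magSq_nonneg _ _ _ _)
    (integral_nonneg fun _ => by positivity)

theorem continuous_magSq (B : ℝ) {u : Plane → ℂ} (hu : ContDiff ℝ 1 u) :
    Continuous (magSq B F0 u) := by
  have h1 : Continuous (fun x => fderiv ℝ u x) := hu.continuous_fderiv one_ne_zero
  have h2 := hu.continuous
  unfold magSq F0
  fun_prop

theorem magSq_expand (B : ℝ) (u : Plane → ℂ) (x : Plane) :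
    magSq B F0 u x = magSq 0 F0 u x + ((magSq 1 F0 u x - magSq (-1) F0 u x) / 2) * B
      + (esq (F0 x) * ‖u x‖ ^ 2) * B ^ 2 := by
  simp only [magSq, F0, esq, ← Complex.normSq_eq_norm_sq, Complex.normSq_apply]
  simp
  ring

theorem discTest_nonempty : discTest.Nonempty := by
  refine ⟨fun _ => 1, contDiff_const, ?_⟩
  have h : (volume : Measure Plane) unitDisc ≠ 0 :=
    (isOpen_unitDisc.measure_pos volume ⟨0, by simp [unitDisc]⟩).ne'
  have h' : (volume : Measure Plane) unitDisc ≠ ⊤ :=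
    ((measure_mono unitDisc_subset).trans_lt isCompact_closedDisc.measure_lt_top).ne
  simp [Measure.real, ENNReal.toReal_eq_zero_iff, h, h']

theorem discTest_norm_pos {u : Plane → ℂ} (hu : u ∈ discTest) :
    0 < ∫ x in unitDisc, ‖u x‖ ^ 2 :=
  lt_of_le_of_ne (integral_nonneg fun _ => by positivity) hu.2.symm

theorem concaveOn_discQuot {u : Plane → ℂ} (hu : u ∈ discTest) :
    ConcaveOn ℝ univ fun B => discQuot u B - B ^ 2 / 4 := by
  have hcont := hu.1.continuous
  set n := ∫ x in unitDisc, ‖u x‖ ^ 2 with hn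
  have hpos : 0 < n := discTest_norm_pos hu
  set a := ∫ x in unitDisc, magSq 0 F0 u x
  set b := ∫ x in unitDisc, (magSq 1 F0 u x - magSq (-1) F0 u x) / 2
  set c := ∫ x in unitDisc, esq (F0 x) * ‖u x‖ ^ 2 with hcdef
  have ic0 := integrableOn_unitDisc (continuous_magSq 0 hu.1)
  have icb : Continuous fun x => (magSq 1 F0 u x - magSq (-1) F0 u x) / 2 :=
    ((continuous_magSq 1 hu.1).sub (continuous_magSq (-1) hu.1)).div_const 2
  have icc : Continuous fun x => esq (F0 x) * ‖u x‖ ^ 2 := by unfold esq F0; fun_prop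
  have hE : ∀ B, ∫ x in unitDisc, magSq B F0 u x = a + b * B + c * B ^ 2 := by
    intro B
    simp_rw [fun x => magSq_expand B u x]
    rw [integral_add, integral_add, integral_mul_const, integral_mul_const]
    · exact ic0
    · exact integrableOn_unitDisc (by fun_prop)
    · exact ic0.add (integrableOn_unitDisc (by fun_prop))
    · exact integrableOn_unitDisc (by fun_prop)
  have hc : c ≤ n / 4 := by
    rw [hn, hcdef, ← integral_div]
    refine setIntegral_mono_on (integrableOn_unitDisc icc) (integrableOn_unitDisc (by fun_prop))
      isOpen_unitDisc.measurableSet fun x hx => ?_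
    have : esq (F0 x) ≤ 1 / 4 := by
      simp only [unitDisc, mem_ofPred_eq] at hx
      simp only [esq, F0]
      nlinarith
    nlinarith [sq_nonneg ‖u x‖]
  have := concaveOn_quadratic convex_univ (a / n) (b / n) (c / n - 1 / 4)
    (by rw [sub_nonpos, div_le_iff₀ hpos]; linarith)
  convert this using 2 with B
  simp only [discQuot, hE, ← hn]
  field_simp
  ring

theorem concaveOn_lam1 : ConcaveOn ℝ univ fun B => lam1 unitDisc B - B ^ 2 / 4 := by
  simp_rw [lam1_eq]
  exact concaveOn_sInf_sub convex_univ discTest_nonempty (fun u hu => concaveOn_discQuot hu)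
    fun u _ B _ => discQuot_nonneg u B

theorem lam1_mul_le {u : Plane → ℂ} (hu : ContDiff ℝ 1 u) (B : ℝ) :
    lam1 unitDisc B * ∫ x in unitDisc, ‖u x‖ ^ 2 ≤ ∫ x in unitDisc, magSq B F0 u x := by
  by_cases h : (∫ x in unitDisc, ‖u x‖ ^ 2) = 0
  · rw [h, mul_zero]
    exact integral_nonneg fun _ => magSq_nonneg _ _ _ _
  · have hm : u ∈ discTest := ⟨hu, h⟩
    rw [← le_div_iff₀ (discTest_norm_pos hm), lam1_eq]
    exact csInf_le ⟨0, by rintro _ ⟨v, _, rfl⟩; exact discQuot_nonneg v B⟩ ⟨u, hm, rfl⟩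

theorem exists_lt_lam1_add (B : ℝ) {η : ℝ} (hη : 0 < η) : ∃ u : Plane → ℂ, ContDiff ℝ 1 u ∧
    ∫ x in unitDisc, magSq B F0 u x
      < (lam1 unitDisc B + η) * ∫ x in unitDisc, ‖u x‖ ^ 2 := by
  obtain ⟨_, ⟨u, hu, rfl⟩, h⟩ := exists_lt_of_csInf_lt
    (discTest_nonempty.image fun u => discQuot u B)
    (show sInf _ < lam1 unitDisc B + η by rw [lam1_eq]; linarith)
  exact ⟨u, hu.1, (div_lt_iff₀ (discTest_norm_pos hu)).1 h⟩

theorem integral_unitDisc {h : Plane → ℝ} (hh : Continuous h) :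
    ∫ x in unitDisc, h x
      = ∫ r in (0 : ℝ)..1, r * ∫ θ in (-Real.pi)..Real.pi,
          h (r * Real.cos θ, r * Real.sin θ) := by
  rw [← integral_indicator isOpen_unitDisc.measurableSet, ← integral_comp_polarCoord_symm]
  have e1 : ∀ p ∈ polarCoord.target, p.1 • unitDisc.indicator h (polarCoord.symm p)
      = ((Ioo (0 : ℝ) 1) ×ˢ (univ : Set ℝ)).indicator
        (fun q : ℝ × ℝ => q.1 * h (q.1 * Real.cos q.2, q.1 * Real.sin q.2)) p := by
    rintro ⟨r, θ⟩ hp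
    have hr : 0 < r := hp.1
    have hiff : (r * Real.cos θ, r * Real.sin θ) ∈ unitDisc ↔ r < 1 := by
      simp only [unitDisc, mem_ofPred_eq]
      have : (r * Real.cos θ) ^ 2 + (r * Real.sin θ) ^ 2 = r ^ 2 := by
        linear_combination r ^ 2 * Real.sin_sq_add_cos_sq θ
      rw [this, sq_lt_one_iff₀ hr.le]
    by_cases h1 : r < 1
    · rw [polarCoord_symm_apply, indicator_of_mem (by exact hiff.2 h1),
        indicator_of_mem (by simp [h1, hr])]
      simp
    · rw [polarCoord_symm_apply, indicator_of_notMem (by exact fun h' => h1 (hiff.1 h')),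
        indicator_of_notMem (by simp [h1])]
      simp
  rw [setIntegral_congr_fun polarCoord.open_target.measurableSet e1,
    setIntegral_indicator (measurableSet_Ioo.prod MeasurableSet.univ)]
  have e2 : polarCoord.target ∩ (Ioo (0 : ℝ) 1) ×ˢ (univ : Set ℝ)
      = Ioo (0 : ℝ) 1 ×ˢ Ioo (-Real.pi) Real.pi := by
    ext ⟨r, θ⟩
    simp [polarCoord_target]
    tauto
  have hc : Continuous (fun q : ℝ × ℝ => q.1 * h (q.1 * Real.cos q.2, q.1 * Real.sin q.2)) := by
    fun_prop
  rw [e2, Measure.volume_eq_prod, setIntegral_prod]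
  · rw [intervalIntegral.integral_of_le zero_le_one, integral_Ioc_eq_integral_Ioo]
    refine setIntegral_congr_fun measurableSet_Ioo fun r _ => ?_
    simp only
    rw [intervalIntegral.integral_of_le (by linarith [Real.pi_pos]),
      integral_Ioc_eq_integral_Ioo, ← integral_const_mul]
  · rw [← Measure.volume_eq_prod]
    exact (hc.continuousOn.integrableOn_compact
      (isCompact_Icc.prod isCompact_Icc)).mono_set
      (prod_mono Ioo_subset_Icc_self Ioo_subset_Icc_self)

/-- The function `u` in polar coordinates. -/
def pol (u : Plane → ℂ) (r θ : ℝ) : ℂ := u (r * Real.cos θ, r * Real.sin θ)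

/-- The radial derivative in polar coordinates. -/
def polR (u : Plane → ℂ) (r θ : ℝ) : ℂ :=
  fderiv ℝ u (r * Real.cos θ, r * Real.sin θ) (Real.cos θ, Real.sin θ)

/-- The normalised angular derivative in polar coordinates. -/
def polT (u : Plane → ℂ) (r θ : ℝ) : ℂ :=
  fderiv ℝ u (r * Real.cos θ, r * Real.sin θ) (-Real.sin θ, Real.cos θ)

/-- The angular magnetic derivative in polar coordinates. -/
def polW (B : ℝ) (u : Plane → ℂ) (r θ : ℝ) : ℂ :=
  -Complex.I * polT u r θ - ((B * r / 2 : ℝ) : ℂ) * pol u r θ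

theorem continuous_pol {u : Plane → ℂ} (hu : ContDiff ℝ 1 u) :
    Continuous (Function.uncurry (pol u)) := by
  have := hu.continuous
  unfold Function.uncurry pol
  fun_prop

theorem continuous_polR {u : Plane → ℂ} (hu : ContDiff ℝ 1 u) :
    Continuous (Function.uncurry (polR u)) := by
  have := hu.continuous_fderiv one_ne_zero
  unfold Function.uncurry polR
  fun_prop

theorem continuous_polT {u : Plane → ℂ} (hu : ContDiff ℝ 1 u) :
    Continuous (Function.uncurry (polT u)) := by
  have := hu.continuous_fderiv one_ne_zero
  unfold Function.uncurry polT
  fun_prop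

theorem continuous_polW (B : ℝ) {u : Plane → ℂ} (hu : ContDiff ℝ 1 u) :
    Continuous (Function.uncurry (polW B u)) := by
  have h1 := continuous_pol hu
  have h2 := continuous_polT hu
  unfold Function.uncurry at h1 h2 ⊢
  unfold polW
  fun_prop

theorem hasDerivAt_pol_left {u : Plane → ℂ} (hu : ContDiff ℝ 1 u) (r θ : ℝ) :
    HasDerivAt (fun s => pol u s θ) (polR u r θ) r := by
  have h1 : HasDerivAt (fun s : ℝ => ((s * Real.cos θ, s * Real.sin θ) : Plane))
      (Real.cos θ, Real.sin θ) r := by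
    have h2 := ((hasDerivAt_id r).mul_const (Real.cos θ)).prodMk
      ((hasDerivAt_id r).mul_const (Real.sin θ))
    simpa using h2
  exact ((hu.differentiable one_ne_zero _).hasFDerivAt).comp_hasDerivAt r h1

theorem hasDerivAt_pol_right {u : Plane → ℂ} (hu : ContDiff ℝ 1 u) (r θ : ℝ) :
    HasDerivAt (fun s => pol u r s) ((r : ℂ) * polT u r θ) θ := by
  have h1 : HasDerivAt (fun s : ℝ => ((r * Real.cos s, r * Real.sin s) : Plane))
      (r • (-Real.sin θ, Real.cos θ)) θ := by
    have h2 := ((Real.hasDerivAt_cos θ).const_mul r).prodMk ((Real.hasDerivAt_sin θ).const_mul r)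
    simpa using h2
  have := ((hu.differentiable one_ne_zero _).hasFDerivAt).comp_hasDerivAt θ h1
  rw [map_smul, Complex.real_smul] at this
  exact this

theorem magSq_polar (B : ℝ) (u : Plane → ℂ) (r θ : ℝ) :
    magSq B F0 u (r * Real.cos θ, r * Real.sin θ) = ‖polR u r θ‖ ^ 2 + ‖polW B u r θ‖ ^ 2 := by
  set D := fderiv ℝ u (r * Real.cos θ, r * Real.sin θ) with hD
  have hlin : ∀ a b : ℝ, D (a, b) = (a : ℂ) * D (1, 0) + (b : ℂ) * D (0, 1) := by
    intro a b
    have : ((a, b) : Plane) = a • ((1 : ℝ), (0 : ℝ)) + b • ((0 : ℝ), (1 : ℝ)) := by simp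
    rw [this, map_add, map_smul, map_smul]
    simp
  have hcs := Real.sin_sq_add_cos_sq θ
  simp only [magSq, polW, polR, polT, pol, ← hD, F0]
  rw [hlin (Real.cos θ), hlin (-Real.sin θ)]
  generalize D (1, 0) = p
  generalize D (0, 1) = q
  generalize u (r * Real.cos θ, r * Real.sin θ) = w
  generalize Real.cos θ = c at *
  generalize Real.sin θ = s at *
  simp only [← Complex.normSq_eq_norm_sq, Complex.normSq_apply]
  simp
  obtain ⟨p1, p2⟩ := p
  obtain ⟨q1, q2⟩ := q
  obtain ⟨w1, w2⟩ := w
  simp only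
  linear_combination (-(p1 ^ 2 + p2 ^ 2 + q1 ^ 2 + q2 ^ 2)
    + B ^ 2 * r ^ 2 / 4 * (w1 ^ 2 + w2 ^ 2)) * hcs

/-- The (unnormalised) Fourier coefficient of order `m` in the angular variable. -/
def mode (m : ℤ) (f : ℝ → ℂ) : ℂ :=
  ∫ θ in (-Real.pi)..Real.pi, Complex.exp (-(m * θ * Complex.I)) * f θ

theorem mode_eq (m : ℤ) (f : ℝ → ℂ) :
    mode m f = (2 * Real.pi : ℝ) •
      fourierCoeffOn (show -Real.pi < Real.pi by linarith [Real.pi_pos]) f m := by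
  rw [fourierCoeffOn_eq_integral, smul_smul]
  have h : (2 * Real.pi) * (1 / (Real.pi - -Real.pi)) = 1 := by
    have := Real.pi_pos
    field_simp
    ring
  rw [h, one_smul]
  unfold mode
  congr 1
  ext θ
  rw [fourier_coe_apply, smul_eq_mul]
  congr 2
  have := Real.pi_ne_zero
  have : (Real.pi : ℂ) ≠ 0 := by exact_mod_cast this
  push_cast
  field_simp
  ring

theorem hasSum_mode {f : ℝ → ℂ} (hf : Continuous f) :
    HasSum (fun m : ℤ => ‖mode m f‖ ^ 2)
      (2 * Real.pi * ∫ θ in (-Real.pi)..Real.pi, ‖f θ‖ ^ 2) := by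
  have hlt : -Real.pi < Real.pi := by linarith [Real.pi_pos]
  have hm : MemLp f 2 (volume.restrict (Ioc (-Real.pi) Real.pi)) := by
    rw [memLp_two_iff_integrable_sq_norm hf.aestronglyMeasurable]
    exact ((hf.norm.pow 2).continuousOn.integrableOn_compact isCompact_Icc).mono_set
      Ioc_subset_Icc_self
  have h := (hasSum_sq_fourierCoeffOn hlt hm).mul_left ((2 * Real.pi) ^ 2)
  have hpi := Real.pi_pos
  have e1 : (fun m : ℤ => ‖mode m f‖ ^ 2)
      = fun m => (2 * Real.pi) ^ 2 * ‖fourierCoeffOn hlt f m‖ ^ 2 := by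
    ext m
    rw [mode_eq, norm_smul, mul_pow, Real.norm_eq_abs, sq_abs]
  have e2 : 2 * Real.pi * (∫ θ in (-Real.pi)..Real.pi, ‖f θ‖ ^ 2) = (2 * Real.pi) ^ 2 *
      (Real.pi - -Real.pi)⁻¹ • ∫ θ in (-Real.pi)..Real.pi, ‖f θ‖ ^ 2 := by
    rw [smul_eq_mul, ← mul_assoc]
    congr 1
    field_simp
    ring
  rw [e1, e2]
  exact h

theorem continuous_mode (m : ℤ) {V : ℝ → ℝ → ℂ} (hV : Continuous (Function.uncurry V)) :
    Continuous fun r => mode m (V r) := by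
  unfold mode
  apply intervalIntegral.continuous_parametric_intervalIntegral_of_continuous'
  unfold Function.uncurry at *
  fun_prop

theorem hasDerivAt_mode (m : ℤ) {u : Plane → ℂ} (hu : ContDiff ℝ 1 u) (r : ℝ) :
    HasDerivAt (fun s => mode m (pol u s)) (mode m (polR u r)) r := by
  have hU := continuous_pol hu
  have hR := continuous_polR hu
  unfold Function.uncurry at hU hR
  have hcR : Continuous (fun p : ℝ × ℝ => Complex.exp (-(m * p.2 * Complex.I)) * polR u p.1 p.2) := by
    fun_prop
  obtain ⟨C, hC⟩ := ((isCompact_Icc (a := r - 1) (b := r + 1)).prod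
    (isCompact_Icc (a := -Real.pi) (b := Real.pi))).exists_bound_of_continuousOn hcR.continuousOn
  have hle : -Real.pi ≤ Real.pi := by linarith [Real.pi_pos]
  refine (intervalIntegral.hasDerivAt_integral_of_dominated_loc_of_deriv_le
    (F := fun s θ => Complex.exp (-(m * θ * Complex.I)) * pol u s θ)
    (F' := fun s θ => Complex.exp (-(m * θ * Complex.I)) * polR u s θ)
    (bound := fun _ => C) (s := Icc (r - 1) (r + 1))
    (Icc_mem_nhds (by linarith) (by linarith)) ?_ ?_ ?_ ?_ ?_ ?_).2
  · refine Eventually.of_forall fun s => Continuous.aestronglyMeasurable ?_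
    have : Continuous (pol u s) := hU.comp (Continuous.prodMk_right s)
    fun_prop
  · refine Continuous.intervalIntegrable ?_ _ _
    have : Continuous (pol u r) := hU.comp (Continuous.prodMk_right r)
    fun_prop
  · refine Continuous.aestronglyMeasurable ?_
    have : Continuous (polR u r) := hR.comp (Continuous.prodMk_right r)
    fun_prop
  · refine Eventually.of_forall fun θ hθ s hs => hC (s, θ) ⟨hs, ?_⟩
    rw [uIoc_of_le hle] at hθ
    exact Ioc_subset_Icc_self hθ
  · exact intervalIntegrable_const
  · exact Eventually.of_forall fun θ _ s _ => (hasDerivAt_pol_left hu s θ).const_mul _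

theorem mode_polT (m : ℤ) {u : Plane → ℂ} (hu : ContDiff ℝ 1 u) (r : ℝ) :
    (r : ℂ) * mode m (polT u r) = m * Complex.I * mode m (pol u r) := by
  have hU := (continuous_pol hu).comp (Continuous.prodMk_right r)
  have hT := (continuous_polT hu).comp (Continuous.prodMk_right r)
  simp only [Function.comp_def, Function.uncurry] at hU hT
  have hd : ∀ θ : ℝ, HasDerivAt (fun θ : ℝ => Complex.exp (-(m * θ * Complex.I)) * pol u r θ)
      ((Complex.exp (-(m * θ * Complex.I)) * (-(m * Complex.I))) * pol u r θ
        + Complex.exp (-(m * θ * Complex.I)) * (r * polT u r θ)) θ := by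
    intro θ
    refine HasDerivAt.mul ?_ (hasDerivAt_pol_right hu r θ)
    have h1 : HasDerivAt (fun θ : ℝ => (-(m * (θ : ℂ) * Complex.I))) (-(m * Complex.I)) θ := by
      have := (((hasDerivAt_id (θ : ℂ)).const_mul (m : ℂ)).mul_const Complex.I).neg.comp_ofReal
      simpa using this
    exact h1.cexp
  have h := intervalIntegral.integral_eq_sub_of_hasDerivAt (a := -Real.pi) (b := Real.pi)
    (fun θ _ => hd θ) (Continuous.intervalIntegrable (by fun_prop) _ _)
  rw [intervalIntegral.integral_add (Continuous.intervalIntegrable (by fun_prop) _ _)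
    (Continuous.intervalIntegrable (by fun_prop) _ _)] at h
  have hb : Complex.exp (-(m * (Real.pi : ℝ) * Complex.I)) * pol u r Real.pi
      - Complex.exp (-(m * (-Real.pi : ℝ) * Complex.I)) * pol u r (-Real.pi) = 0 := by
    have e1 : pol u r (-Real.pi) = pol u r Real.pi := by simp [pol]
    have e2 : Complex.exp (-(m * (-Real.pi : ℝ) * Complex.I))
        = Complex.exp (-(m * (Real.pi : ℝ) * Complex.I)) := by
      rw [Complex.exp_eq_exp_iff_exists_int]
      exact ⟨m, by push_cast; ring⟩
    rw [e1, e2, sub_self]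
  rw [hb] at h
  have e3 : ∀ θ : ℝ, Complex.exp (-(m * θ * Complex.I)) * (-(m * Complex.I)) * pol u r θ
      = -(m * Complex.I) * (Complex.exp (-(m * θ * Complex.I)) * pol u r θ) := fun θ => by ring
  have e4 : ∀ θ : ℝ, Complex.exp (-(m * θ * Complex.I)) * (r * polT u r θ)
      = r * (Complex.exp (-(m * θ * Complex.I)) * polT u r θ) := fun θ => by ring
  simp only [e3, e4, intervalIntegral.integral_const_mul] at h
  unfold mode
  linear_combination h

theorem mode_polW (B : ℝ) (m : ℤ) {u : Plane → ℂ} (hu : ContDiff ℝ 1 u) {r : ℝ} (hr : r ≠ 0) :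
    mode m (polW B u r) = ((m / r - B * r / 2 : ℝ) : ℂ) * mode m (pol u r) := by
  have hU := (continuous_pol hu).comp (Continuous.prodMk_right r)
  have hT := (continuous_polT hu).comp (Continuous.prodMk_right r)
  simp only [Function.comp_def, Function.uncurry] at hU hT
  have e : mode m (polW B u r)
      = -Complex.I * mode m (polT u r) - ((B * r / 2 : ℝ) : ℂ) * mode m (pol u r) := by
    unfold mode
    rw [← intervalIntegral.integral_const_mul, ← intervalIntegral.integral_const_mul,
      ← intervalIntegral.integral_sub (Continuous.intervalIntegrable (by fun_prop) _ _)
        (Continuous.intervalIntegrable (by fun_prop) _ _)]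
    congr 1
    ext θ
    unfold polW
    ring
  have hr' : (r : ℂ) ≠ 0 := by exact_mod_cast hr
  have h := mode_polT m hu r
  have h2 : mode m (polT u r) = m * Complex.I * mode m (pol u r) / r := by
    rw [← h]; field_simp
  rw [e, h2]
  push_cast
  field_simp
  linear_combination (-2 * m * mode m (pol u r)) * Complex.I_sq

theorem exists_mode_lt (B Λ : ℝ) {u : Plane → ℂ} (hu : ContDiff ℝ 1 u)
    (h : ∫ x in unitDisc, magSq B F0 u x < Λ * ∫ x in unitDisc, ‖u x‖ ^ 2) :
    ∃ m : ℤ, ∫ r in (0 : ℝ)..1, (‖mode m (polR u r)‖ ^ 2 + ‖mode m (polW B u r)‖ ^ 2) * r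
      < Λ * ∫ r in (0 : ℝ)..1, ‖mode m (pol u r)‖ ^ 2 * r := by
  by_contra! hcon
  have hU := continuous_pol hu
  have hR := continuous_polR hu
  have hW := continuous_polW B hu
  have hpi := Real.pi_pos
  have sU : ∀ r, Continuous (pol u r) := fun r => hU.comp (Continuous.prodMk_right r)
  have sR : ∀ r, Continuous (polR u r) := fun r => hR.comp (Continuous.prodMk_right r)
  have sW : ∀ r, Continuous (polW B u r) := fun r => hW.comp (Continuous.prodMk_right r)
  have mU := fun m => continuous_mode m hU
  have mR := fun m => continuous_mode m hR
  have mW := fun m => continuous_mode m hW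
  have cU : Continuous fun r => ∫ θ in (-Real.pi)..Real.pi, ‖pol u r θ‖ ^ 2 :=
    intervalIntegral.continuous_parametric_intervalIntegral_of_continuous' (by
      unfold Function.uncurry at *; fun_prop) _ _
  have cE : Continuous fun r => ∫ θ in (-Real.pi)..Real.pi,
      (‖polR u r θ‖ ^ 2 + ‖polW B u r θ‖ ^ 2) :=
    intervalIntegral.continuous_parametric_intervalIntegral_of_continuous' (by
      unfold Function.uncurry at *; fun_prop) _ _
  have hN : HasSum (fun m : ℤ => ∫ r in (0 : ℝ)..1, ‖mode m (pol u r)‖ ^ 2 * r)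
      (∫ r in (0 : ℝ)..1, (2 * Real.pi * ∫ θ in (-Real.pi)..Real.pi, ‖pol u r θ‖ ^ 2) * r) := by
    have hs : ∀ r, HasSum (fun m : ℤ => ‖mode m (pol u r)‖ ^ 2 * r)
        ((2 * Real.pi * ∫ θ in (-Real.pi)..Real.pi, ‖pol u r θ‖ ^ 2) * r) :=
      fun r => (hasSum_mode (sU r)).mul_right r
    refine intervalIntegral.hasSum_integral_of_dominated_convergence
      (fun (m : ℤ) r => ‖mode m (pol u r)‖ ^ 2 * r) (fun m => ?_) (fun m => ?_) ?_ ?_ ?_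
    · exact (((mU m).norm.pow 2).mul continuous_id).aestronglyMeasurable
    · refine Eventually.of_forall fun r hr => ?_
      rw [uIoc_of_le zero_le_one] at hr
      rw [Real.norm_of_nonneg (mul_nonneg (sq_nonneg _) hr.1.le)]
    · exact Eventually.of_forall fun r _ => (hs r).summable
    · simp_rw [fun r => (hs r).tsum_eq]
      exact Continuous.intervalIntegrable (by fun_prop) _ _
    · exact Eventually.of_forall fun r _ => hs r
  have hle : Λ * (∫ r in (0 : ℝ)..1,
        (2 * Real.pi * ∫ θ in (-Real.pi)..Real.pi, ‖pol u r θ‖ ^ 2) * r)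
      ≤ ∫ r in (0 : ℝ)..1, (2 * Real.pi * ∫ θ in (-Real.pi)..Real.pi,
          (‖polR u r θ‖ ^ 2 + ‖polW B u r θ‖ ^ 2)) * r := by
    refine hasSum_le_of_sum_le (hN.mul_left Λ) fun s => ?_
    refine (Finset.sum_le_sum fun m _ => hcon m).trans ?_
    rw [← intervalIntegral.integral_finsetSum fun m _ => Continuous.intervalIntegrable (by
      have := mR m; have := mW m; fun_prop) _ _]
    refine intervalIntegral.integral_mono_on zero_le_one
      (Continuous.intervalIntegrable (by fun_prop) _ _)
      (Continuous.intervalIntegrable (by fun_prop) _ _) fun r hr => ?_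
    rw [← Finset.sum_mul]
    refine mul_le_mul_of_nonneg_right ?_ hr.1
    rw [intervalIntegral.integral_add (Continuous.intervalIntegrable (by
      have := sR r; fun_prop) _ _) (Continuous.intervalIntegrable (by
      have := sW r; fun_prop) _ _), mul_add, Finset.sum_add_distrib]
    exact add_le_add (sum_le_hasSum _ (fun _ _ => sq_nonneg _) (hasSum_mode (sR r)))
      (sum_le_hasSum _ (fun _ _ => sq_nonneg _) (hasSum_mode (sW r)))
  rw [integral_unitDisc (continuous_magSq B hu),
    integral_unitDisc (h := fun x => ‖u x‖ ^ 2) (hu.continuous.norm.pow 2)] at h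
  simp_rw [magSq_polar] at h
  have e1 : ∀ g : ℝ → ℝ, ∫ r in (0 : ℝ)..1, (2 * Real.pi * g r) * r
      = (2 * Real.pi) * ∫ r in (0 : ℝ)..1, r * g r := fun g => by
    rw [← intervalIntegral.integral_const_mul]
    congr 1; ext r; ring
  rw [e1, e1] at hle
  simp only [pol] at hle
  nlinarith

/-- Real-valued form of the selection of a Fourier mode. -/
theorem exists_real_mode_lt (B Λ : ℝ) {u : Plane → ℂ} (hu : ContDiff ℝ 1 u)
    (h : ∫ x in unitDisc, magSq B F0 u x < Λ * ∫ x in unitDisc, ‖u x‖ ^ 2) :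
    ∃ (m : ℤ) (g p : ℝ → ℝ), ContDiff ℝ 1 g ∧ Continuous p ∧
      (∀ r, r ≠ 0 → p r = (m / r - B * r / 2) * g r) ∧
      ∫ r in (0 : ℝ)..1, (deriv g r ^ 2 + p r ^ 2) * r
        < Λ * ∫ r in (0 : ℝ)..1, g r ^ 2 * r := by
  obtain ⟨m, hm⟩ := exists_mode_lt B Λ hu h
  have mU := continuous_mode m (continuous_pol hu)
  have mR := continuous_mode m (continuous_polR hu)
  have mW := continuous_mode m (continuous_polW B hu)
  have hre : ∀ r, HasDerivAt (fun s => (mode m (pol u s)).re) (mode m (polR u r)).re r := fun r =>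
    (Complex.reCLM.hasFDerivAt.comp_hasDerivAt r (hasDerivAt_mode m hu r))
  have him : ∀ r, HasDerivAt (fun s => (mode m (pol u s)).im) (mode m (polR u r)).im r := fun r =>
    (Complex.imCLM.hasFDerivAt.comp_hasDerivAt r (hasDerivAt_mode m hu r))
  have c1 := Complex.continuous_re.comp mU
  have c2 := Complex.continuous_re.comp mR
  have c3 := Complex.continuous_re.comp mW
  have c4 := Complex.continuous_im.comp mU
  have c5 := Complex.continuous_im.comp mR
  have c6 := Complex.continuous_im.comp mW
  simp only [Function.comp_def] at c1 c2 c3 c4 c5 c6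
  have cd : ∀ {f f' : ℝ → ℝ}, (∀ r, HasDerivAt f (f' r) r) → Continuous f' →
      ContDiff ℝ 1 f := fun hf hc => contDiff_one_iff_deriv.2
        ⟨fun r => (hf r).differentiableAt, by rwa [show deriv _ = _ from funext fun r => (hf r).deriv]⟩
  have e : ∀ z : ℂ, ‖z‖ ^ 2 = z.re ^ 2 + z.im ^ 2 := fun z => by
    rw [← Complex.normSq_eq_norm_sq, Complex.normSq_apply]; ring
  have split1 : ∫ r in (0 : ℝ)..1, (‖mode m (polR u r)‖ ^ 2 + ‖mode m (polW B u r)‖ ^ 2) * r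
      = (∫ r in (0 : ℝ)..1, ((mode m (polR u r)).re ^ 2 + (mode m (polW B u r)).re ^ 2) * r)
      + ∫ r in (0 : ℝ)..1, ((mode m (polR u r)).im ^ 2 + (mode m (polW B u r)).im ^ 2) * r := by
    rw [← intervalIntegral.integral_add (Continuous.intervalIntegrable (by fun_prop) _ _)
      (Continuous.intervalIntegrable (by fun_prop) _ _)]
    congr 1; ext r; rw [e, e]; ring
  have split2 : ∫ r in (0 : ℝ)..1, ‖mode m (pol u r)‖ ^ 2 * r
      = (∫ r in (0 : ℝ)..1, (mode m (pol u r)).re ^ 2 * r)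
      + ∫ r in (0 : ℝ)..1, (mode m (pol u r)).im ^ 2 * r := by
    rw [← intervalIntegral.integral_add (Continuous.intervalIntegrable (by fun_prop) _ _)
      (Continuous.intervalIntegrable (by fun_prop) _ _)]
    congr 1; ext r; rw [e]; ring
  rw [split1, split2, mul_add] at hm
  have hW : ∀ r, r ≠ 0 → mode m (polW B u r) = ((m / r - B * r / 2 : ℝ) : ℂ) * mode m (pol u r) :=
    fun r hr => mode_polW B m hu hr
  by_cases hc : ∫ r in (0 : ℝ)..1, ((mode m (polR u r)).re ^ 2 + (mode m (polW B u r)).re ^ 2) * r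
      < Λ * ∫ r in (0 : ℝ)..1, (mode m (pol u r)).re ^ 2 * r
  · refine ⟨m, _, _, cd hre c2, c3, fun r hr => ?_, ?_⟩
    · rw [hW r hr, Complex.re_ofReal_mul]
    · simpa only [fun r => (hre r).deriv] using hc
  · refine ⟨m, _, _, cd him c5, c6, fun r hr => ?_, ?_⟩
    · rw [hW r hr, Complex.im_ofReal_mul]
    · simp only [fun r => (him r).deriv]
      linarith

theorem exists_deriv_smoothTransition_le : ∃ M : ℝ, 0 < M ∧
    ∀ x, 0 ≤ deriv Real.smoothTransition x ∧ deriv Real.smoothTransition x ≤ M := by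
  have hc : Continuous (deriv Real.smoothTransition) :=
    (Real.smoothTransition.contDiff (n := 1)).continuous_deriv le_rfl
  obtain ⟨C, hC⟩ := (isCompact_Icc (a := (0 : ℝ)) (b := 1)).exists_bound_of_continuousOn
    hc.continuousOn
  refine ⟨max C 1, by positivity, fun x => ⟨Real.smoothTransition.monotone.deriv_nonneg, ?_⟩⟩
  by_cases hx : x ∈ Icc (0 : ℝ) 1
  · exact (le_abs_self _).trans ((hC x hx).trans (le_max_left _ _))
  · have h0 : deriv Real.smoothTransition x = 0 := by
      rw [mem_Icc, not_and_or, not_le, not_le] at hx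
      rcases hx with hx | hx
      · have : Real.smoothTransition =ᶠ[𝓝 x] fun _ => 0 := by
          filter_upwards [Iio_mem_nhds hx] with y hy
          exact Real.smoothTransition.zero_of_nonpos (le_of_lt hy)
        rw [this.deriv_eq, deriv_const]
      · have : Real.smoothTransition =ᶠ[𝓝 x] fun _ => 1 := by
          filter_upwards [Ioi_mem_nhds hx] with y hy
          exact Real.smoothTransition.one_of_one_le (le_of_lt hy)
        rw [this.deriv_eq, deriv_const]
    rw [h0]
    exact zero_le_one.trans (le_max_right _ _)

/-- Cutoff functions vanishing near the origin with small two-dimensional capacity. -/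
theorem exists_log_cutoff {δ : ℝ} (hδ : 0 < δ) : ∃ ζ : ℝ → ℝ, ContDiff ℝ 1 ζ ∧
    (∃ ε > 0, ∀ r ≤ ε, ζ r = 0) ∧ (∀ r, 0 ≤ ζ r ∧ ζ r ≤ 1) ∧
    (∫ r in (0 : ℝ)..1, deriv ζ r ^ 2 * r) ≤ δ ∧
    ∀ r, 0 ≤ r → (1 - ζ r ^ 2) * r ≤ δ := by
  obtain ⟨M, hM, hS⟩ := exists_deriv_smoothTransition_le
  obtain ⟨n, hn⟩ := exists_nat_gt (max (M / δ) (max (-Real.log δ) 0))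
  have hn1 : M / δ < n := (le_max_left _ _).trans_lt hn
  have hn2 : -Real.log δ < n := ((le_max_left _ _).trans (le_max_right _ _)).trans_lt hn
  have hn0 : (0 : ℝ) < n := ((le_max_right _ _).trans (le_max_right _ _)).trans_lt hn
  have hMn : M / n ≤ δ := by
    rw [div_le_iff₀ hn0]; rw [div_lt_iff₀ hδ] at hn1; linarith
  have hexp : Real.exp (-n) ≤ δ := by
    rw [← Real.exp_log hδ]; exact Real.exp_le_exp.2 (by linarith)
  set ζ : ℝ → ℝ := fun r => if r ≤ 0 then 0 else Real.smoothTransition (2 + Real.log r / n) with hζ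
  have hz : ∀ r ≤ Real.exp (-(2 * n)), ζ r = 0 := by
    intro r hr
    simp only [hζ]
    split_ifs with h
    · rfl
    · apply Real.smoothTransition.zero_of_nonpos
      have : Real.log r ≤ -(2 * n) := by
        rw [← Real.log_exp (-(2 * n : ℝ))]
        exact Real.log_le_log (not_le.1 h) hr
      have : Real.log r / n ≤ -2 := by rw [div_le_iff₀ hn0]; linarith
      linarith
  have hpos : ∀ r, 0 < r → ζ =ᶠ[𝓝 r] fun r => Real.smoothTransition (2 + Real.log r / n) := by
    intro r hr
    filter_upwards [Ioi_mem_nhds hr] with y hy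
    simp [hζ, not_le.2 (mem_Ioi.1 hy)]
  have hd : ∀ r, 0 < r → HasDerivAt ζ
      (deriv Real.smoothTransition (2 + Real.log r / n) * (r⁻¹ / n)) r := by
    intro r hr
    refine HasDerivAt.congr_of_eventuallyEq ?_ (hpos r hr)
    have h1 := ((Real.hasDerivAt_log hr.ne').div_const (n : ℝ)).const_add 2
    exact HasDerivAt.comp r ((Real.smoothTransition.contDiff (n := 1)).differentiable
      one_ne_zero _).hasDerivAt h1
  have hcd : ContDiff ℝ 1 ζ := by
    rw [contDiff_iff_contDiffAt]
    intro r
    by_cases hr : 0 < r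
    · refine ContDiffAt.congr_of_eventuallyEq ?_ (hpos r hr)
      exact Real.smoothTransition.contDiff.contDiffAt.comp r
        (contDiffAt_const.add ((Real.contDiffAt_log.2 hr.ne').div_const _))
    · have : ζ =ᶠ[𝓝 r] fun _ => 0 := by
        filter_upwards [Iio_mem_nhds (show r < Real.exp (-(2 * n)) from
          (not_lt.1 hr).trans_lt (Real.exp_pos _))] with y hy
        exact hz y (le_of_lt hy)
      exact contDiffAt_const.congr_of_eventuallyEq this
  have hb : ∀ r, 0 ≤ ζ r ∧ ζ r ≤ 1 := by
    intro r
    simp only [hζ]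
    split_ifs
    · simp
    · exact ⟨Real.smoothTransition.nonneg _, Real.smoothTransition.le_one _⟩
  refine ⟨ζ, hcd, ⟨_, Real.exp_pos _, hz⟩, hb, ?_, fun r hr => ?_⟩
  · have hcont := hcd.continuous_deriv le_rfl
    calc ∫ r in (0 : ℝ)..1, deriv ζ r ^ 2 * r ≤ ∫ r in (0 : ℝ)..1, M / n * deriv ζ r := by
          refine intervalIntegral.integral_mono_on zero_le_one
            (Continuous.intervalIntegrable (by fun_prop) _ _)
            (Continuous.intervalIntegrable (by fun_prop) _ _) fun r hr => ?_
          rcases hr.1.eq_or_lt with h | h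
          · subst h
            have : deriv ζ 0 = 0 := by
              have h0 : ζ =ᶠ[𝓝 0] fun _ => 0 := by
                filter_upwards [Iio_mem_nhds (Real.exp_pos (-(2 * n : ℝ)))] with y hy
                exact hz y (le_of_lt hy)
              rw [h0.deriv_eq, deriv_const]
            simp [this]
          · rw [(hd r h).deriv]
            obtain ⟨h1, h2⟩ := hS (2 + Real.log r / n)
            have h3 : (deriv Real.smoothTransition (2 + Real.log r / n) * (r⁻¹ / n)) ^ 2 * r
              = deriv Real.smoothTransition (2 + Real.log r / n) / n *
                (deriv Real.smoothTransition (2 + Real.log r / n) * (r⁻¹ / n)) := by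
              field_simp
            rw [h3]
            gcongr
      _ = M / n * (ζ 1 - ζ 0) := by
          rw [intervalIntegral.integral_const_mul, intervalIntegral.integral_deriv_eq_sub
            (fun x _ => hcd.differentiable one_ne_zero x) (hcont.intervalIntegrable _ _)]
      _ ≤ M / n * 1 := by
          gcongr
          linarith [(hb 1).2, (hb 0).1]
      _ ≤ δ := by linarith
  · by_cases h : r ≤ Real.exp (-n)
    · nlinarith [sq_nonneg (ζ r)]
    · have : ζ r = 1 := by
        have hr : 0 < r := (Real.exp_pos _).trans (not_le.1 h)
        simp only [hζ, not_le.2 hr, if_false]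
        apply Real.smoothTransition.one_of_one_le
        have : -(n : ℝ) ≤ Real.log r := by
          rw [← Real.log_exp (-(n : ℝ))]
          exact Real.log_le_log (Real.exp_pos _) (not_le.1 h).le
        have : -1 ≤ Real.log r / n := by rw [le_div_iff₀ hn0]; linarith
        linarith
      rw [this]
      linarith

theorem exists_radial_lt {B Λ : ℝ} (hΛ : 0 ≤ Λ) {u : Plane → ℂ} (hu : ContDiff ℝ 1 u)
    (h : ∫ x in unitDisc, magSq B F0 u x < Λ * ∫ x in unitDisc, ‖u x‖ ^ 2) :
    ∃ (m : ℤ) (g : ℝ → ℝ), ContDiff ℝ 1 g ∧ (∃ ε > 0, ∀ r ≤ ε, g r = 0) ∧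
      ∫ r in (0 : ℝ)..1, (deriv g r ^ 2 + ((m / r - B * r / 2) * g r) ^ 2) * r
        < Λ * ∫ r in (0 : ℝ)..1, g r ^ 2 * r := by
  obtain ⟨m, g, p, hg, hp, hpg, hlt⟩ := exists_real_mode_lt B Λ hu h
  have hgc := hg.continuous
  have hg' := hg.continuous_deriv le_rfl
  obtain ⟨G, hG⟩ := (isCompact_Icc (a := (0 : ℝ)) (b := 1)).exists_bound_of_continuousOn
    hgc.continuousOn
  have hG2 : ∀ r ∈ Icc (0 : ℝ) 1, g r ^ 2 ≤ G ^ 2 := fun r hr => by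
    rw [← sq_abs]; exact pow_le_pow_left₀ (abs_nonneg _) (hG r hr) 2
  set E := ∫ r in (0 : ℝ)..1, (deriv g r ^ 2 + p r ^ 2) * r with hE
  set N := ∫ r in (0 : ℝ)..1, g r ^ 2 * r with hN
  have hlim : Tendsto (fun ε : ℝ => Λ * N - (1 + ε) * E) (𝓝[>] 0) (𝓝 (Λ * N - (1 + 0) * E)) :=
    (Continuous.tendsto (by fun_prop) 0).mono_left nhdsWithin_le_nhds
  obtain ⟨ε, hε1, hε⟩ := ((hlim.eventually_const_lt
    (show 0 < Λ * N - (1 + 0) * E by linarith)).and self_mem_nhdsWithin).exists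
  have hlim2 : Tendsto (fun δ : ℝ => Λ * (N - G ^ 2 * δ) - (1 + ε) * E - (1 + ε⁻¹) * G ^ 2 * δ)
      (𝓝[>] 0) (𝓝 (Λ * (N - G ^ 2 * 0) - (1 + ε) * E - (1 + ε⁻¹) * G ^ 2 * 0)) :=
    (Continuous.tendsto (by fun_prop) 0).mono_left nhdsWithin_le_nhds
  obtain ⟨δ, hδ1, hδ⟩ := ((hlim2.eventually_const_lt
    (show 0 < Λ * (N - G ^ 2 * 0) - (1 + ε) * E - (1 + ε⁻¹) * G ^ 2 * 0 by linarith)).and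
    self_mem_nhdsWithin).exists
  obtain ⟨ζ, hζ, ⟨ε₀, hε₀, hz⟩, hb, hcap, hsmall⟩ := exists_log_cutoff hδ
  have hζc := hζ.continuous
  have hζ' := hζ.continuous_deriv le_rfl
  refine ⟨m, fun r => ζ r * g r, hζ.mul hg, ⟨ε₀, hε₀, fun r hr => by simp [hz r hr]⟩, ?_⟩
  have hder : ∀ r, deriv (fun r => ζ r * g r) r = deriv ζ r * g r + ζ r * deriv g r := fun r =>
    deriv_mul (hζ.differentiable one_ne_zero r) (hg.differentiable one_ne_zero r)
  have h1 : ∫ r in (0 : ℝ)..1, (deriv (fun r => ζ r * g r) r ^ 2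
      + ((m / r - B * r / 2) * (ζ r * g r)) ^ 2) * r ≤ (1 + ε) * E + (1 + ε⁻¹) * G ^ 2 * δ := by
    have e : ∀ r ∈ Ioc (0 : ℝ) 1, (deriv (fun r => ζ r * g r) r ^ 2
        + ((m / r - B * r / 2) * (ζ r * g r)) ^ 2) * r
        = ((deriv ζ r * g r + ζ r * deriv g r) ^ 2 + (ζ r * p r) ^ 2) * r := fun r hr => by
      rw [hder, hpg r hr.1.ne']; ring
    rw [intervalIntegral.integral_of_le zero_le_one, setIntegral_congr_fun measurableSet_Ioc e,
      ← intervalIntegral.integral_of_le zero_le_one]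
    calc _ ≤ ∫ r in (0 : ℝ)..1, ((1 + ε) * ((deriv g r ^ 2 + p r ^ 2) * r)
            + (1 + ε⁻¹) * G ^ 2 * (deriv ζ r ^ 2 * r)) := by
          refine intervalIntegral.integral_mono_on zero_le_one
            (Continuous.intervalIntegrable (by fun_prop) _ _)
            (Continuous.intervalIntegrable (by fun_prop) _ _) fun r hr => ?_
          have hz2 : ζ r ^ 2 ≤ 1 := pow_le_one₀ (hb r).1 (hb r).2
          have a1 : (deriv ζ r * g r + ζ r * deriv g r) ^ 2
              ≤ (1 + ε) * (ζ r * deriv g r) ^ 2 + (1 + ε⁻¹) * (deriv ζ r * g r) ^ 2 := by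
            have : 0 ≤ ε⁻¹ * (ε * (ζ r * deriv g r) - deriv ζ r * g r) ^ 2 := by positivity
            have e2 : ε⁻¹ * (ε * (ζ r * deriv g r) - deriv ζ r * g r) ^ 2
              = ε * (ζ r * deriv g r) ^ 2 + ε⁻¹ * (deriv ζ r * g r) ^ 2
                - 2 * (deriv ζ r * g r) * (ζ r * deriv g r) := by field_simp; ring
            rw [e2] at this
            linarith [add_sq (deriv ζ r * g r) (ζ r * deriv g r)]
          have a2 : (ζ r * deriv g r) ^ 2 ≤ deriv g r ^ 2 := by
            rw [mul_pow]; exact mul_le_of_le_one_left (sq_nonneg _) hz2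
          have a3 : (deriv ζ r * g r) ^ 2 ≤ G ^ 2 * deriv ζ r ^ 2 := by
            rw [mul_pow, mul_comm]; exact mul_le_mul_of_nonneg_right (hG2 r hr) (sq_nonneg _)
          have a4 : (ζ r * p r) ^ 2 ≤ (1 + ε) * p r ^ 2 := by
            rw [mul_pow]; exact mul_le_mul_of_nonneg_right (by linarith) (sq_nonneg _)
          have a5 : (1 + ε) * (ζ r * deriv g r) ^ 2 ≤ (1 + ε) * deriv g r ^ 2 := by gcongr
          have a6 : (1 + ε⁻¹) * (deriv ζ r * g r) ^ 2 ≤ (1 + ε⁻¹) * (G ^ 2 * deriv ζ r ^ 2) := by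
            gcongr
          have := mul_le_mul_of_nonneg_right (show (deriv ζ r * g r + ζ r * deriv g r) ^ 2
            + (ζ r * p r) ^ 2 ≤ (1 + ε) * (deriv g r ^ 2 + p r ^ 2)
              + (1 + ε⁻¹) * (G ^ 2 * deriv ζ r ^ 2) by linarith) hr.1
          linarith
      _ = (1 + ε) * E + (1 + ε⁻¹) * G ^ 2 * ∫ r in (0 : ℝ)..1, deriv ζ r ^ 2 * r := by
          rw [intervalIntegral.integral_add (Continuous.intervalIntegrable (by fun_prop) _ _)
            (Continuous.intervalIntegrable (by fun_prop) _ _),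
            intervalIntegral.integral_const_mul, intervalIntegral.integral_const_mul]
      _ ≤ _ := by
          have : 0 ≤ (1 + ε⁻¹) * G ^ 2 := by positivity
          nlinarith
  have h2 : N - G ^ 2 * δ ≤ ∫ r in (0 : ℝ)..1, (ζ r * g r) ^ 2 * r := by
    have : ∫ r in (0 : ℝ)..1, (g r ^ 2 * r - G ^ 2 * δ) = N - G ^ 2 * δ := by
      rw [intervalIntegral.integral_sub (Continuous.intervalIntegrable (by fun_prop) _ _)
            (Continuous.intervalIntegrable (by fun_prop) _ _)]
      simp [hN]
    rw [← this]
    refine intervalIntegral.integral_mono_on zero_le_one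
      (Continuous.intervalIntegrable (by fun_prop) _ _)
      (Continuous.intervalIntegrable (by fun_prop) _ _) fun r hr => ?_
    have b1 := hsmall r hr.1
    have b2 : g r ^ 2 * ((1 - ζ r ^ 2) * r) ≤ G ^ 2 * δ :=
      mul_le_mul (hG2 r hr) b1 (mul_nonneg (by
        have := pow_le_one₀ (n := 2) (hb r).1 (hb r).2; linarith) hr.1) (sq_nonneg _)
    nlinarith
  have h3 := mul_le_mul_of_nonneg_left h2 hΛ
  linarith

/-- The function `g(r) e^{imθ}` on the plane. -/
def radTrial (m : ℤ) (g : ℝ → ℝ) (x : Plane) : ℂ :=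
  (g (Real.sqrt (x.1 ^ 2 + x.2 ^ 2)) : ℂ) *
    ((x.1 + x.2 * Complex.I) / (Real.sqrt (x.1 ^ 2 + x.2 ^ 2) : ℂ)) ^ m

theorem contDiff_radTrial (m : ℤ) {g : ℝ → ℝ} (hg : ContDiff ℝ 1 g)
    (hz : ∃ ε > 0, ∀ r ≤ ε, g r = 0) : ContDiff ℝ 1 (radTrial m g) := by
  obtain ⟨ε, hε, hz⟩ := hz
  rw [contDiff_iff_contDiffAt]
  intro x
  by_cases hx : x.1 ^ 2 + x.2 ^ 2 = 0
  · have : radTrial m g =ᶠ[𝓝 x] fun _ => 0 := by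
      have hc : Continuous fun y : Plane => Real.sqrt (y.1 ^ 2 + y.2 ^ 2) := by fun_prop
      have : Tendsto (fun y : Plane => Real.sqrt (y.1 ^ 2 + y.2 ^ 2)) (𝓝 x) (𝓝 0) := by
        have h := hc.tendsto x
        rwa [hx, Real.sqrt_zero] at h
      filter_upwards [this.eventually_lt_const hε] with y hy
      simp [radTrial, hz _ hy.le]
    exact contDiffAt_const.congr_of_eventuallyEq this
  · have hpos : 0 < x.1 ^ 2 + x.2 ^ 2 := lt_of_le_of_ne (by positivity) (Ne.symm hx)
    have hs : ContDiffAt ℝ 1 (fun y : Plane => Real.sqrt (y.1 ^ 2 + y.2 ^ 2)) x :=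
      ContDiffAt.sqrt (by fun_prop) hx
    have hof : ContDiff ℝ 1 (fun r : ℝ => (r : ℂ)) := Complex.ofRealCLM.contDiff
    have hsC : ContDiffAt ℝ 1 (fun y : Plane => (Real.sqrt (y.1 ^ 2 + y.2 ^ 2) : ℂ)) x :=
      hof.contDiffAt.comp x hs
    have hgC : ContDiffAt ℝ 1 (fun y : Plane => (g (Real.sqrt (y.1 ^ 2 + y.2 ^ 2)) : ℂ)) x :=
      (hof.comp hg).contDiffAt.comp x hs
    have hs0 : (Real.sqrt (x.1 ^ 2 + x.2 ^ 2) : ℂ) ≠ 0 := by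
      exact_mod_cast (Real.sqrt_pos.2 hpos).ne'
    have h1 : ContDiff ℝ 1 (fun y : Plane => (y.1 : ℂ)) := hof.comp contDiff_fst
    have h2 : ContDiff ℝ 1 (fun y : Plane => (y.2 : ℂ)) := hof.comp contDiff_snd
    have hw : ContDiffAt ℝ 1 (fun y : Plane => ((y.1 : ℂ) + y.2 * Complex.I)
        / (Real.sqrt (y.1 ^ 2 + y.2 ^ 2) : ℂ)) x := by
      simp only [div_eq_mul_inv]
      exact (h1.add (h2.mul contDiff_const)).contDiffAt.mul (hsC.inv hs0)
    have hz0 : ((x.1 : ℂ) + x.2 * Complex.I) / (Real.sqrt (x.1 ^ 2 + x.2 ^ 2) : ℂ) ≠ 0 := by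
      refine div_ne_zero (fun h => hx ?_) hs0
      have a1 := congrArg Complex.re h
      have a2 := congrArg Complex.im h
      simp at a1 a2
      simp [a1, a2]
    refine hgC.mul ?_
    obtain ⟨n, rfl | rfl⟩ := m.eq_nat_or_neg
    · simp only [zpow_natCast]
      exact hw.pow n
    · simp only [zpow_neg, zpow_natCast]
      exact (hw.pow n).inv (pow_ne_zero _ hz0)

theorem pol_radTrial (m : ℤ) (g : ℝ → ℝ) {r : ℝ} (hr : 0 < r) (θ : ℝ) :
    pol (radTrial m g) r θ = g r * Complex.exp (m * θ * Complex.I) := by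
  have hs : Real.sqrt ((r * Real.cos θ) ^ 2 + (r * Real.sin θ) ^ 2) = r := by
    rw [show (r * Real.cos θ) ^ 2 + (r * Real.sin θ) ^ 2 = r ^ 2 by
      linear_combination r ^ 2 * Real.sin_sq_add_cos_sq θ, Real.sqrt_sq hr.le]
  have hr' : (r : ℂ) ≠ 0 := by exact_mod_cast hr.ne'
  simp only [pol, radTrial, hs]
  have : (((r * Real.cos θ : ℝ) : ℂ) + ((r * Real.sin θ : ℝ) : ℂ) * Complex.I) / r
      = Complex.exp (θ * Complex.I) := by
    rw [Complex.exp_mul_I]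
    push_cast
    field_simp
  rw [this, ← Complex.exp_int_mul]
  ring_nf

theorem normSq_radTrial (m : ℤ) (g : ℝ → ℝ) {r : ℝ} (hr : 0 < r) (θ : ℝ) :
    ‖radTrial m g (r * Real.cos θ, r * Real.sin θ)‖ ^ 2 = g r ^ 2 := by
  have h := pol_radTrial m g hr θ
  unfold pol at h
  rw [h, norm_mul, show (m * θ * Complex.I : ℂ) = ((m * θ : ℝ) : ℂ) * Complex.I by push_cast; ring,
    Complex.norm_exp_ofReal_mul_I, mul_one, Complex.norm_real, Real.norm_eq_abs, sq_abs]

theorem magSq_radTrial (B : ℝ) (m : ℤ) {g : ℝ → ℝ} (hg : ContDiff ℝ 1 g)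
    (hz : ∃ ε > 0, ∀ r ≤ ε, g r = 0) {r : ℝ} (hr : 0 < r) (θ : ℝ) :
    magSq B F0 (radTrial m g) (r * Real.cos θ, r * Real.sin θ)
      = deriv g r ^ 2 + ((m / r - B * r / 2) * g r) ^ 2 := by
  have hu := contDiff_radTrial m hg hz
  have hr' : (r : ℂ) ≠ 0 := by exact_mod_cast hr.ne'
  have hn : ‖Complex.exp (m * θ * Complex.I)‖ = 1 := by
    rw [show (m * θ * Complex.I : ℂ) = ((m * θ : ℝ) : ℂ) * Complex.I by push_cast; ring,
      Complex.norm_exp_ofReal_mul_I]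
  have e1 : polR (radTrial m g) r θ = deriv g r * Complex.exp (m * θ * Complex.I) := by
    have h1 : HasDerivAt (fun s => (g s : ℂ) * Complex.exp (m * θ * Complex.I))
        (deriv g r * Complex.exp (m * θ * Complex.I)) r :=
      ((hg.differentiable one_ne_zero r).hasDerivAt.ofReal_comp).mul_const _
    refine (hasDerivAt_pol_left hu r θ).unique (h1.congr_of_eventuallyEq ?_)
    filter_upwards [Ioi_mem_nhds hr] with s hs
    exact pol_radTrial m g hs θ
  have e2 : (r : ℂ) * polT (radTrial m g) r θ
      = g r * (Complex.exp (m * θ * Complex.I) * (m * Complex.I)) := by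
    have h0 : HasDerivAt (fun θ : ℝ => (m * (θ : ℂ) * Complex.I)) (m * Complex.I) θ := by
      have := (((hasDerivAt_id (θ : ℂ)).const_mul (m : ℂ)).mul_const Complex.I).comp_ofReal
      simpa using this
    have h1 := (h0.cexp).const_mul (g r : ℂ)
    refine (hasDerivAt_pol_right hu r θ).unique (h1.congr_of_eventuallyEq ?_)
    exact Eventually.of_forall fun s => pol_radTrial m g hr s
  have e3 : polW B (radTrial m g) r θ
      = (((m / r - B * r / 2) * g r : ℝ) : ℂ) * Complex.exp (m * θ * Complex.I) := by
    unfold polW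
    have : polT (radTrial m g) r θ = g r * (Complex.exp (m * θ * Complex.I) * (m * Complex.I)) / r := by
      rw [← e2]; field_simp
    rw [this, pol_radTrial m g hr]
    push_cast
    field_simp
    linear_combination (-2 * g r * m) * Complex.I_sq
  rw [magSq_polar, e1, e3, norm_mul, norm_mul, hn, Complex.norm_real, Complex.norm_real,
    Real.norm_eq_abs, Real.norm_eq_abs]
  simp only [mul_one, sq_abs]

theorem lam1_mul_radial_le (B : ℝ) (m : ℤ) {g : ℝ → ℝ} (hg : ContDiff ℝ 1 g)
    (hz : ∃ ε > 0, ∀ r ≤ ε, g r = 0) :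
    lam1 unitDisc B * ∫ r in (0 : ℝ)..1, g r ^ 2 * r
      ≤ ∫ r in (0 : ℝ)..1, (deriv g r ^ 2 + ((m / r - B * r / 2) * g r) ^ 2) * r := by
  have hu := contDiff_radTrial m hg hz
  have h := lam1_mul_le hu B
  rw [integral_unitDisc (continuous_magSq B hu),
    integral_unitDisc (h := fun x => ‖radTrial m g x‖ ^ 2) (hu.continuous.norm.pow 2)] at h
  have e1 : ∀ r ∈ Ioc (0 : ℝ) 1, r * ∫ θ in (-Real.pi)..Real.pi,
      ‖radTrial m g (r * Real.cos θ, r * Real.sin θ)‖ ^ 2 = (2 * Real.pi) * (g r ^ 2 * r) := by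
    intro r hr
    simp_rw [normSq_radTrial m g hr.1]
    simp; ring
  have e2 : ∀ r ∈ Ioc (0 : ℝ) 1, r * ∫ θ in (-Real.pi)..Real.pi,
      magSq B F0 (radTrial m g) (r * Real.cos θ, r * Real.sin θ)
      = (2 * Real.pi) * ((deriv g r ^ 2 + ((m / r - B * r / 2) * g r) ^ 2) * r) := by
    intro r hr
    simp_rw [magSq_radTrial B m hg hz hr.1]
    simp; ring
  have f1 := setIntegral_congr_fun (μ := volume) measurableSet_Ioc e1
  have f2 := setIntegral_congr_fun (μ := volume) measurableSet_Ioc e2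
  rw [← intervalIntegral.integral_of_le zero_le_one, ← intervalIntegral.integral_of_le zero_le_one,
    intervalIntegral.integral_const_mul] at f1 f2
  rw [f1, f2] at h
  have := Real.pi_pos
  nlinarith

/-- Admissible boundary-layer functions: `C¹` and vanishing near the centre `t = R`. -/
def Adm (R : ℝ) (F : ℝ → ℝ) : Prop :=
  ContDiff ℝ 1 F ∧ ∃ ε > 0, ∀ t, R - ε ≤ t → F t = 0

/-- The scaled magnetic momentum times the weight. -/
def bb (R ξ t : ℝ) : ℝ := t + ξ - t ^ 2 / (2 * R)

/-- The scaled effective potential. -/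
def pot (R ξ t : ℝ) : ℝ := bb R ξ t / (1 - t / R)

/-- The scaled energy. -/
def En (R ξ : ℝ) (F : ℝ → ℝ) : ℝ :=
  ∫ t in (0 : ℝ)..R, (deriv F t ^ 2 + (pot R ξ t * F t) ^ 2) * (1 - t / R)

/-- The scaled squared norm. -/
def Nm (R : ℝ) (F : ℝ → ℝ) : ℝ := ∫ t in (0 : ℝ)..R, F t ^ 2 * (1 - t / R)

/-- The momentum moment. -/
def mom (R ξ : ℝ) (F : ℝ → ℝ) : ℝ := ∫ t in (0 : ℝ)..R, bb R ξ t * F t ^ 2 * (1 - t / R)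

/-- The scaled angular momentum. -/
def xiOf (R : ℝ) (m : ℤ) : ℝ := (m - R ^ 2 / 2) / R

theorem Adm.contDiff {R : ℝ} {F : ℝ → ℝ} (h : Adm R F) : ContDiff ℝ 1 F := h.1

theorem Adm.continuous {R : ℝ} {F : ℝ → ℝ} (h : Adm R F) : Continuous F := h.1.continuous

theorem Adm.continuous_deriv {R : ℝ} {F : ℝ → ℝ} (h : Adm R F) : Continuous (deriv F) :=
  h.1.continuous_deriv le_rfl

theorem Adm.mul {R : ℝ} {F χ : ℝ → ℝ} (h : Adm R F) (hχ : ContDiff ℝ 1 χ) :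
    Adm R (fun t => χ t * F t) := by
  obtain ⟨h1, ε, hε, h0⟩ := h
  exact ⟨hχ.mul h1, ε, hε, fun t ht => by simp [h0 t ht]⟩

theorem Adm.continuous_mul {R : ℝ} {F : ℝ → ℝ} (h : Adm R F) {k : ℝ → ℝ}
    (hk : ∀ t, t ≠ R → ContinuousAt k t) : Continuous fun t => k t * F t := by
  obtain ⟨h1, ε, hε, h0⟩ := h
  rw [continuous_iff_continuousAt]
  intro t
  by_cases ht : t = R
  · have : (fun t => k t * F t) =ᶠ[𝓝 t] fun _ => 0 := by
      filter_upwards [Ioi_mem_nhds (show R - ε < t by linarith)] with s hs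
      simp [h0 s (le_of_lt hs)]
    exact continuousAt_const.congr this.symm
  · exact (hk t ht).mul h1.continuous.continuousAt

theorem one_sub_div_ne {R t : ℝ} (hR : 0 < R) (ht : t ≠ R) : 1 - t / R ≠ 0 := fun h => ht (by
  field_simp at h; linarith)

theorem Adm.continuous_pot {R : ℝ} (hR : 0 < R) {F : ℝ → ℝ} (h : Adm R F) (ξ : ℝ) :
    Continuous fun t => pot R ξ t * F t := by
  refine h.continuous_mul fun t ht => ?_
  unfold pot bb
  exact ContinuousAt.div (by fun_prop) (by fun_prop) (one_sub_div_ne hR ht)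

theorem Adm.continuous_inv {R : ℝ} (hR : 0 < R) {F : ℝ → ℝ} (h : Adm R F) :
    Continuous fun t => (1 - t / R)⁻¹ * F t := by
  refine h.continuous_mul fun t ht => ?_
  exact ContinuousAt.inv₀ (by fun_prop) (one_sub_div_ne hR ht)

theorem continuous_bb (R ξ : ℝ) : Continuous (bb R ξ) := by unfold bb; fun_prop

theorem weight_mem {R t : ℝ} (hR : 0 < R) (ht : t ∈ Icc 0 R) :
    0 ≤ 1 - t / R ∧ 1 - t / R ≤ 1 := by
  have h1 : t / R ≤ 1 := (div_le_one hR).2 ht.2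
  have h2 : 0 ≤ t / R := div_nonneg ht.1 hR.le
  constructor <;> linarith

theorem integral_scale {R : ℝ} (hR : 0 < R) (f : ℝ → ℝ) :
    ∫ t in (0 : ℝ)..R, f (1 - t / R) = R * ∫ r in (0 : ℝ)..1, f r := by
  rw [intervalIntegral.integral_comp_sub_div (fun r => f r) hR.ne' 1]
  simp [hR.ne']

theorem lam1_mul_Nm_le {R : ℝ} (hR : 0 < R) (B : ℝ) (m : ℤ) {F : ℝ → ℝ} (h : Adm R F) :
    lam1 unitDisc B * Nm R F ≤ R ^ 2 * En R (xiOf R m) F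
      + (B - R ^ 2) * (-R * mom R (xiOf R m) F) + (B - R ^ 2) ^ 2 / 4 * Nm R F := by
  have hFd : Differentiable ℝ F := h.1.differentiable one_ne_zero
  have c1 := h.continuous
  have c2 := h.continuous_deriv
  have c3 := h.continuous_pot hR (xiOf R m)
  have c4 := continuous_bb R (xiOf R m)
  obtain ⟨hF, ε, hε, h0⟩ := id h
  set g : ℝ → ℝ := fun r => F (R * (1 - r)) with hg
  have hgc : ContDiff ℝ 1 g := hF.comp (by fun_prop)
  have hgz : ∃ ε > 0, ∀ r ≤ ε, g r = 0 := by
    refine ⟨ε / R, by positivity, fun r hr => h0 _ ?_⟩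
    rw [le_div_iff₀ hR] at hr
    linarith
  have hgd : ∀ r, deriv g r = -R * deriv F (R * (1 - r)) := by
    intro r
    have h1 : HasDerivAt (fun r : ℝ => R * (1 - r)) (R * (-1)) r := by
      have := ((hasDerivAt_id r).const_sub 1).const_mul R
      simpa using this
    have := ((hFd _).hasDerivAt.comp r h1).deriv
    rw [hg]
    simp only [Function.comp_def] at this
    rw [this]; ring
  have hkey := lam1_mul_radial_le B m hgc hgz
  have e0 : ∀ t, R * (1 - (1 - t / R)) = t := fun t => by field_simp; ring
  have e1 : Nm R F = R * ∫ r in (0 : ℝ)..1, g r ^ 2 * r := by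
    rw [← integral_scale hR]
    simp only [Nm, hg, e0]
  have e2 : ∫ t in (0 : ℝ)..R, ((R * deriv F t) ^ 2
        + ((m / (1 - t / R) - B * (1 - t / R) / 2) * F t) ^ 2) * (1 - t / R)
      = R * ∫ r in (0 : ℝ)..1, (deriv g r ^ 2 + ((m / r - B * r / 2) * g r) ^ 2) * r := by
    rw [← integral_scale hR]
    simp only [hgd, neg_mul, neg_sq]
    simp only [hg, e0]
  have hkey2 := mul_le_mul_of_nonneg_left hkey hR.le
  rw [mul_left_comm, ← e1, ← e2] at hkey2
  refine hkey2.trans ?_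
  have e3 : R ^ 2 * En R (xiOf R m) F
      + (B - R ^ 2) * (-R * mom R (xiOf R m) F) + (B - R ^ 2) ^ 2 / 4 * Nm R F
      = ∫ t in (0 : ℝ)..R, (R ^ 2 * ((deriv F t ^ 2 + (pot R (xiOf R m) t * F t) ^ 2) * (1 - t / R))
        + (B - R ^ 2) * (-R * (bb R (xiOf R m) t * F t ^ 2 * (1 - t / R)))
        + (B - R ^ 2) ^ 2 / 4 * (F t ^ 2 * (1 - t / R))) := by
    rw [intervalIntegral.integral_add, intervalIntegral.integral_add]
    · simp only [intervalIntegral.integral_const_mul, En, mom, Nm]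
    all_goals exact Continuous.intervalIntegrable (by fun_prop) _ _
  rw [e3]
  have c5 : ∀ t, t ≠ R → (m / (1 - t / R) - B * (1 - t / R) / 2)
      = R * pot R (xiOf R m) t - (B - R ^ 2) * (1 - t / R) / 2 := by
    intro t ht
    have := one_sub_div_ne hR ht
    have h2 : R - t ≠ 0 := fun h => ht (by linarith)
    unfold pot bb xiOf
    field_simp
    ring
  have c6 : ∀ t, (m / (1 - t / R) - B * (1 - t / R) / 2) * F t
      = R * (pot R (xiOf R m) t * F t) - (B - R ^ 2) * (1 - t / R) / 2 * F t := by
    intro t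
    by_cases ht : t = R
    · have : F t = 0 := h0 t (by linarith)
      simp [this]
    · rw [c5 t ht]; ring
  simp_rw [c6]
  refine intervalIntegral.integral_mono_on hR.le (Continuous.intervalIntegrable (by fun_prop) _ _)
    (Continuous.intervalIntegrable (by fun_prop) _ _) fun t ht => ?_
  obtain ⟨w0, w1⟩ := weight_mem hR ht
  by_cases htR : t = R
  · have : F t = 0 := h0 t (by linarith)
    simp [this, mul_pow]
    ring_nf
    rfl
  · have e5 : bb R (xiOf R m) t = pot R (xiOf R m) t * (1 - t / R) := by
      unfold pot
      have := one_sub_div_ne hR htR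
      field_simp
    rw [e5]
    have : (B - R ^ 2) ^ 2 / 4 * (F t ^ 2 * (1 - t / R)) * (1 - t / R) ^ 2
        ≤ (B - R ^ 2) ^ 2 / 4 * (F t ^ 2 * (1 - t / R)) :=
      mul_le_of_le_one_right (by positivity) (pow_le_one₀ w0 w1)
    linear_combination this

theorem lam1_nonneg (B : ℝ) : 0 ≤ lam1 unitDisc B := by
  rw [lam1_eq]
  exact Real.sInf_nonneg (by rintro _ ⟨v, _, rfl⟩; exact discQuot_nonneg v B)

theorem lam1_div_mul_Nm_le {R : ℝ} (hR : 0 < R) (m : ℤ) {F : ℝ → ℝ} (h : Adm R F) :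
    lam1 unitDisc (R ^ 2) / R ^ 2 * Nm R F ≤ En R (xiOf R m) F := by
  have := lam1_mul_Nm_le hR (R ^ 2) m h
  rw [div_mul_eq_mul_div, div_le_iff₀ (by positivity)]
  linarith

theorem exists_near_min {R : ℝ} (hR : 0 < R) {η : ℝ} (hη : 0 < η) :
    ∃ (m : ℤ) (F : ℝ → ℝ), Adm R F ∧ Nm R F = 1 ∧
      En R (xiOf R m) F < lam1 unitDisc (R ^ 2) / R ^ 2 + η := by
  obtain ⟨u, hu, hlt⟩ := exists_lt_lam1_add (R ^ 2) (show 0 < R ^ 2 * η by positivity)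
  have hΛ : 0 ≤ lam1 unitDisc (R ^ 2) + R ^ 2 * η := add_nonneg (lam1_nonneg _) (by positivity)
  obtain ⟨m, g, hg, ⟨ε, hε, hz⟩, hE⟩ := exists_radial_lt hΛ hu hlt
  set N := ∫ r in (0 : ℝ)..1, g r ^ 2 * r with hN
  have hE0 : 0 ≤ ∫ r in (0 : ℝ)..1, (deriv g r ^ 2 + ((m / r - R ^ 2 * r / 2) * g r) ^ 2) * r :=
    intervalIntegral.integral_nonneg zero_le_one fun r hr => mul_nonneg (by positivity) hr.1
  have hNpos : 0 < N := by
    by_contra hc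
    nlinarith
  set k : ℝ := (Real.sqrt (R * N))⁻¹ with hk
  have hk2 : k ^ 2 * (R * N) = 1 := by
    rw [hk, inv_pow, Real.sq_sqrt (by positivity)]
    field_simp
  have hgd := hg.differentiable one_ne_zero
  have hFd : ∀ t, deriv (fun t => k * g (1 - t / R)) t = -k * deriv g (1 - t / R) / R := by
    intro t
    have h1 : HasDerivAt (fun t : ℝ => 1 - t / R) (-(1 / R)) t := by
      have := ((hasDerivAt_id t).div_const R).const_sub 1
      simpa using this
    have := (((hgd (1 - t / R)).hasDerivAt.comp t h1).const_mul k).deriv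
    simp only [Function.comp_def] at this
    rw [this]; ring
  have hz0 : g 0 = 0 := hz 0 hε.le
  refine ⟨m, fun t => k * g (1 - t / R), ⟨contDiff_const.mul (hg.comp (by fun_prop)), R * ε,
    by positivity, fun t ht => ?_⟩, ?_, ?_⟩
  · have : 1 - t / R ≤ ε := by
      rw [sub_le_iff_le_add, ← sub_le_iff_le_add', le_div_iff₀ hR]; linarith
    simp [hz _ this]
  · have e : Nm R (fun t => k * g (1 - t / R)) = R * ∫ r in (0 : ℝ)..1, k ^ 2 * (g r ^ 2 * r) := by
      rw [← integral_scale hR]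
      simp only [Nm, mul_pow, mul_assoc]
    rw [e, intervalIntegral.integral_const_mul, ← hN]
    linear_combination hk2
  · have e : R ^ 2 * En R (xiOf R m) (fun t => k * g (1 - t / R)) = R * ∫ r in (0 : ℝ)..1,
        k ^ 2 * ((deriv g r ^ 2 + ((m / r - R ^ 2 * r / 2) * g r) ^ 2) * r) := by
      rw [← integral_scale hR]
      simp only [En, hFd]
      rw [← intervalIntegral.integral_const_mul]
      congr 1
      ext t
      by_cases ht : t = R
      · subst ht
        rw [div_self hR.ne', sub_self]
        simp
      · have h1 := one_sub_div_ne hR ht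
        have h2 : R - t ≠ 0 := fun h => ht (by linarith)
        have h3 : R * pot R (xiOf R m) t = m / (1 - t / R) - R ^ 2 * (1 - t / R) / 2 := by
          unfold pot bb xiOf
          field_simp
          ring
        rw [← h3]
        field_simp
    rw [intervalIntegral.integral_const_mul] at e
    have hk0 : 0 < k ^ 2 := by
      have : 0 < k := by rw [hk]; positivity
      positivity
    have h5 := mul_lt_mul_of_pos_left hE (show 0 < R * k ^ 2 by positivity)
    have h6 : R ^ 2 * En R (xiOf R m) (fun t => k * g (1 - t / R))
        < lam1 unitDisc (R ^ 2) + R ^ 2 * η := by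
      calc _ < R * k ^ 2 * ((lam1 unitDisc (R ^ 2) + R ^ 2 * η) * N) := by rw [e, ← mul_assoc]; exact h5
        _ = _ := by linear_combination (lam1 unitDisc (R ^ 2) + R ^ 2 * η) * hk2
    rw [← sub_lt_iff_lt_add, lt_div_iff₀ (by positivity)]
    linarith

namespace DeGennes

/-- The ground state, extended by a constant to the negative half-line. -/
def U (D : DeGennes) (t : ℝ) : ℝ := D.u₀ (max t 0)

/-- The derivative of the extended ground state. -/
def V (D : DeGennes) (t : ℝ) : ℝ := derivWithin D.u₀ (Ici 0) (max t 0)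

/-- The second derivative of the ground state on the positive half-line. -/
def K (D : DeGennes) (t : ℝ) : ℝ := ((t + D.ξ₀) ^ 2 - Theta0) * D.U t

variable (D : DeGennes)

theorem continuous_U : Continuous D.U :=
  D.u₀_smooth.continuousOn.comp_continuous (by fun_prop) fun t => le_max_right t 0

theorem continuous_V : Continuous D.V :=
  (D.u₀_smooth.continuousOn_derivWithin (uniqueDiffOn_Ici 0) one_le_two).comp_continuous
    (by fun_prop) fun t => le_max_right t 0

theorem continuous_K : Continuous D.K := by
  have := D.continuous_U
  unfold K
  fun_prop

theorem U_pos (t : ℝ) : 0 < D.U t := D.u₀_pos _ (le_max_right t 0)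

theorem U_of_nonneg {t : ℝ} (ht : 0 ≤ t) : D.U t = D.u₀ t := by rw [U, max_eq_left ht]

theorem V_of_nonpos {t : ℝ} (ht : t ≤ 0) : D.V t = 0 := by
  rw [V, max_eq_right ht, D.u₀_neumann]

theorem K_zero : D.K 0 = 0 := by rw [K, zero_add, D.ξ₀_sq, sub_self, zero_mul]

theorem eventuallyEq_U {t : ℝ} (ht : 0 < t) : D.U =ᶠ[𝓝 t] D.u₀ := by
  filter_upwards [Ioi_mem_nhds ht] with s hs using D.U_of_nonneg (le_of_lt hs)

theorem hasDerivAt_U (t : ℝ) : HasDerivAt D.U (D.V t) t := by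
  have hne : ∀ s, s ≠ 0 → HasDerivAt D.U (D.V s) s := by
    intro s hs
    rcases lt_or_gt_of_ne hs with h | h
    · rw [D.V_of_nonpos h.le]
      refine (hasDerivAt_const s (D.u₀ 0)).congr_of_eventuallyEq ?_
      filter_upwards [Iio_mem_nhds h] with y hy
      rw [U, max_eq_right (le_of_lt hy)]
    · rw [V, max_eq_left h.le]
      refine HasDerivAt.congr_of_eventuallyEq ?_ (D.eventuallyEq_U h)
      exact ((D.u₀_smooth.differentiableOn two_ne_zero s h.le).hasDerivWithinAt).hasDerivAt
        (Ici_mem_nhds h)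
  by_cases ht : t = 0
  · subst ht
    exact hasDerivAt_of_hasDerivAt_of_ne hne D.continuous_U.continuousAt D.continuous_V.continuousAt
  · exact hne t ht

theorem hasDerivAt_V_aux (t : ℝ) :
    HasDerivAt D.V (D.K (max t 0)) t := by
  have hne : ∀ s, s ≠ 0 → HasDerivAt D.V (D.K (max s 0)) s := by
    intro s hs
    rcases lt_or_gt_of_ne hs with h | h
    · rw [max_eq_right h.le, K_zero]
      refine (hasDerivAt_const s (0 : ℝ)).congr_of_eventuallyEq ?_
      filter_upwards [Iio_mem_nhds h] with y hy using D.V_of_nonpos (le_of_lt hy)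
    · rw [max_eq_left h.le]
      have hev : deriv D.u₀ =ᶠ[𝓝 s] derivWithin D.u₀ (Ici 0) := by
        filter_upwards [Ioi_mem_nhds h] with y hy
        rw [derivWithin_of_mem_nhds (Ici_mem_nhds hy)]
      have hev2 : D.V =ᶠ[𝓝 s] derivWithin D.u₀ (Ici 0) := by
        filter_upwards [Ioi_mem_nhds h] with y hy
        rw [V, max_eq_left (le_of_lt hy)]
      have hd : DifferentiableAt ℝ (derivWithin D.u₀ (Ici 0)) s := by
        have h1 : ContDiffOn ℝ 1 (derivWithin D.u₀ (Ici 0)) (Ici 0) :=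
          D.u₀_smooth.derivWithin (uniqueDiffOn_Ici 0) (by norm_num)
        exact (h1.contDiffAt (Ici_mem_nhds h)).differentiableAt one_ne_zero
      have h2 := (hd.hasDerivAt).congr_of_eventuallyEq hev2
      have h3 : deriv (derivWithin D.u₀ (Ici 0)) s = D.K s := by
        rw [← hev.deriv_eq, K, D.U_of_nonneg h.le]
        have := D.u₀_ode s h
        linarith
      rwa [h3] at h2
  by_cases ht : t = 0
  · subst ht
    refine hasDerivAt_of_hasDerivAt_of_ne hne D.continuous_V.continuousAt
      (g := fun s => D.K (max s 0)) ?_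
    exact (D.continuous_K.comp (by fun_prop : Continuous fun s : ℝ => max s 0)).continuousAt
  · exact hne t ht

theorem hasDerivAt_V {t : ℝ} (ht : 0 ≤ t) : HasDerivAt D.V (D.K t) t := by
  have := D.hasDerivAt_V_aux t
  rwa [max_eq_left ht] at this

theorem contDiff_U : ContDiff ℝ 1 D.U := contDiff_one_iff_deriv.2
  ⟨fun t => (D.hasDerivAt_U t).differentiableAt, by
    rw [show deriv D.U = D.V from funext fun t => (D.hasDerivAt_U t).deriv]
    exact D.continuous_V⟩

theorem contDiff_V : ContDiff ℝ 1 D.V := contDiff_one_iff_deriv.2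
  ⟨fun t => (D.hasDerivAt_V_aux t).differentiableAt, by
    rw [show deriv D.V = _ from funext fun t => (D.hasDerivAt_V_aux t).deriv]
    exact D.continuous_K.comp (by fun_prop)⟩

theorem integrableOn_U_sq : IntegrableOn (fun t => D.U t ^ 2) (Ioi 0) :=
  D.u₀_sq_int.congr_fun (fun t ht => by rw [D.U_of_nonneg (le_of_lt ht)]) measurableSet_Ioi

theorem integral_U_sq : ∫ t in Ioi (0 : ℝ), D.U t ^ 2 = 1 := by
  rw [← D.u₀_normalized]
  exact setIntegral_congr_fun measurableSet_Ioi fun t ht => by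
    rw [D.U_of_nonneg (le_of_lt ht)]

theorem tendsto_integral_U_sq :
    Tendsto (fun T : ℝ => ∫ t in (0 : ℝ)..T, D.U t ^ 2) atTop (𝓝 1) := by
  rw [← D.integral_U_sq]
  exact intervalIntegral_tendsto_integral_Ioi 0 D.integrableOn_U_sq tendsto_id

theorem integral_U_sq_le {T : ℝ} (hT : 0 ≤ T) : ∫ t in (0 : ℝ)..T, D.U t ^ 2 ≤ 1 := by
  rw [← D.integral_U_sq, intervalIntegral.integral_of_le hT]
  exact setIntegral_mono_set D.integrableOn_U_sq (Eventually.of_forall fun t => sq_nonneg _)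
    (Ioc_subset_Ioi_self.eventuallyLE)

theorem U_le_K {t : ℝ} (ht : 3 ≤ t) : D.U t ≤ D.K t := by
  have h1 := D.ξ₀_mem.1
  have h2 := D.theta_ub
  have := D.U_pos t
  unfold K
  have : 1 ≤ (t + D.ξ₀) ^ 2 - Theta0 := by nlinarith
  nlinarith

theorem U_add_V_nonpos {a : ℝ} (ha : 3 ≤ a) : D.U a + D.V a ≤ 0 := by
  by_contra! hz
  set z := D.U a + D.V a with hzdef
  have hz1 : ∀ t, a ≤ t → z * Real.exp (t - a) ≤ D.U t + D.V t := by
    have hmono : MonotoneOn (fun t => Real.exp (-t) * (D.U t + D.V t)) (Ici a) := by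
      have hd : ∀ t ∈ Ici a, HasDerivAt (fun t => Real.exp (-t) * (D.U t + D.V t))
          (-Real.exp (-t) * (D.U t + D.V t) + Real.exp (-t) * (D.V t + D.K t)) t := by
        intro t ht
        have h1 : HasDerivAt (fun t : ℝ => Real.exp (-t)) (-Real.exp (-t)) t := by
          simpa using (hasDerivAt_neg t).exp
        exact h1.mul ((D.hasDerivAt_U t).add (D.hasDerivAt_V (by linarith [mem_Ici.1 ht])))
      refine monotoneOn_of_deriv_nonneg (convex_Ici a)
        (fun t ht => (hd t ht).continuousAt.continuousWithinAt)
        (fun t ht => (hd t (interior_subset ht)).differentiableAt.differentiableWithinAt)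
        fun t ht => ?_
      have ht' := interior_subset ht
      rw [(hd t ht').deriv]
      have := D.U_le_K (ha.trans ht')
      have := Real.exp_pos (-t)
      nlinarith
    intro t ht
    have h := hmono (mem_Ici.2 le_rfl) (mem_Ici.2 ht) ht
    simp only [← hzdef] at h
    have h2 := mul_le_mul_of_nonneg_left h (Real.exp_pos t).le
    rw [← mul_assoc, ← mul_assoc, ← Real.exp_add, ← Real.exp_add, add_neg_cancel, Real.exp_zero,
      one_mul] at h2
    rwa [mul_comm, sub_eq_add_neg]
  have hmonoU : ∀ t, a ≤ t → z ≤ D.U t + D.V t := fun t ht => by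
    have h4 : 1 ≤ Real.exp (t - a) := Real.one_le_exp (sub_nonneg.2 ht)
    nlinarith [hz1 t ht]
  have hlow : ∀ t, a ≤ t → min (D.U a) z ≤ D.U t := by
    have hanti : MonotoneOn (fun t => (D.U t - z) * Real.exp (t - a)) (Ici a) := by
      have hd : ∀ t ∈ Ici a, HasDerivAt (fun t => (D.U t - z) * Real.exp (t - a))
          (D.V t * Real.exp (t - a) + (D.U t - z) * Real.exp (t - a)) t := by
        intro t ht
        have h1 : HasDerivAt (fun t : ℝ => Real.exp (t - a)) (Real.exp (t - a)) t := by
          simpa using ((hasDerivAt_id t).sub_const a).exp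
        exact ((D.hasDerivAt_U t).sub_const z).mul h1
      refine monotoneOn_of_deriv_nonneg (convex_Ici a)
        (fun t ht => (hd t ht).continuousAt.continuousWithinAt)
        (fun t ht => (hd t (interior_subset ht)).differentiableAt.differentiableWithinAt)
        fun t ht => ?_
      have ht' := interior_subset ht
      rw [(hd t ht').deriv]
      have := hmonoU t ht'
      have := Real.exp_pos (t - a)
      nlinarith
    intro t ht
    have h := hanti (mem_Ici.2 le_rfl) (mem_Ici.2 ht) ht
    simp only [sub_self, Real.exp_zero, mul_one] at h
    have h4 : 1 ≤ Real.exp (t - a) := Real.one_le_exp (sub_nonneg.2 ht)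
    by_cases hc : z ≤ D.U t
    · exact (min_le_right _ _).trans hc
    · refine (min_le_left _ _).trans ?_
      nlinarith
  set c := min (D.U a) z with hc
  have hcpos : 0 < c := lt_min (D.U_pos a) hz
  have h1 := D.integral_U_sq_le (T := a + 2 / c ^ 2) (by positivity)
  have h2 : ∫ t in a..(a + 2 / c ^ 2), c ^ 2 ≤ ∫ t in a..(a + 2 / c ^ 2), D.U t ^ 2 := by
    refine intervalIntegral.integral_mono_on (by simp; positivity)
      (Continuous.intervalIntegrable (by fun_prop) _ _)
      (Continuous.intervalIntegrable (by have := D.continuous_U; fun_prop) _ _) fun t ht => ?_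
    exact pow_le_pow_left₀ hcpos.le (hlow t ht.1) 2
  have h3 : (∫ t in (0 : ℝ)..a, D.U t ^ 2) + ∫ t in a..(a + 2 / c ^ 2), D.U t ^ 2
      = ∫ t in (0 : ℝ)..(a + 2 / c ^ 2), D.U t ^ 2 := by
    have := D.continuous_U
    rw [intervalIntegral.integral_add_adjacent_intervals] <;>
      exact Continuous.intervalIntegrable (by fun_prop) _ _
  have h4 : 0 ≤ ∫ t in (0 : ℝ)..a, D.U t ^ 2 :=
    intervalIntegral.integral_nonneg (by linarith) fun t _ => sq_nonneg _
  rw [intervalIntegral.integral_const, smul_eq_mul] at h2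
  have h5 : (a + 2 / c ^ 2 - a) * c ^ 2 = 2 := by field_simp; ring
  linarith

end DeGennes

namespace DeGennes
variable (D : DeGennes)

theorem U_le_exp {t : ℝ} (ht : 3 ≤ t) : D.U t ≤ D.U 3 * Real.exp (3 - t) := by
  have hd : ∀ t, HasDerivAt (fun t => D.U t * Real.exp (t - 3))
      (D.V t * Real.exp (t - 3) + D.U t * Real.exp (t - 3)) t := fun t =>
    (D.hasDerivAt_U t).mul (by simpa using ((hasDerivAt_id t).sub_const 3).exp)
  have hanti : AntitoneOn (fun t => D.U t * Real.exp (t - 3)) (Ici 3) := by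
    refine antitoneOn_of_deriv_nonpos (convex_Ici 3)
      (fun t _ => (hd t).continuousAt.continuousWithinAt)
      (fun t _ => (hd t).differentiableAt.differentiableWithinAt) fun t ht => ?_
    rw [(hd t).deriv]
    have h1 := D.U_add_V_nonpos (interior_subset ht)
    nlinarith [Real.exp_pos (t - 3)]
  have h := hanti (mem_Ici.2 le_rfl) (mem_Ici.2 ht) ht
  simp only [sub_self, Real.exp_zero, mul_one] at h
  have h2 := mul_le_mul_of_nonneg_right h (Real.exp_pos (3 - t)).le
  rwa [mul_assoc, ← Real.exp_add, show t - 3 + (3 - t) = 0 by ring, Real.exp_zero, mul_one] at h2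

theorem abs_V_le {t : ℝ} (ht : 4 ≤ t) : |D.V t| ≤ D.U (t - 1) := by
  have hV := D.U_add_V_nonpos (a := t) (by linarith)
  have hU := D.U_pos t
  have hmono : MonotoneOn D.V (Ici 3) := by
    refine monotoneOn_of_deriv_nonneg (convex_Ici 3) D.continuous_V.continuousOn
      (fun t _ => (D.hasDerivAt_V_aux t).differentiableAt.differentiableWithinAt) fun t ht => ?_
    have ht' : 3 ≤ t := interior_subset ht
    rw [(D.hasDerivAt_V (by linarith)).deriv]
    exact (D.U_pos t).le.trans (D.U_le_K ht')
  obtain ⟨c, hc, hc2⟩ := exists_hasDerivAt_eq_slope D.U D.V (a := t - 1) (b := t) (by linarith)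
    D.continuous_U.continuousOn fun x _ => D.hasDerivAt_U x
  have h := hmono (mem_Ici.2 (by linarith [hc.1])) (mem_Ici.2 (by linarith)) hc.2.le
  rw [hc2, sub_sub_cancel, div_one] at h
  rw [abs_of_nonpos (by linarith)]
  linarith

theorem exists_decay : ∃ C, 0 < C ∧ ∀ t, 0 ≤ t →
    (1 + t) ^ 2 * D.U t ≤ C ∧ (1 + t) ^ 2 * |D.V t| ≤ C := by
  have hcU : ContinuousOn (fun t => (1 + t) ^ 2 * D.U t) (Icc 0 4) := by
    have := D.continuous_U; fun_prop
  have hcV : ContinuousOn (fun t => (1 + t) ^ 2 * |D.V t|) (Icc 0 4) := by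
    have := D.continuous_V; fun_prop
  obtain ⟨C1, h1⟩ := isCompact_Icc.bddAbove_image hcU
  obtain ⟨C2, h2⟩ := isCompact_Icc.bddAbove_image hcV
  have hexp : ∀ t, 0 ≤ t → (1 + t) ^ 2 * Real.exp (4 - t) ≤ 4 * Real.exp 4 := by
    intro t ht
    have h3 : (1 + t / 2) ^ 2 ≤ Real.exp t := by
      rw [show t = t / 2 + t / 2 by ring, Real.exp_add, ← sq]
      refine pow_le_pow_left₀ (by linarith) ?_ 2
      have := Real.add_one_le_exp (t / 2)
      ring_nf at this ⊢
      linarith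
    rw [Real.exp_sub, ← mul_div_assoc, div_le_iff₀ (Real.exp_pos t)]
    have := Real.exp_pos 4
    have h4 : (1 + t) ^ 2 ≤ 4 * Real.exp t := by nlinarith
    nlinarith
  have hU3 := D.U_pos 3
  have he4 := Real.exp_pos 4
  refine ⟨max (max C1 C2) (D.U 3 * (4 * Real.exp 4)), by positivity, fun t ht => ?_⟩
  rcases le_total t 4 with h | h
  · exact ⟨(h1 ⟨t, ⟨ht, h⟩, rfl⟩).trans ((le_max_left _ _).trans (le_max_left _ _)),
      (h2 ⟨t, ⟨ht, h⟩, rfl⟩).trans ((le_max_right _ _).trans (le_max_left _ _))⟩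
  · have key : ∀ x, x ≤ D.U 3 * Real.exp (4 - t) → (1 + t) ^ 2 * x ≤
        max (max C1 C2) (D.U 3 * (4 * Real.exp 4)) := fun x hx => by
      refine le_trans ?_ (le_max_right _ _)
      calc (1 + t) ^ 2 * x ≤ (1 + t) ^ 2 * (D.U 3 * Real.exp (4 - t)) := by gcongr
        _ = D.U 3 * ((1 + t) ^ 2 * Real.exp (4 - t)) := by ring
        _ ≤ _ := by exact mul_le_mul_of_nonneg_left (hexp t ht) hU3.le
    refine ⟨key _ ((D.U_le_exp (by linarith)).trans ?_), key _ ((D.abs_V_le h).trans ?_)⟩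
    · gcongr; norm_num
    · refine (D.U_le_exp (by linarith)).trans_eq ?_
      ring_nf

/-- The boundary functional whose derivative carries the moment identities of `U`. -/
def bdry (κ : ℝ → ℝ) (t : ℝ) : ℝ :=
  ((t + D.ξ₀) * ((t + D.ξ₀) ^ 2 - Theta0) * D.U t ^ 2 - (t + D.ξ₀) * D.V t ^ 2 + D.U t * D.V t)
  - 2 * D.ξ₀ * (((t + D.ξ₀) ^ 2 - Theta0) * D.U t ^ 2 - D.V t ^ 2)
  - (t + D.ξ₀) * D.U t ^ 2
  - κ t ^ 2 * D.V t * (D.K t - D.V t ^ 2 / D.U t)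

theorem hasDerivAt_bdry {κ : ℝ → ℝ} {κ' t : ℝ} (hκ : HasDerivAt κ κ' t) (ht : 0 ≤ t) :
    HasDerivAt (D.bdry κ)
      ((4 * (t + D.ξ₀) * (t - κ t * D.V t / D.U t)
          - (-κ' * (D.V t / D.U t) - κ t * ((D.K t * D.U t - D.V t * D.V t) / D.U t ^ 2)) ^ 2)
          * D.U t ^ 2
        - (2 * Theta0 + 1) * D.U t ^ 2
        - (2 * (1 - κ t) ^ 2 * (t + D.ξ₀) * D.U t * D.V t - κ' ^ 2 * D.V t ^ 2)) t := by
  have hU0 := (D.U_pos t).ne'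
  have hs : HasDerivAt (fun t => t + D.ξ₀) 1 t := (hasDerivAt_id t).add_const _
  have hU := D.hasDerivAt_U t
  have hV := D.hasDerivAt_V ht
  have hK : HasDerivAt D.K (2 * (t + D.ξ₀) * D.U t + ((t + D.ξ₀) ^ 2 - Theta0) * D.V t) t := by
    have := ((hs.pow 2).sub_const Theta0).mul hU
    convert! this using 1
    simp
  have h := ((((hs.mul ((hs.pow 2).sub_const Theta0)).mul (hU.pow 2)).sub
    (hs.mul (hV.pow 2))).add (hU.mul hV)).sub
    (((((hs.pow 2).sub_const Theta0).mul (hU.pow 2)).sub (hV.pow 2)).const_mul (2 * D.ξ₀))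
    |>.sub (hs.mul (hU.pow 2)) |>.sub (((hκ.pow 2).mul hV).mul (hK.sub ((hV.pow 2).div hU hU0)))
  convert! h using 1
  simp only [Pi.mul_apply, Pi.pow_apply, Pi.sub_apply, Pi.div_apply]
  rw [show D.K t = ((t + D.ξ₀) ^ 2 - Theta0) * D.U t from rfl]
  field_simp
  push_cast
  ring

end DeGennes

namespace DeGennes
variable (D : DeGennes)

theorem abs_add_ξ₀_le {t : ℝ} (ht : 0 ≤ t) : |t + D.ξ₀| ≤ 1 + t := by
  have := D.ξ₀_mem
  rw [abs_le]
  constructor <;> linarith [this.1, this.2]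

/-- The C¹ cutoff equal to `1` for `t ≤ n` and `0` for `t ≥ 2 * n`. -/
def cut (n t : ℝ) : ℝ := 1 - Real.smoothTransition (t / n - 1)

theorem contDiff_cut (n : ℝ) : ContDiff ℝ 1 (cut n) :=
  contDiff_const.sub (Real.smoothTransition.contDiff.comp (by fun_prop))

theorem cut_of_le {n t : ℝ} (hn : 0 < n) (ht : t ≤ n) : cut n t = 1 := by
  rw [cut, Real.smoothTransition.zero_of_nonpos, sub_zero]
  rw [sub_nonpos, div_le_one hn]
  exact ht

theorem cut_of_ge {n t : ℝ} (hn : 0 < n) (ht : 2 * n ≤ t) : cut n t = 0 := by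
  rw [cut, Real.smoothTransition.one_of_one_le, sub_self]
  rw [le_sub_iff_add_le, le_div_iff₀ hn]
  linarith

theorem cut_mem (n t : ℝ) : 0 ≤ cut n t ∧ cut n t ≤ 1 := by
  unfold cut
  constructor <;> linarith [Real.smoothTransition.nonneg (t / n - 1),
    Real.smoothTransition.le_one (t / n - 1)]

theorem deriv_cut (n t : ℝ) : deriv (cut n) t =
    -(deriv Real.smoothTransition (t / n - 1) / n) := by
  have h1 : HasDerivAt (fun t : ℝ => t / n - 1) (1 / n) t :=
    ((hasDerivAt_id t).div_const n).sub_const 1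
  have h2 := ((Real.smoothTransition.contDiff (n := 1)).differentiable one_ne_zero
    (t / n - 1)).hasDerivAt.comp t h1
  have h3 : HasDerivAt (cut n) _ t := h2.const_sub 1
  rw [h3.deriv]
  ring

theorem exists_abs_deriv_cut_le : ∃ M, 0 < M ∧ ∀ n t, 0 < n → |deriv (cut n) t| ≤ M / n := by
  obtain ⟨M, hM, h⟩ := exists_deriv_smoothTransition_le
  refine ⟨M, hM, fun n t hn => ?_⟩
  rw [deriv_cut, abs_neg, abs_of_nonneg (div_nonneg (h _).1 hn.le)]
  exact div_le_div_of_nonneg_right (h _).2 hn.le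

/-- The first-order corrector of the trial state, `-κ V / U`. -/
def corr (n t : ℝ) : ℝ := -cut n t * (D.V t / D.U t)

theorem contDiff_corr (n : ℝ) : ContDiff ℝ 1 (D.corr n) := by
  refine (contDiff_cut n).neg.mul ?_
  have : (fun t => D.V t / D.U t) = fun t => D.V t * (D.U t)⁻¹ := by
    ext t; rw [div_eq_mul_inv]
  rw [this]
  exact D.contDiff_V.mul (D.contDiff_U.inv fun t => (D.U_pos t).ne')

theorem corr_of_ge {n t : ℝ} (hn : 0 < n) (ht : 2 * n ≤ t) : D.corr n t = 0 := by
  rw [corr, cut_of_ge hn ht]; simp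

theorem hasDerivAt_corr (n : ℝ) {t : ℝ} (ht : 0 ≤ t) : HasDerivAt (D.corr n)
    (-deriv (cut n) t * (D.V t / D.U t)
      - cut n t * ((D.K t * D.U t - D.V t * D.V t) / D.U t ^ 2)) t := by
  have h1 := ((contDiff_cut n).differentiable one_ne_zero t).hasDerivAt
  have h := h1.neg.mul ((D.hasDerivAt_V ht).div (D.hasDerivAt_U t) (D.U_pos t).ne')
  convert! h using 1
  simp only [Pi.neg_apply]
  ring_nf
  simp only [Pi.div_apply]
  ring

/-- The first-order gain density of the corrector. -/
def gain (ω : ℝ → ℝ) (t : ℝ) : ℝ := 4 * (t + D.ξ₀) * (t + ω t) - deriv ω t ^ 2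

theorem integral_gain {n : ℝ} (hn : 0 < n) :
    ∫ t in (0 : ℝ)..(2 * n), D.gain (D.corr n) t * D.U t ^ 2 =
      D.bdry (cut n) (2 * n) + D.ξ₀ * D.U 0 ^ 2
      + (2 * Theta0 + 1) * (∫ t in (0 : ℝ)..(2 * n), D.U t ^ 2)
      + ∫ t in (0 : ℝ)..(2 * n), (2 * (1 - cut n t) ^ 2 * (t + D.ξ₀) * D.U t * D.V t
          - deriv (cut n) t ^ 2 * D.V t ^ 2) := by
  have cU := D.continuous_U
  have cV := D.continuous_V
  have cc := (contDiff_cut n).continuous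
  have cc' := (contDiff_cut n).continuous_deriv le_rfl
  have cω := (D.contDiff_corr n).continuous
  have cω' := (D.contDiff_corr n).continuous_deriv le_rfl
  have cg : Continuous (D.gain (D.corr n)) := by unfold gain; fun_prop
  have key : ∫ t in (0 : ℝ)..(2 * n), (D.gain (D.corr n) t * D.U t ^ 2
      - (2 * Theta0 + 1) * D.U t ^ 2
      - (2 * (1 - cut n t) ^ 2 * (t + D.ξ₀) * D.U t * D.V t
          - deriv (cut n) t ^ 2 * D.V t ^ 2)) = D.bdry (cut n) (2 * n) - D.bdry (cut n) 0 := by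
    refine intervalIntegral.integral_eq_sub_of_hasDerivAt (fun t ht => ?_)
      (Continuous.intervalIntegrable (by fun_prop) _ _)
    rw [uIcc_of_le (by linarith)] at ht
    have h := D.hasDerivAt_bdry ((contDiff_cut n).differentiable one_ne_zero t).hasDerivAt ht.1
    have e : D.gain (D.corr n) t = 4 * (t + D.ξ₀) * (t - cut n t * D.V t / D.U t)
        - (-deriv (cut n) t * (D.V t / D.U t)
          - cut n t * ((D.K t * D.U t - D.V t * D.V t) / D.U t ^ 2)) ^ 2 := by
      rw [gain, (D.hasDerivAt_corr n ht.1).deriv, corr]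
      ring
    rwa [e]
  rw [intervalIntegral.integral_sub (Continuous.intervalIntegrable (by fun_prop) _ _)
    (Continuous.intervalIntegrable (by fun_prop) _ _),
    intervalIntegral.integral_sub (Continuous.intervalIntegrable (by fun_prop) _ _)
    (Continuous.intervalIntegrable (by fun_prop) _ _), intervalIntegral.integral_const_mul] at key
  have hb : D.bdry (cut n) 0 = -D.ξ₀ * D.U 0 ^ 2 := by
    have := D.ξ₀_sq
    rw [bdry, D.V_of_nonpos le_rfl, zero_add, this]
    ring
  rw [hb] at key
  linarith

theorem bdry_cut_ge {C n : ℝ} (hn : 1 ≤ n) (h1 : (1 + 2 * n) ^ 2 * D.U (2 * n) ≤ C)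
    (h2 : (1 + 2 * n) ^ 2 * |D.V (2 * n)| ≤ C) :
    -(10 * C ^ 2 / n) ≤ D.bdry (cut n) (2 * n) := by
  have hn0 : 0 < n := by linarith
  have hth := D.theta_ub
  have hth' := D.theta_lb
  have hxi := D.ξ₀_mem
  rw [bdry, cut_of_ge hn0 le_rfl]
  have hU := D.U_pos (2 * n)
  have hs := D.abs_add_ξ₀_le (t := 2 * n) (by linarith)
  set U := D.U (2 * n)
  set V := D.V (2 * n)
  set s := 2 * n + D.ξ₀
  set p := 1 + 2 * n
  have hp : 1 ≤ p := by simp only [p]; linarith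
  have hp0 : 0 < p := by linarith
  have hUC : |U| ≤ C / p ^ 2 := by
    rw [abs_of_pos hU, le_div_iff₀ (by positivity)]; linarith
  have hVC : |V| ≤ C / p ^ 2 := by
    rw [le_div_iff₀ (by positivity)]; linarith
  have mulb : ∀ {x y A B : ℝ}, |x| ≤ A → |y| ≤ B → |x * y| ≤ A * B := fun {x y A B} hx hy => by
    rw [abs_mul]; exact mul_le_mul hx hy (abs_nonneg _) ((abs_nonneg _).trans hx)
  have hq : |s ^ 2 - Theta0| ≤ p ^ 2 := by
    have h3 : s ^ 2 ≤ p ^ 2 := by rw [← sq_abs]; gcongr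
    rw [abs_le]; constructor <;> nlinarith [sq_nonneg s]
  have hxi1 : |2 * D.ξ₀| ≤ 2 := by rw [abs_le]; constructor <;> linarith [hxi.1, hxi.2]
  have b1 := abs_le.1 (mulb (mulb hs hq) (mulb hUC hUC))
  have b2 := abs_le.1 (mulb hs (mulb hVC hVC))
  have b3 := abs_le.1 (mulb hUC hVC)
  have b4 := abs_le.1 (mulb hxi1 (mulb hq (mulb hUC hUC)))
  have b5 := abs_le.1 (mulb hxi1 (mulb hVC hVC))
  have b6 := abs_le.1 (mulb hs (mulb hUC hUC))
  have hfin : ∀ x, x = p ^ 3 ∨ x = p ∨ x = 1 ∨ x = 2 * p ^ 2 ∨ x = 2 →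
      x * (C / p ^ 2 * (C / p ^ 2)) ≤ C ^ 2 / n := by
    intro x hx
    have hx3 : x ≤ 2 * p ^ 2 ∨ x = p ^ 3 := by
      rcases hx with h | h | h | h | h
      · exact Or.inr h
      all_goals left; subst h; nlinarith
    have hx4 : x * n ≤ p ^ 4 := by
      have hpn : 2 * n ≤ p := by simp only [p]; linarith
      have hpp : p ^ 3 ≤ p ^ 4 := pow_le_pow_right₀ hp (by norm_num)
      rcases hx3 with h | h
      · calc x * n ≤ 2 * p ^ 2 * n := by gcongr
          _ = p ^ 2 * (2 * n) := by ring
          _ ≤ p ^ 2 * p := by gcongr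
          _ = p ^ 3 := by ring
          _ ≤ _ := hpp
      · rw [h]
        calc p ^ 3 * n ≤ p ^ 3 * p := by gcongr; linarith
          _ = p ^ 4 := by ring
    rw [le_div_iff₀ hn0]
    calc x * (C / p ^ 2 * (C / p ^ 2)) * n = x * n * (C ^ 2 / p ^ 4) := by field_simp
      _ ≤ p ^ 4 * (C ^ 2 / p ^ 4) := by gcongr
      _ = C ^ 2 := by field_simp
  have f1 := hfin _ (Or.inl rfl)
  have f2 := hfin _ (Or.inr (Or.inl rfl))
  have f3 := hfin _ (Or.inr (Or.inr (Or.inl rfl)))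
  have f4 := hfin _ (Or.inr (Or.inr (Or.inr (Or.inl rfl))))
  have f5 := hfin _ (Or.inr (Or.inr (Or.inr (Or.inr rfl))))
  have e10 : 10 * C ^ 2 / n = 10 * (C ^ 2 / n) := by ring
  rw [e10]
  generalize C / p ^ 2 * (C / p ^ 2) = e at b1 b2 b3 b4 b5 b6 f1 f2 f3 f4 f5
  generalize C ^ 2 / n = z at f1 f2 f3 f4 f5 ⊢
  have b1 := b1.1
  have b2 := b2.2
  have b3 := b3.1
  have b4 := b4.2
  have b5 := b5.1
  have b6 := b6.2
  linarith

theorem exists_gain_error_le : ∃ A, 0 < A ∧ ∀ n, 1 ≤ n →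
    -(A / n) ≤ D.bdry (cut n) (2 * n) + ∫ t in (0 : ℝ)..(2 * n),
      (2 * (1 - cut n t) ^ 2 * (t + D.ξ₀) * D.U t * D.V t - deriv (cut n) t ^ 2 * D.V t ^ 2) := by
  obtain ⟨C, hC, hdec⟩ := D.exists_decay
  obtain ⟨M, hM, hcut⟩ := exists_abs_deriv_cut_le
  have cU := D.continuous_U
  have cV := D.continuous_V
  refine ⟨10 * C ^ 2 + 4 * C ^ 2 + 2 * M ^ 2 * C ^ 2, by positivity, fun n hn => ?_⟩
  have hn0 : 0 < n := by linarith
  have hb : -(10 * C ^ 2 / n) ≤ D.bdry (cut n) (2 * n) :=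
    D.bdry_cut_ge hn (hdec _ (by linarith)).1 (hdec _ (by linarith)).2
  have hi : -((4 * C ^ 2 + 2 * M ^ 2 * C ^ 2) / n) ≤ ∫ t in (0 : ℝ)..(2 * n),
      (2 * (1 - cut n t) ^ 2 * (t + D.ξ₀) * D.U t * D.V t
        - deriv (cut n) t ^ 2 * D.V t ^ 2) := by
    have cc := (contDiff_cut n).continuous
    have cc' := (contDiff_cut n).continuous_deriv le_rfl
    have : ∫ t in (0 : ℝ)..(2 * n), (-((2 * C ^ 2 + M ^ 2 * C ^ 2) / n ^ 2)) ≤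
        ∫ t in (0 : ℝ)..(2 * n), (2 * (1 - cut n t) ^ 2 * (t + D.ξ₀) * D.U t * D.V t
        - deriv (cut n) t ^ 2 * D.V t ^ 2) := by
      refine intervalIntegral.integral_mono_on (by linarith)
        (Continuous.intervalIntegrable (by fun_prop) _ _)
        (Continuous.intervalIntegrable (by fun_prop) _ _) fun t ht => ?_
      obtain ⟨h1, h2⟩ := hdec t ht.1
      have hU := D.U_pos t
      have hp : 1 ≤ 1 + t := by linarith [ht.1]
      have hV0 : |D.V t| ≤ C := le_trans (le_mul_of_one_le_left (abs_nonneg _) (one_le_pow₀ hp)) h2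
      have e1 : deriv (cut n) t ^ 2 * D.V t ^ 2 ≤ M ^ 2 * C ^ 2 / n ^ 2 := by
        rw [← sq_abs (deriv _ _), ← sq_abs (D.V t)]
        calc _ ≤ (M / n) ^ 2 * C ^ 2 := by
              gcongr
              exact hcut n t hn0
          _ = _ := by ring
      have e2 : -(2 * C ^ 2 / n ^ 2) ≤
          2 * (1 - cut n t) ^ 2 * (t + D.ξ₀) * D.U t * D.V t := by
        rcases le_total t n with h | h
        · rw [cut_of_le hn0 h]
          simp only [sub_self]
          have : 0 ≤ 2 * C ^ 2 / n ^ 2 := by positivity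
          nlinarith
        · have hq : (1 - cut n t) ^ 2 ≤ 1 := by
            have := cut_mem n t
            nlinarith
          refine neg_le_of_abs_le ?_
          rw [abs_mul, abs_mul, abs_mul, abs_of_nonneg (by positivity : 0 ≤ 2 * (1 - cut n t) ^ 2),
            abs_of_pos hU]
          calc _ ≤ 2 * 1 * (1 + t) * D.U t * |D.V t| := by
                gcongr
                exact D.abs_add_ξ₀_le ht.1
            _ ≤ 2 * C ^ 2 / n ^ 2 := by
                rw [le_div_iff₀ (by positivity)]
                have hnt : n ^ 2 ≤ (1 + t) ^ 2 := by gcongr; linarith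
                calc 2 * 1 * (1 + t) * D.U t * |D.V t| * n ^ 2
                    ≤ 2 * 1 * (1 + t) * D.U t * |D.V t| * (1 + t) ^ 2 := by gcongr
                  _ ≤ 2 * 1 * (1 + t) ^ 2 * D.U t * |D.V t| * (1 + t) ^ 2 := by
                      gcongr; nlinarith
                  _ = 2 * (((1 + t) ^ 2 * D.U t) * ((1 + t) ^ 2 * |D.V t|)) := by ring
                  _ ≤ 2 * (C * C) := by gcongr
                  _ = _ := by ring
      have e3 : (2 * C ^ 2 + M ^ 2 * C ^ 2) / n ^ 2 = 2 * C ^ 2 / n ^ 2 + M ^ 2 * C ^ 2 / n ^ 2 :=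
        add_div _ _ _
      linarith
    rw [intervalIntegral.integral_const, smul_eq_mul] at this
    refine le_trans (le_of_eq ?_) this
    field_simp
    ring
  have e : (10 * C ^ 2 + 4 * C ^ 2 + 2 * M ^ 2 * C ^ 2) / n =
    10 * C ^ 2 / n + (4 * C ^ 2 + 2 * M ^ 2 * C ^ 2) / n := by ring
  linarith

end DeGennes

namespace DeGennes
variable (D : DeGennes)

theorem exists_corrector {ε : ℝ} (hε : 0 < ε) : ∃ (N : ℝ) (ω : ℝ → ℝ), 6 ≤ N ∧ ContDiff ℝ 1 ω ∧
    (∀ t, N ≤ t → ω t = 0) ∧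
    2 * Theta0 + 1 - D.U 0 ^ 2 * |D.ξ₀| - ε ≤ ∫ t in (0 : ℝ)..N, D.gain ω t * D.U t ^ 2 := by
  obtain ⟨A, hA, herr⟩ := D.exists_gain_error_le
  have hth := D.theta_ub
  have hth' := D.theta_lb
  have ht1 : Tendsto (fun n : ℝ => ∫ t in (0 : ℝ)..(2 * n), D.U t ^ 2) atTop (𝓝 1) :=
    D.tendsto_integral_U_sq.comp (tendsto_id.const_mul_atTop two_pos)
  have ht2 : Tendsto (fun n : ℝ => A / n) atTop (𝓝 0) := tendsto_const_nhds.div_atTop tendsto_id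
  obtain ⟨n, hn, hn1, hn2⟩ := ((eventually_ge_atTop 3).and
    ((ht1.eventually (lt_mem_nhds (show 1 - ε / 6 < 1 by linarith))).and
      (ht2.eventually (gt_mem_nhds (show 0 < ε / 2 by linarith))))).exists
  have hn0 : 0 < n := by linarith
  refine ⟨2 * n, D.corr n, by linarith, D.contDiff_corr n, fun t ht => D.corr_of_ge hn0 ht, ?_⟩
  rw [D.integral_gain hn0, abs_of_neg D.ξ₀_mem.2]
  have := herr n (by linarith)
  nlinarith

theorem mul_U_zero_sq_le {T : ℝ} (hT : 0 ≤ T) : |D.ξ₀| * D.U 0 ^ 2 ≤ 3 / 2 * Theta0 +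
    (|D.ξ₀| * D.U T ^ 2 + D.U T * D.V T - ((T + D.ξ₀) * ((T + D.ξ₀) ^ 2 - Theta0) * D.U T ^ 2
      - (T + D.ξ₀) * D.V T ^ 2 + D.U T * D.V T) / 4) := by
  have cU := D.continuous_U
  have cV := D.continuous_V
  set G : ℝ → ℝ := fun T => |D.ξ₀| * D.U T ^ 2 + (D.U T * D.V T -
    ((T + D.ξ₀) * ((T + D.ξ₀) ^ 2 - Theta0) * D.U T ^ 2
      - (T + D.ξ₀) * D.V T ^ 2 + D.U T * D.V T) / 4) with hG
  have key : ∫ t in (0 : ℝ)..T,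
      (2 * |D.ξ₀| * D.U t * D.V t + D.V t ^ 2 - Theta0 / 2 * D.U t ^ 2) = G T - G 0 := by
    refine intervalIntegral.integral_eq_sub_of_hasDerivAt (fun t ht => ?_)
      (Continuous.intervalIntegrable (by fun_prop) _ _)
    rw [uIcc_of_le hT] at ht
    have hs : HasDerivAt (fun t => t + D.ξ₀) 1 t := (hasDerivAt_id t).add_const _
    have hU := D.hasDerivAt_U t
    have hV := D.hasDerivAt_V ht.1
    have h := ((hU.pow 2).const_mul |D.ξ₀|).add ((hU.mul hV).sub
      ((((hs.mul ((hs.pow 2).sub_const Theta0)).mul (hU.pow 2)).sub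
        (hs.mul (hV.pow 2))).add (hU.mul hV) |>.div_const 4))
    convert! h using 1
    simp only [Pi.mul_apply, Pi.pow_apply]
    rw [show D.K t = ((t + D.ξ₀) ^ 2 - Theta0) * D.U t from rfl]
    push_cast
    ring
  have hle : ∫ t in (0 : ℝ)..T, (-(3 / 2 * Theta0) * D.U t ^ 2) ≤ ∫ t in (0 : ℝ)..T,
      (2 * |D.ξ₀| * D.U t * D.V t + D.V t ^ 2 - Theta0 / 2 * D.U t ^ 2) := by
    refine intervalIntegral.integral_mono_on hT (Continuous.intervalIntegrable (by fun_prop) _ _)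
      (Continuous.intervalIntegrable (by fun_prop) _ _) fun t _ => ?_
    have h1 : |D.ξ₀| ^ 2 = Theta0 := by rw [sq_abs, D.ξ₀_sq]
    rw [← h1]
    linarith [sq_nonneg (|D.ξ₀| * D.U t + D.V t)]
  rw [key, intervalIntegral.integral_const_mul] at hle
  have h1 := D.integral_U_sq_le hT
  have h2 := D.theta_lb
  have hG0 : G 0 = |D.ξ₀| * D.U 0 ^ 2 := by
    simp only [hG]
    rw [D.V_of_nonpos le_rfl, zero_add, D.ξ₀_sq]
    ring
  rw [hG0] at hle
  have hGT : G T = |D.ξ₀| * D.U T ^ 2 + (D.U T * D.V T -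
    ((T + D.ξ₀) * ((T + D.ξ₀) ^ 2 - Theta0) * D.U T ^ 2
      - (T + D.ξ₀) * D.V T ^ 2 + D.U T * D.V T) / 4) := rfl
  nlinarith

theorem U_zero : D.U 0 = D.u₀ 0 := D.U_of_nonneg le_rfl

theorem target_eq : Theta0 - 3 / 2 * D.C1 * |D.ξ₀| = Theta0 - D.U 0 ^ 2 * |D.ξ₀| / 2 := by
  rw [C1, U_zero]; ring

theorem target_pos : 0 < Theta0 - 3 / 2 * D.C1 * |D.ξ₀| := by
  rw [target_eq]
  obtain ⟨C, hC, hdec⟩ := D.exists_decay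
  have hth := D.theta_ub
  have hth' := D.theta_lb
  have hxi := D.ξ₀_mem
  have hC2 : 0 < C ^ 2 := by positivity
  obtain ⟨T, hT3, hTC⟩ : ∃ T : ℝ, 3 ≤ T ∧ 16 * C ^ 2 ≤ T :=
    ⟨max 3 (16 * C ^ 2), le_max_left _ _, le_max_right _ _⟩
  have hT : 0 ≤ T := by linarith
  have h := D.mul_U_zero_sq_le hT
  obtain ⟨h1, h2⟩ := hdec T hT
  have hU := D.U_pos T
  have hs := abs_le.1 (D.abs_add_ξ₀_le hT)
  have hUV := D.U_add_V_nonpos (a := T) hT3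
  have ha : |D.ξ₀| ≤ 1 := by rw [abs_of_neg hxi.2]; linarith [hxi.1]
  generalize D.U T = U at *
  generalize D.V T = V at *
  have hVabs : |V| = -V := abs_of_nonpos (by linarith)
  rw [hVabs] at h2
  have hp : 0 < 1 + T := by linarith
  have e1 : U ≤ C / (1 + T) ^ 2 := by rw [le_div_iff₀ (by positivity)]; linarith
  have e2 : -V ≤ C / (1 + T) ^ 2 := by rw [le_div_iff₀ (by positivity)]; linarith
  have e3 : (1 + T) * (C / (1 + T) ^ 2 * (C / (1 + T) ^ 2)) ≤ 1 / 16 := by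
    rw [show (1 + T) * (C / (1 + T) ^ 2 * (C / (1 + T) ^ 2)) = C ^ 2 / (1 + T) ^ 3 by field_simp,
      div_le_iff₀ (by positivity)]
    have : 1 + T ≤ (1 + T) ^ 3 := le_self_pow₀ (by linarith) (by norm_num)
    linarith
  generalize C / (1 + T) ^ 2 = e at *
  have f1 : U ^ 2 ≤ e * e := by nlinarith
  have f2 : V ^ 2 ≤ e * e := by nlinarith
  have f3 : -(U * V) ≤ e * e := by nlinarith
  have f4 : 0 ≤ -(U * V) := by nlinarith
  have g1 : |D.ξ₀| * U ^ 2 ≤ e * e := by nlinarith [sq_nonneg U]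
  have g2 : (T + D.ξ₀) * V ^ 2 ≤ (1 + T) * (e * e) := by
    have : 0 ≤ e * e := by linarith
    nlinarith [sq_nonneg V]
  have g3 : 0 ≤ (T + D.ξ₀) * ((T + D.ξ₀) ^ 2 - Theta0) * U ^ 2 := by
    have : 0 ≤ T + D.ξ₀ := by linarith [hxi.1]
    have : 0 ≤ (T + D.ξ₀) ^ 2 - Theta0 := by nlinarith [hxi.1]
    positivity
  have g4 : e * e ≤ (1 + T) * (e * e) := by nlinarith
  linarith

end DeGennes

theorem Adm.continuous_En {R : ℝ} (hR : 0 < R) {F : ℝ → ℝ} (h : Adm R F) (ξ : ℝ) :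
    Continuous fun t => (deriv F t ^ 2 + (pot R ξ t * F t) ^ 2) * (1 - t / R) := by
  have h1 := h.continuous_deriv
  have h2 := h.continuous_pot hR ξ
  fun_prop

theorem Adm.continuous_Nm {R : ℝ} {F : ℝ → ℝ} (h : Adm R F) :
    Continuous fun t => F t ^ 2 * (1 - t / R) := by
  have h1 := h.continuous
  fun_prop

theorem Nm_nonneg {R : ℝ} (hR : 0 < R) (F : ℝ → ℝ) : 0 ≤ Nm R F :=
  intervalIntegral.integral_nonneg hR.le fun _ ht => mul_nonneg (sq_nonneg _) (weight_mem hR ht).1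

theorem weight_pos {R t : ℝ} (hR : 0 < R) (ht : t < R) : 0 < 1 - t / R :=
  sub_pos.2 ((div_lt_one hR).2 ht)

theorem integral_deriv_mul_sq {R : ℝ} (hR : 0 < R) {F : ℝ → ℝ} (h : Adm R F) {g g' : ℝ → ℝ}
    (hg : ∀ t, t ≠ R → HasDerivAt g (g' t) t) (hg' : ∀ t, t ≠ R → ContinuousAt g' t) :
    ∫ t in (0 : ℝ)..R, (g' t * F t ^ 2 + 2 * g t * F t * deriv F t) = -(g 0 * F 0 ^ 2) := by
  have c1 := h.continuous_mul hg'
  have c2 := h.continuous_mul fun t ht => (hg t ht).continuousAt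
  have cF := h.continuous
  have cF' := h.continuous_deriv
  have hc : Continuous fun t => g' t * F t ^ 2 + 2 * g t * F t * deriv F t := by
    have e : (fun t => g' t * F t ^ 2 + 2 * g t * F t * deriv F t) =
        fun t => (g' t * F t) * F t + 2 * (g t * F t) * deriv F t := by ext t; ring
    rw [e]
    fun_prop
  rw [intervalIntegral.integral_eq_sub_of_hasDerivAt_of_le (f := fun t => g t * F t * F t) hR.le
    (by fun_prop) (fun t ht => ?_) (hc.intervalIntegrable _ _)]
  · have hFR : F R = 0 := by
      obtain ⟨ε, hε, h0⟩ := h.2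
      exact h0 R (by linarith)
    rw [hFR]
    ring
  · have hF := (h.contDiff.differentiable one_ne_zero t).hasDerivAt
    convert! ((hg t ht.2.ne).mul hF).mul hF using 1
    simp only [Pi.mul_apply]
    ring

/-- Lower bound on the energy from a field `g` (an integrating factor). -/
theorem mul_Nm_add_le_En {R : ℝ} (hR : 0 < R) {F : ℝ → ℝ} (h : Adm R F) (ξ c : ℝ) {g g' : ℝ → ℝ}
    (hg : ∀ t, t ≠ R → HasDerivAt g (g' t) t) (hg' : ∀ t, t ≠ R → ContinuousAt g' t)
    (hc : ∀ t ∈ Ioo 0 R,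
      c * (1 - t / R) ≤ g' t - g t ^ 2 / (1 - t / R) + bb R ξ t ^ 2 / (1 - t / R)) :
    c * Nm R F + g 0 * F 0 ^ 2 ≤ En R ξ F := by
  have c1 := h.continuous_mul hg'
  have c2 := h.continuous_mul fun t ht => (hg t ht).continuousAt
  have cF := h.continuous
  have cF' := h.continuous_deriv
  have hcc : Continuous fun t => g' t * F t ^ 2 + 2 * g t * F t * deriv F t := by
    have e : (fun t => g' t * F t ^ 2 + 2 * g t * F t * deriv F t) =
        fun t => (g' t * F t) * F t + 2 * (g t * F t) * deriv F t := by ext t; ring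
    rw [e]
    fun_prop
  have cN := h.continuous_Nm
  have cE := h.continuous_En hR ξ
  have key : ∫ t in (0 : ℝ)..R, (c * (F t ^ 2 * (1 - t / R))
        - (g' t * F t ^ 2 + 2 * g t * F t * deriv F t))
      ≤ En R ξ F := by
    refine intervalIntegral.integral_mono_on_of_le_Ioo hR.le
      (Continuous.intervalIntegrable (by fun_prop) _ _) (cE.intervalIntegrable _ _) fun t ht => ?_
    have hρ := weight_pos hR ht.2
    have h1 := mul_le_mul_of_nonneg_right (hc t ht) (sq_nonneg (F t))
    have h2 : 0 ≤ (deriv F t + g t / (1 - t / R) * F t) ^ 2 * (1 - t / R) := by positivity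
    have h3 : (deriv F t + g t / (1 - t / R) * F t) ^ 2 * (1 - t / R) =
        deriv F t ^ 2 * (1 - t / R) + 2 * g t * F t * deriv F t
          + g t ^ 2 / (1 - t / R) * F t ^ 2 := by
      generalize 1 - t / R = ρ at hρ
      field_simp
      ring
    have h4 : (pot R ξ t * F t) ^ 2 * (1 - t / R) = bb R ξ t ^ 2 / (1 - t / R) * F t ^ 2 := by
      rw [pot]
      generalize 1 - t / R = ρ at hρ
      field_simp
    rw [add_mul, h4]
    linarith
  rw [intervalIntegral.integral_sub (Continuous.intervalIntegrable (by fun_prop) _ _)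
    (hcc.intervalIntegrable _ _), intervalIntegral.integral_const_mul,
    integral_deriv_mul_sq hR h hg hg'] at key
  unfold Nm
  linarith

theorem hasDerivAt_bb (R ξ t : ℝ) : HasDerivAt (bb R ξ) (1 - t / R) t := by
  have h := ((hasDerivAt_id t).add_const ξ).sub (((hasDerivAt_id t).pow 2).div_const (2 * R))
  convert! h using 1
  simp
  by_cases hR : R = 0
  · simp [hR]
  · field_simp

theorem Nm_add_le_En {R : ℝ} (hR : 0 < R) {F : ℝ → ℝ} (h : Adm R F) (ξ : ℝ) :
    Nm R F + ξ * F 0 ^ 2 ≤ En R ξ F := by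
  have := mul_Nm_add_le_En hR h ξ 1 (g := bb R ξ) (g' := fun t => 1 - t / R)
    (fun t _ => hasDerivAt_bb R ξ t) (fun t _ => by fun_prop) (fun t ht => by linarith)
  simpa [bb] using this

theorem hasDerivAt_min_sq (x : ℝ) : HasDerivAt (fun x : ℝ => min x 0 ^ 2) (2 * min x 0) x := by
  have hne : ∀ s : ℝ, s ≠ 0 → HasDerivAt (fun x : ℝ => min x 0 ^ 2) (2 * min s 0) s := by
    intro s hs
    rcases lt_or_gt_of_ne hs with h | h
    · rw [min_eq_left h.le]
      refine HasDerivAt.congr_of_eventuallyEq (f := fun x => x ^ 2)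
        (by simpa using hasDerivAt_pow 2 s) ?_
      filter_upwards [Iio_mem_nhds h] with y hy
      rw [min_eq_left (le_of_lt hy)]
    · rw [min_eq_right h.le, mul_zero]
      refine (hasDerivAt_const s (0 : ℝ)).congr_of_eventuallyEq ?_
      filter_upwards [Ioi_mem_nhds h] with y hy
      rw [min_eq_right (le_of_lt hy)]
      simp
  by_cases hx : x = 0
  · subst hx
    refine hasDerivAt_of_hasDerivAt_of_ne (g := fun s : ℝ => 2 * min s 0) hne ?_ ?_ <;> fun_prop
  · exact hne x hx

theorem one_sub_mul_Nm_le_En_aux {R : ℝ} (hR : 0 < R) {F : ℝ → ℝ} (h : Adm R F) {ξ : ℝ}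
    (hξ : ξ < 0) (hξR : -(R / 2) ≤ ξ) : (1 - 2 / |ξ|) * Nm R F ≤ En R ξ F := by
  have hℓ : 0 < -ξ := by linarith
  rw [abs_of_neg hξ]
  have := mul_Nm_add_le_En hR h ξ (1 - 2 / -ξ)
    (g := fun t => bb R ξ t + min (bb R ξ t) 0 ^ 2 / (1 - t / R) / -ξ)
    (g' := fun t => (1 - t / R) + (2 * min (bb R ξ t) 0
      + min (bb R ξ t) 0 ^ 2 / (1 - t / R) ^ 2 / R) / -ξ) ?_ ?_ ?_
  · have h0 : bb R ξ 0 = ξ := by simp [bb]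
    have h1 : min ξ 0 = ξ := min_eq_left hξ.le
    simp only [h0, h1] at this
    have h2 : ξ + ξ ^ 2 / (1 - 0 / R) / -ξ = 0 := by
      rw [zero_div, sub_zero, div_one]
      field_simp
      ring
    rw [h2] at this
    linarith
  · intro t ht
    have hρ := one_sub_div_ne hR ht
    have h1 := (hasDerivAt_min_sq (bb R ξ t)).comp t (hasDerivAt_bb R ξ t)
    have h2 : HasDerivAt (fun t : ℝ => 1 - t / R) (-(1 / R)) t :=
      ((hasDerivAt_id t).div_const R).const_sub 1
    have h3 := (hasDerivAt_bb R ξ t).add ((h1.div h2 hρ).div_const (-ξ))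
    convert! h3 using 1
    simp only [Function.comp]
    field_simp
    ring
  · intro t ht
    have hρ := one_sub_div_ne hR ht
    have hb : ContinuousAt (bb R ξ) t := (continuous_bb R ξ).continuousAt
    have h1 : ContinuousAt (fun t => min (bb R ξ t) 0 ^ 2 / (1 - t / R) ^ 2) t :=
      ContinuousAt.div (by fun_prop) (by fun_prop) (pow_ne_zero 2 hρ)
    fun_prop
  · intro t ht
    have hρ := weight_pos hR ht.2
    have hx : bb R ξ t / (1 - t / R) * (1 - t / R) = bb R ξ t := div_mul_cancel₀ _ hρ.ne'
    have hlow : ξ ≤ bb R ξ t / (1 - t / R) := by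
      rw [le_div_iff₀ hρ, bb]
      have h1 : 0 ≤ t * (1 - t / R / 2 + ξ / R) := by
        refine mul_nonneg ht.1.le ?_
        have h2 : t / R ≤ 1 := (div_le_one hR).2 ht.2.le
        have h3 : -(1 / 2) ≤ ξ / R := by
          rw [le_div_iff₀ hR]; linarith
        linarith
      have h4 : t ^ 2 / (2 * R) = t * (t / R / 2) := by ring
      have h5 : ξ * (1 - t / R) = ξ - t * (ξ / R) := by ring
      rw [h4, h5]
      linarith
    set ρ := 1 - t / R
    set a := bb R ξ t / ρ
    rw [← hx]
    rcases le_total 0 a with ha | ha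
    · rw [min_eq_right (by positivity)]
      have : 0 < 2 / -ξ := by positivity
      have e : (a * ρ + 0 ^ 2 / ρ / -ξ) ^ 2 / ρ = (a * ρ) ^ 2 / ρ := by simp
      rw [e]
      have : ρ + (2 * 0 + 0 ^ 2 / ρ ^ 2 / R) / -ξ = ρ := by simp
      rw [this]
      nlinarith
    · rw [min_eq_left (mul_nonpos_of_nonpos_of_nonneg ha hρ.le)]
      have e : ρ + (2 * (a * ρ) + (a * ρ) ^ 2 / ρ ^ 2 / R) / -ξ
          - (a * ρ + (a * ρ) ^ 2 / ρ / -ξ) ^ 2 / ρ + (a * ρ) ^ 2 / ρ - (1 - 2 / -ξ) * ρ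
          = (ρ * (2 + 2 * a - 2 * a ^ 3 - a ^ 4 / -ξ) + a ^ 2 / R) / -ξ := by
        field_simp
        ring
      have h1 : a ^ 4 / -ξ ≤ -a ^ 3 := by
        rw [div_le_iff₀ hℓ]
        nlinarith [mul_nonneg (mul_nonneg (sq_nonneg a) (neg_nonneg.2 ha)) (sub_nonneg.2 hlow)]
      have h2 : 0 ≤ 2 + 2 * a - a ^ 3 := by nlinarith [sq_nonneg (a + 1)]
      have h3 : 0 ≤ (ρ * (2 + 2 * a - 2 * a ^ 3 - a ^ 4 / -ξ) + a ^ 2 / R) / -ξ := by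
        have : 0 ≤ 2 + 2 * a - 2 * a ^ 3 - a ^ 4 / -ξ := by linarith
        positivity
      linarith

theorem one_sub_mul_Nm_le_En {R L : ℝ} (hL : 0 < L) (hR : 2 * L ≤ R) {F : ℝ → ℝ} (h : Adm R F)
    {ξ : ℝ} (hξ : ξ ≤ -L) : (1 - 2 / L) * Nm R F ≤ En R ξ F := by
  have hR0 : 0 < R := by linarith
  have hN := Nm_nonneg hR0 F
  have main : ∀ ζ, ζ ≤ -L → -(R / 2) ≤ ζ → (1 - 2 / L) * Nm R F ≤ En R ζ F := by
    intro ζ h1 h2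
    refine le_trans ?_ (one_sub_mul_Nm_le_En_aux hR0 h (by linarith) h2)
    have h3 : L ≤ |ζ| := by rw [abs_of_neg (by linarith)]; linarith
    gcongr
  rcases le_total (-(R / 2)) ξ with h1 | h1
  · exact main ξ hξ h1
  · refine (main (-(R / 2)) (by linarith) le_rfl).trans ?_
    refine intervalIntegral.integral_mono_on_of_le_Ioo hR0.le
      ((h.continuous_En hR0 _).intervalIntegrable _ _)
      ((h.continuous_En hR0 _).intervalIntegrable _ _) fun t ht => ?_
    have hρ := weight_pos hR0 ht.2
    have h2 : bb R ξ t ≤ bb R (-(R / 2)) t := by unfold bb; linarith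
    have h3 : bb R (-(R / 2)) t ≤ 0 := by
      have : bb R (-(R / 2)) t = -((R - t) ^ 2 / (2 * R)) := by
        unfold bb; field_simp; ring
      rw [this, neg_nonpos]
      positivity
    have h4 : pot R (-(R / 2)) t ^ 2 ≤ pot R ξ t ^ 2 := by
      rw [pot, pot, div_pow, div_pow]
      gcongr ?_ / _
      nlinarith
    rw [mul_pow, mul_pow]
    gcongr

/-- Admissible test functions on the half-line. -/
def halfTest : Set (ℝ → ℝ) :=
  {φ | ContDiff ℝ 1 φ ∧ HasCompactSupport φ ∧ ∃ τ, 0 < τ ∧ φ τ ≠ 0}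

/-- Half-line energy of a test function. -/
def halfEn (φ : ℝ → ℝ) (ζ : ℝ) : ℝ :=
  ∫ τ in Ioi (0 : ℝ), ((deriv φ τ) ^ 2 + (τ + ζ) ^ 2 * (φ τ) ^ 2)

/-- Half-line mass of a test function. -/
def halfNm (φ : ℝ → ℝ) : ℝ := ∫ τ in Ioi (0 : ℝ), (φ τ) ^ 2

theorem muGen_eq (ζ : ℝ) : muGen ζ = sInf ((fun φ => halfEn φ ζ / halfNm φ) '' halfTest) := by
  unfold muGen
  congr 1
  ext r
  constructor
  · rintro ⟨φ, h1, h2, h3, rfl⟩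
    exact ⟨φ, ⟨h1, h2, h3⟩, rfl⟩
  · rintro ⟨φ, ⟨h1, h2, h3⟩, rfl⟩
    exact ⟨φ, h1, h2, h3, rfl⟩

theorem integrableOn_of_compact {φ : ℝ → ℝ} (h : HasCompactSupport φ) (hc : Continuous φ)
    (s : Set ℝ) : IntegrableOn φ s := (hc.integrable_of_hasCompactSupport h).integrableOn

theorem halfNm_pos {φ : ℝ → ℝ} (hφ : φ ∈ halfTest) : 0 < halfNm φ := by
  obtain ⟨h1, h2, τ, hτ, h3⟩ := hφ
  have hc := h1.continuous
  have hcs : HasCompactSupport fun t => φ t ^ 2 := h2.comp_left (g := fun x => x ^ 2) (by simp)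
  refine (setIntegral_pos_iff_support_of_nonneg_ae (Eventually.of_forall fun t => sq_nonneg _)
    (integrableOn_of_compact hcs (by fun_prop) _)).2 ?_
  have hopen : IsOpen (Function.support (fun t => φ t ^ 2) ∩ Ioi 0) :=
    ((by fun_prop : Continuous fun t => φ t ^ 2).isOpen_support).inter isOpen_Ioi
  exact hopen.measure_pos _ ⟨τ, by simpa using h3, hτ⟩

theorem halfEn_nonneg (φ : ℝ → ℝ) (ζ : ℝ) : 0 ≤ halfEn φ ζ :=
  integral_nonneg fun _ => by positivity

theorem halfEn_expand {φ : ℝ → ℝ} (hφ : φ ∈ halfTest) (ζ : ℝ) : halfEn φ ζ =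
    halfEn φ 0 + ζ * (∫ τ in Ioi (0 : ℝ), 2 * τ * φ τ ^ 2) + ζ ^ 2 * halfNm φ := by
  obtain ⟨h1, h2, -⟩ := hφ
  have hc := h1.continuous
  have hc' := h1.continuous_deriv le_rfl
  have h2' : HasCompactSupport (deriv φ) := h2.deriv
  have hcs : HasCompactSupport fun t => φ t ^ 2 := h2.comp_left (g := fun x => x ^ 2) (by simp)
  have hcs' : HasCompactSupport fun t => deriv φ t ^ 2 :=
    h2'.comp_left (g := fun x => x ^ 2) (by simp)
  have i1 : IntegrableOn (fun τ => deriv φ τ ^ 2 + (τ + 0) ^ 2 * φ τ ^ 2) (Ioi 0) :=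
    integrableOn_of_compact (hcs'.add (hcs.mul_left)) (by fun_prop) _
  have i2 : IntegrableOn (fun τ => 2 * τ * φ τ ^ 2) (Ioi 0) :=
    integrableOn_of_compact (hcs.mul_left) (by fun_prop) _
  have i3 : IntegrableOn (fun τ => φ τ ^ 2) (Ioi 0) :=
    integrableOn_of_compact hcs (by fun_prop) _
  have i12 : IntegrableOn (fun τ => deriv φ τ ^ 2 + (τ + 0) ^ 2 * φ τ ^ 2 +
      ζ * (2 * τ * φ τ ^ 2)) (Ioi 0) := i1.add (i2.const_mul ζ)
  have i3c : IntegrableOn (fun τ => ζ ^ 2 * φ τ ^ 2) (Ioi 0) := i3.const_mul _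
  unfold halfEn halfNm
  rw [← integral_const_mul, ← integral_const_mul, ← integral_add i1 (i2.const_mul ζ),
    ← integral_add i12 i3c]
  congr 1
  ext τ
  ring

theorem contDiff_smoothTransition_add_one : ContDiff ℝ 1 fun t => Real.smoothTransition (t + 1) :=
  Real.smoothTransition.contDiff.comp (by fun_prop)

/-- Cutting off a half-line function on the negative axis. -/
def cutNeg (G : ℝ → ℝ) (t : ℝ) : ℝ := Real.smoothTransition (t + 1) * G t

theorem cutNeg_of_nonneg (G : ℝ → ℝ) {t : ℝ} (ht : 0 ≤ t) : cutNeg G t = G t := by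
  rw [cutNeg, Real.smoothTransition.one_of_one_le (by linarith), one_mul]

theorem deriv_cutNeg (G : ℝ → ℝ) {t : ℝ} (ht : 0 < t) : deriv (cutNeg G) t = deriv G t := by
  refine Filter.EventuallyEq.deriv_eq ?_
  filter_upwards [Ioi_mem_nhds ht] with s hs using cutNeg_of_nonneg G (le_of_lt hs)

theorem cutNeg_hasCompactSupport {G : ℝ → ℝ} {M : ℝ} (h : ∀ t, M ≤ t → G t = 0) :
    HasCompactSupport (cutNeg G) := by
  refine HasCompactSupport.intro (isCompact_Icc (a := -1) (b := M)) fun t ht => ?_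
  rw [cutNeg]
  by_cases h1 : t ≤ -1
  · rw [Real.smoothTransition.zero_of_nonpos (by linarith), zero_mul]
  · rw [h t (by
      by_contra! h2
      exact ht ⟨by linarith, h2.le⟩), mul_zero]

theorem contDiff_cutNeg {G : ℝ → ℝ} (hG : ContDiff ℝ 1 G) : ContDiff ℝ 1 (cutNeg G) :=
  contDiff_smoothTransition_add_one.mul hG

theorem halfTest_nonempty : halfTest.Nonempty := by
  have hG : ContDiff ℝ 1 fun t : ℝ => Real.smoothTransition (2 - t) :=
    Real.smoothTransition.contDiff.comp (by fun_prop)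
  refine ⟨cutNeg fun t => Real.smoothTransition (2 - t), contDiff_cutNeg hG,
    cutNeg_hasCompactSupport (M := 2) fun t ht =>
      Real.smoothTransition.zero_of_nonpos (by linarith), 1, one_pos, ?_⟩
  rw [cutNeg_of_nonneg _ zero_le_one, Real.smoothTransition.one_of_one_le (by norm_num)]
  exact one_ne_zero

theorem muGen_mul_le {φ : ℝ → ℝ} (hφ : φ ∈ halfTest) (ζ : ℝ) :
    muGen ζ * halfNm φ ≤ halfEn φ ζ := by
  rw [← le_div_iff₀ (halfNm_pos hφ), muGen_eq]
  refine csInf_le ⟨0, ?_⟩ ⟨φ, hφ, rfl⟩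
  rintro _ ⟨ψ, hψ, rfl⟩
  exact div_nonneg (halfEn_nonneg ψ ζ) (halfNm_pos hψ).le

theorem muGen_nonneg (ζ : ℝ) : 0 ≤ muGen ζ := by
  rw [muGen_eq]
  refine Real.sInf_nonneg ?_
  rintro _ ⟨ψ, hψ, rfl⟩
  exact div_nonneg (halfEn_nonneg ψ ζ) (halfNm_pos hψ).le

theorem exists_halfEn_lt (ζ : ℝ) {ε : ℝ} (hε : 0 < ε) :
    ∃ φ ∈ halfTest, halfEn φ ζ < (muGen ζ + ε) * halfNm φ := by
  obtain ⟨_, ⟨φ, hφ, rfl⟩, hlt⟩ := Real.lt_sInf_add_pos (halfTest_nonempty.image _) hε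
    (s := (fun φ => halfEn φ ζ / halfNm φ) '' halfTest)
  rw [← muGen_eq] at hlt
  exact ⟨φ, hφ, (div_lt_iff₀ (halfNm_pos hφ)).1 hlt⟩

theorem continuous_muGen : Continuous muGen := by
  have h : ConcaveOn ℝ univ fun ζ => muGen ζ - ζ ^ 2 := by
    simp_rw [muGen_eq]
    refine concaveOn_sInf_sub convex_univ halfTest_nonempty (fun φ hφ => ?_)
      fun φ hφ ζ _ => div_nonneg (halfEn_nonneg φ ζ) (halfNm_pos hφ).le
    have hpos := halfNm_pos hφ
    have := concaveOn_quadratic convex_univ (halfEn φ 0 / halfNm φ)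
      ((∫ τ in Ioi (0 : ℝ), 2 * τ * φ τ ^ 2) / halfNm φ) 0 le_rfl
    convert this using 2 with ζ
    rw [halfEn_expand hφ ζ]
    field_simp
    ring
  have h1 := (h.continuousOn isOpen_univ)
  rw [← continuousOn_univ]
  have h2 : muGen = fun ζ => (muGen ζ - ζ ^ 2) + ζ ^ 2 := by ext; ring
  rw [h2]
  exact h1.add (by fun_prop)

theorem Theta0_le_muGen (ζ : ℝ) : Theta0 ≤ muGen ζ :=
  csInf_le ⟨0, by rintro _ ⟨z, rfl⟩; exact muGen_nonneg z⟩ ⟨ζ, rfl⟩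

theorem DeGennes.exists_gap (D : DeGennes) (L : ℝ) {ε : ℝ} (hε : 0 < ε) : ∃ c, 0 < c ∧
    ∀ ζ, |ζ| ≤ L → ε ≤ |ζ - D.ξ₀| → Theta0 + c ≤ muGen ζ := by
  set S := {ζ : ℝ | |ζ| ≤ L ∧ ε ≤ |ζ - D.ξ₀|} with hS
  have hcl1 : IsClosed {ζ : ℝ | |ζ| ≤ L} := isClosed_le (by fun_prop) (by fun_prop)
  have hcl2 : IsClosed {ζ : ℝ | ε ≤ |ζ - D.ξ₀|} := isClosed_le (by fun_prop) (by fun_prop)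
  have hcomp : IsCompact S := by
    refine Metric.isCompact_of_isClosed_isBounded (hcl1.inter hcl2) ?_
    refine (Metric.isBounded_closedBall (x := (0 : ℝ)) (r := L)).subset fun ζ hζ => ?_
    simpa using hζ.1
  by_cases hne : S.Nonempty
  · obtain ⟨ζ₀, h0, hmin⟩ := hcomp.exists_isMinOn hne continuous_muGen.continuousOn
    refine ⟨muGen ζ₀ - Theta0, ?_, fun ζ h1 h2 => ?_⟩
    · rw [sub_pos]
      refine lt_of_le_of_ne (Theta0_le_muGen ζ₀) fun h => ?_
      have := D.ξ₀_uniq ζ₀ h.symm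
      rw [this] at h0
      have h3 := h0.2
      simp at h3
      linarith
    · have := hmin (show ζ ∈ S from ⟨h1, h2⟩)
      simp only [mem_ofPred_eq] at this
      linarith
  · refine ⟨1, one_pos, fun ζ h1 h2 => absurd ⟨ζ, h1, h2⟩ hne⟩

theorem integral_Ioi_eq {f : ℝ → ℝ} {M : ℝ} (hM : 0 ≤ M) (h : ∀ t, M < t → f t = 0) :
    ∫ t in Ioi (0 : ℝ), f t = ∫ t in (0 : ℝ)..M, f t := by
  rw [intervalIntegral.integral_of_le hM]
  refine setIntegral_eq_of_subset_of_forall_sdiff_eq_zero measurableSet_Ioi Ioc_subset_Ioi_self ?_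
  rintro t ⟨h1, h2⟩
  refine h t ?_
  by_contra! h3
  exact h2 ⟨h1, h3⟩

theorem deriv_eq_zero_of_vanish {G : ℝ → ℝ} {M t : ℝ} (h : ∀ t, M ≤ t → G t = 0) (ht : M < t) :
    deriv G t = 0 := by
  have : G =ᶠ[𝓝 t] fun _ => 0 := by
    filter_upwards [Ioi_mem_nhds ht] with s hs using h s (le_of_lt hs)
  rw [this.deriv_eq, deriv_const]

theorem muGen_mul_integral_le {G : ℝ → ℝ} (hG : ContDiff ℝ 1 G) {M : ℝ} (hM : 0 ≤ M)
    (h : ∀ t, M ≤ t → G t = 0) (ζ : ℝ) : muGen ζ * (∫ t in (0 : ℝ)..M, G t ^ 2) ≤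
      ∫ t in (0 : ℝ)..M, (deriv G t ^ 2 + (t + ζ) ^ 2 * G t ^ 2) := by
  by_cases hz : ∃ τ, 0 < τ ∧ G τ ≠ 0
  · obtain ⟨τ, hτ, hGτ⟩ := hz
    have hmem : cutNeg G ∈ halfTest := ⟨contDiff_cutNeg hG, cutNeg_hasCompactSupport h, τ, hτ, by
      rwa [cutNeg_of_nonneg _ hτ.le]⟩
    have key := muGen_mul_le hmem ζ
    have e1 : halfNm (cutNeg G) = ∫ t in (0 : ℝ)..M, G t ^ 2 := by
      rw [← integral_Ioi_eq hM fun t ht => by simp [h t ht.le]]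
      exact setIntegral_congr_fun measurableSet_Ioi fun t ht => by
        rw [cutNeg_of_nonneg _ (le_of_lt ht)]
    have e2 : halfEn (cutNeg G) ζ =
        ∫ t in (0 : ℝ)..M, (deriv G t ^ 2 + (t + ζ) ^ 2 * G t ^ 2) := by
      rw [← integral_Ioi_eq hM fun t ht => by
        simp [h t ht.le, deriv_eq_zero_of_vanish h ht]]
      exact setIntegral_congr_fun measurableSet_Ioi fun t ht => by
        rw [cutNeg_of_nonneg _ (le_of_lt ht), deriv_cutNeg _ ht]
    rwa [e1, e2] at key
  · push Not at hz
    have e1 : ∫ t in (0 : ℝ)..M, G t ^ 2 = 0 := by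
      rw [intervalIntegral.integral_of_le hM]
      exact setIntegral_eq_zero_of_forall_eq_zero fun t ht => by simp [hz t ht.1]
    rw [e1, mul_zero]
    exact intervalIntegral.integral_nonneg hM fun t _ => by positivity

/-- The inner function of a quadratic partition of unity at scale `K`. -/
def chiIn (K t : ℝ) : ℝ := Real.cos (Real.pi / 2 * (1 - DeGennes.cut K t))

/-- The outer function of a quadratic partition of unity at scale `K`. -/
def chiOut (K t : ℝ) : ℝ := Real.sin (Real.pi / 2 * (1 - DeGennes.cut K t))

theorem contDiff_chiIn (K : ℝ) : ContDiff ℝ 1 (chiIn K) :=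
  Real.contDiff_cos.comp (contDiff_const.mul (contDiff_const.sub (DeGennes.contDiff_cut K)))

theorem contDiff_chiOut (K : ℝ) : ContDiff ℝ 1 (chiOut K) :=
  Real.contDiff_sin.comp (contDiff_const.mul (contDiff_const.sub (DeGennes.contDiff_cut K)))

theorem chiIn_of_le {K t : ℝ} (hK : 0 < K) (ht : t ≤ K) : chiIn K t = 1 := by
  simp [chiIn, DeGennes.cut_of_le hK ht]

theorem chiOut_of_le {K t : ℝ} (hK : 0 < K) (ht : t ≤ K) : chiOut K t = 0 := by
  simp [chiOut, DeGennes.cut_of_le hK ht]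

theorem chiIn_of_ge {K t : ℝ} (hK : 0 < K) (ht : 2 * K ≤ t) : chiIn K t = 0 := by
  simp [chiIn, DeGennes.cut_of_ge hK ht]

theorem chi_sq_add (K t : ℝ) : chiIn K t ^ 2 + chiOut K t ^ 2 = 1 := Real.cos_sq_add_sin_sq _

theorem hasDerivAt_chi (K t : ℝ) :
    HasDerivAt (chiIn K) (chiOut K t * (Real.pi / 2 * deriv (DeGennes.cut K) t)) t ∧
    HasDerivAt (chiOut K) (-(chiIn K t * (Real.pi / 2 * deriv (DeGennes.cut K) t))) t := by
  have h := ((((DeGennes.contDiff_cut K).differentiable one_ne_zero t).hasDerivAt.const_sub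
    1).const_mul (Real.pi / 2))
  refine ⟨?_, ?_⟩
  · convert! h.cos using 1
    unfold chiOut
    ring
  · convert! h.sin using 1
    unfold chiIn
    ring

/-- Localization formula for the radial energy. -/
theorem exists_localization : ∃ C, 0 < C ∧ ∀ K R ξ : ℝ, ∀ F : ℝ → ℝ, 0 < K → 0 < R → Adm R F →
    En R ξ (fun t => chiIn K t * F t) + En R ξ (fun t => chiOut K t * F t)
      ≤ En R ξ F + C / K ^ 2 * Nm R F := by
  obtain ⟨M, hM, hcut⟩ := DeGennes.exists_abs_deriv_cut_le
  refine ⟨(Real.pi / 2 * M) ^ 2, by positivity, fun K R ξ F hK hR h => ?_⟩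
  have h1 := (h.mul (contDiff_chiIn K)).continuous_En hR ξ
  have h2 := (h.mul (contDiff_chiOut K)).continuous_En hR ξ
  have h3 := h.continuous_En hR ξ
  have h4 := h.continuous_Nm
  unfold En Nm
  rw [← intervalIntegral.integral_add (h1.intervalIntegrable _ _) (h2.intervalIntegrable _ _),
    ← intervalIntegral.integral_const_mul,
    ← intervalIntegral.integral_add (h3.intervalIntegrable _ _)
      ((h4.const_mul _).intervalIntegrable _ _)]
  refine intervalIntegral.integral_mono_on_of_le_Ioo hR.le
    ((h1.add h2).intervalIntegrable _ _) ((h3.add (h4.const_mul _)).intervalIntegrable _ _)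
    fun t ht => ?_
  have hρ := weight_pos hR ht.2
  obtain ⟨d1, d2⟩ := hasDerivAt_chi K t
  have dF := (h.contDiff.differentiable one_ne_zero t).hasDerivAt
  have e1 : deriv (fun t => chiIn K t * F t) t = _ := (d1.mul dF).deriv
  have e2 : deriv (fun t => chiOut K t * F t) t = _ := (d2.mul dF).deriv
  rw [e1, e2]
  have hs := chi_sq_add K t
  have hθ : (Real.pi / 2 * deriv (DeGennes.cut K) t) ^ 2 ≤ (Real.pi / 2 * M) ^ 2 / K ^ 2 := by
    rw [← div_pow, ← sq_abs, abs_mul, abs_of_pos (by positivity : 0 < Real.pi / 2), mul_div_assoc]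
    have := hcut K t hK
    gcongr
  set θ := Real.pi / 2 * deriv (DeGennes.cut K) t
  generalize (Real.pi / 2 * M) ^ 2 / K ^ 2 = C at *
  generalize chiIn K t = a at *
  generalize chiOut K t = b at *
  generalize deriv F t = f' at *
  generalize F t = f at *
  generalize pot R ξ t = p
  generalize 1 - t / R = ρ at *
  have e : ((b * θ * f + a * f') ^ 2 + (p * (a * f)) ^ 2) * ρ
      + ((-(a * θ) * f + b * f') ^ 2 + (p * (b * f)) ^ 2) * ρ
      = (a ^ 2 + b ^ 2) * ((f' ^ 2 + (p * f) ^ 2) * ρ + θ ^ 2 * (f ^ 2 * ρ)) := by ring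
  rw [e, hs, one_mul]
  gcongr

theorem Nm_chi_add {R : ℝ} {F : ℝ → ℝ} (h : Adm R F) (K : ℝ) :
    Nm R (fun t => chiIn K t * F t) + Nm R (fun t => chiOut K t * F t) = Nm R F := by
  have h1 := (h.mul (contDiff_chiIn K)).continuous_Nm
  have h2 := (h.mul (contDiff_chiOut K)).continuous_Nm
  unfold Nm
  rw [← intervalIntegral.integral_add (h1.intervalIntegrable _ _) (h2.intervalIntegrable _ _)]
  congr 1
  ext t
  linear_combination (F t ^ 2 * (1 - t / R)) * chi_sq_add K t

theorem Nm_chiOut_le_En {K R : ℝ} (hK : 0 < K) (hR : 0 < R) {F : ℝ → ℝ} (h : Adm R F) (ξ : ℝ) :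
    Nm R (fun t => chiOut K t * F t) ≤ En R ξ (fun t => chiOut K t * F t) := by
  have := Nm_add_le_En hR (h.mul (contDiff_chiOut K)) ξ
  simpa [chiOut_of_le hK hK.le] using this

theorem integral_eq_of_vanish {f : ℝ → ℝ} {M R : ℝ} (hM : 0 ≤ M) (hR : M ≤ R)
    (h : ∀ t, M < t → f t = 0) :
    ∫ t in (0 : ℝ)..R, f t = ∫ t in (0 : ℝ)..M, f t := by
  rw [← integral_Ioi_eq hM h, ← integral_Ioi_eq (hM.trans hR) fun t ht => h t (hR.trans_lt ht)]

theorem abs_pot_sub_le {M R ξ ζ t : ℝ} (hM : 0 ≤ M) (hR : 2 * M ≤ R) (hR0 : 0 < R)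
    (ht : t ∈ Icc 0 M) : |pot R ξ t - (t + ζ)| ≤ |ξ - ζ| + (M ^ 2 + 2 * |ξ| * M) / R := by
  have hρ : 1 / 2 ≤ 1 - t / R := by
    have : t / R ≤ 1 / 2 := by
      rw [div_le_div_iff₀ hR0 two_pos]
      linarith [ht.2]
    linarith
  have e : pot R ξ t - (t + ζ) = (ξ - ζ) + (t ^ 2 / 2 + ξ * t) / R / (1 - t / R) := by
    have h0 : 1 - t / R ≠ 0 := by linarith
    rw [pot, bb, sub_eq_iff_eq_add, div_eq_iff h0]
    have : (ξ - ζ + (t ^ 2 / 2 + ξ * t) / R / (1 - t / R) + (t + ζ)) * (1 - t / R)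
        = (t + ξ) * (1 - t / R) + (t ^ 2 / 2 + ξ * t) / R / (1 - t / R) * (1 - t / R) := by ring
    rw [this, div_mul_cancel₀ _ h0]
    field_simp
    ring
  rw [e]
  refine (abs_add_le _ _).trans ?_
  gcongr
  rw [abs_div, abs_of_pos (by linarith : 0 < 1 - t / R), div_le_iff₀ (by linarith),
    abs_div, abs_of_pos hR0, div_mul_eq_mul_div]
  gcongr
  have h1 : |t ^ 2 / 2 + ξ * t| ≤ M ^ 2 / 2 + |ξ| * M := by
    refine (abs_add_le _ _).trans ?_
    rw [abs_mul, abs_of_nonneg (by positivity), abs_of_nonneg ht.1]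
    have := ht.1
    have := ht.2
    gcongr
  have h2 : 0 ≤ M ^ 2 + 2 * |ξ| * M := by positivity
  nlinarith

theorem En_ge_of_vanish {M R ξ ζ : ℝ} (hM : 0 ≤ M) (hR : 2 * M ≤ R) (hR0 : 0 < R) {G : ℝ → ℝ}
    (h : Adm R G) (hG : ∀ t, M ≤ t → G t = 0) :
    (1 - M / R) * ((∫ t in (0 : ℝ)..M, (deriv G t ^ 2 + (t + ζ) ^ 2 * G t ^ 2)) -
      2 * (M + |ζ|) * (|ξ - ζ| + (M ^ 2 + 2 * |ξ| * M) / R) * ∫ t in (0 : ℝ)..M, G t ^ 2)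
      ≤ En R ξ G := by
  have cG := h.continuous
  have cG' := h.continuous_deriv
  have cE := h.continuous_En hR0 ξ
  unfold En
  rw [integral_eq_of_vanish (R := R) hM (by linarith) fun t ht => by
      simp [hG t ht.le, deriv_eq_zero_of_vanish hG ht],
    ← intervalIntegral.integral_const_mul, ← intervalIntegral.integral_sub
      (Continuous.intervalIntegrable (by fun_prop) _ _)
      (Continuous.intervalIntegrable (by fun_prop) _ _), ← intervalIntegral.integral_const_mul]
  refine intervalIntegral.integral_mono_on hM (Continuous.intervalIntegrable (by fun_prop) _ _)
    (cE.intervalIntegrable _ _) fun t ht => ?_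
  have hp := abs_pot_sub_le (ξ := ξ) (ζ := ζ) hM hR hR0 ht
  set δ := |ξ - ζ| + (M ^ 2 + 2 * |ξ| * M) / R
  have hq : |t + ζ| ≤ M + |ζ| := by
    refine (abs_add_le _ _).trans ?_
    rw [abs_of_nonneg ht.1]
    linarith [ht.2]
  have h1 : (t + ζ) ^ 2 - 2 * (M + |ζ|) * δ ≤ pot R ξ t ^ 2 := by
    have h2 : |(t + ζ) * (pot R ξ t - (t + ζ))| ≤ (M + |ζ|) * δ := by
      rw [abs_mul]
      gcongr
    nlinarith [(abs_le.1 h2).1, sq_nonneg (pot R ξ t - (t + ζ))]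
  have hw : 0 ≤ 1 - M / R := by
    rw [sub_nonneg, div_le_one hR0]
    linarith
  have hw' : 1 - M / R ≤ 1 - t / R := by
    have := ht.2
    gcongr
  calc _ = (1 - M / R) * (deriv G t ^ 2 + ((t + ζ) ^ 2 - 2 * (M + |ζ|) * δ) * G t ^ 2) := by ring
    _ ≤ (1 - M / R) * (deriv G t ^ 2 + pot R ξ t ^ 2 * G t ^ 2) := by gcongr
    _ ≤ (1 - t / R) * (deriv G t ^ 2 + pot R ξ t ^ 2 * G t ^ 2) := by gcongr
    _ = _ := by ring

theorem Nm_le_integral_of_vanish {M R : ℝ} (hM : 0 ≤ M) (hR : M ≤ R) (hR0 : 0 < R) {G : ℝ → ℝ}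
    (h : Adm R G) (hG : ∀ t, M ≤ t → G t = 0) : Nm R G ≤ ∫ t in (0 : ℝ)..M, G t ^ 2 := by
  have cG := h.continuous
  unfold Nm
  rw [integral_eq_of_vanish hM hR fun t ht => by simp [hG t ht.le]]
  refine intervalIntegral.integral_mono_on hM (h.continuous_Nm.intervalIntegrable _ _)
    (Continuous.intervalIntegrable (by fun_prop) _ _) fun t ht => ?_
  exact mul_le_of_le_one_right (sq_nonneg _) (by linarith [div_nonneg ht.1 hR0.le])

theorem mul_integral_le_Nm {M R : ℝ} (hM : 0 ≤ M) (hR : M ≤ R) (hR0 : 0 < R) {G : ℝ → ℝ}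
    (h : Adm R G) : (1 - M / R) * (∫ t in (0 : ℝ)..M, G t ^ 2) ≤ Nm R G := by
  have cG := h.continuous
  have h1 : ∫ t in (0 : ℝ)..M, G t ^ 2 * (1 - t / R) ≤ Nm R G := by
    refine intervalIntegral.integral_mono_interval le_rfl hM hR ?_
      (h.continuous_Nm.intervalIntegrable _ _)
    filter_upwards [ae_restrict_mem measurableSet_Ioc] with t ht
    exact mul_nonneg (sq_nonneg _) (weight_mem hR0 (Ioc_subset_Icc_self ht)).1
  refine le_trans ?_ h1
  rw [← intervalIntegral.integral_const_mul]
  refine intervalIntegral.integral_mono_on hM (Continuous.intervalIntegrable (by fun_prop) _ _)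
    (h.continuous_Nm.intervalIntegrable _ _) fun t ht => ?_
  rw [mul_comm]
  have := ht.2
  gcongr

theorem En_le_of_vanish {M R ξ ζ : ℝ} (hM : 0 ≤ M) (hR : 2 * M ≤ R) (hR0 : 0 < R) {G : ℝ → ℝ}
    (h : Adm R G) (hG : ∀ t, M ≤ t → G t = 0) {δ : ℝ}
    (hδ : |ξ - ζ| + (M ^ 2 + 2 * |ξ| * M) / R ≤ δ) :
    En R ξ G ≤ (∫ t in (0 : ℝ)..M, (deriv G t ^ 2 + (t + ζ) ^ 2 * G t ^ 2)) +
      (2 * (M + |ζ|) * δ + δ ^ 2) * ∫ t in (0 : ℝ)..M, G t ^ 2 := by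
  have cG := h.continuous
  have cG' := h.continuous_deriv
  have cE := h.continuous_En hR0 ξ
  unfold En
  rw [integral_eq_of_vanish (R := R) hM (by linarith) fun t ht => by
      simp [hG t ht.le, deriv_eq_zero_of_vanish hG ht],
    ← intervalIntegral.integral_const_mul, ← intervalIntegral.integral_add
      (Continuous.intervalIntegrable (by fun_prop) _ _)
      (Continuous.intervalIntegrable (by fun_prop) _ _)]
  refine intervalIntegral.integral_mono_on hM (cE.intervalIntegrable _ _)
    (Continuous.intervalIntegrable (by fun_prop) _ _) fun t ht => ?_
  have hp := (abs_pot_sub_le (ξ := ξ) (ζ := ζ) hM hR hR0 ht).trans hδ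
  have hδ0 : 0 ≤ δ := (abs_nonneg _).trans hp
  have hq : |t + ζ| ≤ M + |ζ| := by
    refine (abs_add_le _ _).trans ?_
    rw [abs_of_nonneg ht.1]
    linarith [ht.2]
  have h1 : pot R ξ t ^ 2 ≤ (t + ζ) ^ 2 + 2 * (M + |ζ|) * δ + δ ^ 2 := by
    have h2 : |(t + ζ) * (pot R ξ t - (t + ζ))| ≤ (M + |ζ|) * δ := by
      rw [abs_mul]
      gcongr
    have h3 := sq_le_sq' (abs_le.1 hp).1 (abs_le.1 hp).2
    nlinarith [(abs_le.1 h2).2]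
  have hw' : 1 - t / R ≤ 1 := by linarith [div_nonneg ht.1 hR0.le]
  calc (deriv G t ^ 2 + (pot R ξ t * G t) ^ 2) * (1 - t / R)
      ≤ deriv G t ^ 2 + (pot R ξ t * G t) ^ 2 := mul_le_of_le_one_right (by positivity) hw'
    _ = deriv G t ^ 2 + pot R ξ t ^ 2 * G t ^ 2 := by ring
    _ ≤ deriv G t ^ 2 + ((t + ζ) ^ 2 + 2 * (M + |ζ|) * δ + δ ^ 2) * G t ^ 2 := by gcongr
    _ = _ := by ring

theorem exists_xiOf_near {R : ℝ} (hR : 0 < R) (ζ : ℝ) : ∃ m : ℤ, |xiOf R m - ζ| ≤ 1 / R := by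
  refine ⟨round (ζ * R + R ^ 2 / 2), ?_⟩
  have h := abs_sub_round (ζ * R + R ^ 2 / 2)
  have e : xiOf R (round (ζ * R + R ^ 2 / 2)) - ζ =
      -((ζ * R + R ^ 2 / 2 - round (ζ * R + R ^ 2 / 2)) / R) := by
    rw [xiOf]
    field_simp
    ring
  rw [e, abs_neg, abs_div, abs_of_pos hR]
  gcongr
  linarith

theorem DeGennes.eventually_lam1_le (D : DeGennes) {ε : ℝ} (hε : 0 < ε) :
    ∀ᶠ R : ℝ in atTop, lam1 unitDisc (R ^ 2) / R ^ 2 ≤ Theta0 + ε := by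
  obtain ⟨φ, hφ, hlt⟩ := exists_halfEn_lt D.ξ₀ (half_pos hε)
  have hpos := halfNm_pos hφ
  obtain ⟨h1, h2, -⟩ := hφ
  obtain ⟨M, hM, hsupp⟩ : ∃ M, 0 < M ∧ ∀ t, M ≤ t → φ t = 0 := by
    obtain ⟨r, hr, h⟩ := h2.isCompact.isBounded.subset_closedBall_lt 0 0
    refine ⟨r + 1, by linarith, fun t ht => ?_⟩
    by_contra hne
    have := h (subset_tsupport φ hne)
    rw [mem_closedBall_zero_iff, Real.norm_eq_abs] at this
    linarith [le_abs_self t]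
  rw [D.ξ₀_min] at hlt
  have hNm : halfNm φ = ∫ t in (0 : ℝ)..M, φ t ^ 2 :=
    integral_Ioi_eq hM.le fun t ht => by simp [hsupp t ht.le]
  have hEn : halfEn φ D.ξ₀ = ∫ t in (0 : ℝ)..M, (deriv φ t ^ 2 + (t + D.ξ₀) ^ 2 * φ t ^ 2) :=
    integral_Ioi_eq hM.le fun t ht => by
      simp [hsupp t ht.le, deriv_eq_zero_of_vanish hsupp ht]
  have hξ0 : |D.ξ₀| ≤ 1 := by
    rw [abs_le]
    exact ⟨D.ξ₀_mem.1.le, by linarith [D.ξ₀_mem.2]⟩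
  have hinv : Tendsto (fun R : ℝ => R⁻¹) atTop (𝓝 0) := tendsto_inv_atTop_zero
  have hlim : Tendsto (fun R : ℝ => (1 - M * R⁻¹) * (Theta0 + ε) -
      (2 * (M + |D.ξ₀|) * ((1 + M ^ 2 + 4 * M) * R⁻¹) + ((1 + M ^ 2 + 4 * M) * R⁻¹) ^ 2)) atTop
      (𝓝 ((1 - M * 0) * (Theta0 + ε) - (2 * (M + |D.ξ₀|) * ((1 + M ^ 2 + 4 * M) * 0) +
        ((1 + M ^ 2 + 4 * M) * 0) ^ 2))) :=
    (((hinv.const_mul M).const_sub 1).mul_const _).sub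
      (((hinv.const_mul _).const_mul _).add ((hinv.const_mul _).pow 2))
  have hlim2 := hlim.eventually_const_lt (u := Theta0 + ε / 2)
    (by simp; linarith)
  filter_upwards [hlim2, eventually_ge_atTop (2 * M + 1)] with R hR hRM
  have hR0 : 0 < R := by linarith
  have hadm : Adm R φ := ⟨h1, R - M, by linarith, fun t ht => hsupp t (by linarith)⟩
  obtain ⟨m, hm⟩ := exists_xiOf_near hR0 D.ξ₀
  have hxi : |xiOf R m| ≤ 2 := by
    have h3 : 1 / R ≤ 1 := by
      rw [div_le_one hR0]
      linarith
    have h4 : |xiOf R m| ≤ |xiOf R m - D.ξ₀| + |D.ξ₀| := by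
      simpa using abs_add_le (xiOf R m - D.ξ₀) D.ξ₀
    linarith
  have key := lam1_div_mul_Nm_le hR0 m hadm
  have h3 := mul_integral_le_Nm hM.le (by linarith : M ≤ R) hR0 hadm
  have h4 := En_le_of_vanish (ξ := xiOf R m) (ζ := D.ξ₀) hM.le (by linarith) hR0 hadm hsupp
    (δ := (1 + M ^ 2 + 4 * M) * R⁻¹) (by
      have : (M ^ 2 + 2 * |xiOf R m| * M) / R ≤ (M ^ 2 + 2 * 2 * M) / R := by gcongr
      have e : (1 + M ^ 2 + 4 * M) * R⁻¹ = 1 / R + (M ^ 2 + 2 * 2 * M) / R := by ring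
      rw [e]
      linarith)
  rw [← hNm] at h3 h4
  rw [← hEn] at h4
  have h5 : lam1 unitDisc (R ^ 2) / R ^ 2 * ((1 - M / R) * halfNm φ) ≤
      ((1 - M / R) * (Theta0 + ε)) * halfNm φ := by
    have h6 := mul_le_mul_of_nonneg_left h3 (div_nonneg (lam1_nonneg (R ^ 2)) (sq_nonneg R))
    have h7 := mul_lt_mul_of_pos_right hR hpos
    rw [div_eq_mul_inv M R]
    rw [div_eq_mul_inv M R] at h6
    linarith
  have h6 : 0 < (1 - M / R) * halfNm φ := by
    have := weight_pos hR0 (by linarith : M < R)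
    positivity
  refine le_of_mul_le_mul_right (a := (1 - M / R) * halfNm φ) ?_ h6
  linarith

theorem exists_En_split : ∃ C, 0 < C ∧ ∀ K R ξ : ℝ, ∀ F : ℝ → ℝ, 0 < K → 0 < R → Adm R F →
    Nm R F = 1 → En R ξ (fun t => chiIn K t * F t) + (1 - Nm R (fun t => chiIn K t * F t))
      ≤ En R ξ F + C / K ^ 2 := by
  obtain ⟨C, hC, h⟩ := exists_localization
  refine ⟨C, hC, fun K R ξ F hK hR hF h1 => ?_⟩
  have h2 := h K R ξ F hK hR hF
  have h3 := Nm_chi_add hF K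
  have h4 := Nm_chiOut_le_En hK hR hF ξ
  rw [h1, mul_one] at h2
  linarith

theorem Nm_chiIn_le {R : ℝ} (hR : 0 < R) {F : ℝ → ℝ} (h : Adm R F) (K : ℝ) :
    Nm R (fun t => chiIn K t * F t) ≤ Nm R F := by
  linarith [Nm_chi_add h K, Nm_nonneg hR (fun t => chiOut K t * F t)]

theorem tendsto_error (c d : ℝ) : Tendsto (fun R : ℝ => c + d / R) atTop (𝓝 c) := by
  simpa using (tendsto_const_nhds (x := c)).add (tendsto_id.const_div_atTop d)

namespace DeGennes
variable (D : DeGennes)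

/-- Low-energy configurations have frequency close to `ξ₀`. -/
theorem eventually_abs_sub_lt {ε : ℝ} (hε : 0 < ε) : ∃ δ, 0 < δ ∧ ∀ᶠ R : ℝ in atTop,
    ∀ ξ F, Adm R F → Nm R F = 1 → En R ξ F ≤ Theta0 + δ → |ξ - D.ξ₀| < ε := by
  obtain ⟨C, hC, hsplit⟩ := exists_En_split
  have hΘ := D.theta_ub
  set L := 8 / (1 - Theta0) with hL
  have hL0 : 0 < L := div_pos (by norm_num) (by linarith)
  have hL2 : 2 / L = (1 - Theta0) / 4 := by
    have : 1 - Theta0 ≠ 0 := by linarith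
    rw [hL]
    field_simp
    norm_num
  obtain ⟨c₁, hc₁, hgap⟩ := D.exists_gap L hε
  obtain ⟨c, hc, hcc, hc1⟩ : ∃ c, 0 < c ∧ c ≤ c₁ ∧ c ≤ 1 - Theta0 :=
    ⟨min c₁ (1 - Theta0), lt_min hc₁ (by linarith), min_le_left _ _, min_le_right _ _⟩
  obtain ⟨K, hK, hKc⟩ : ∃ K, 0 < K ∧ C / K ^ 2 ≤ c / 8 := by
    refine ⟨Real.sqrt (8 * C / c), by positivity, ?_⟩
    rw [Real.sq_sqrt (by positivity)]
    apply le_of_eq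
    field_simp
  set M := 2 * K with hM
  have hM0 : 0 < M := by positivity
  have hlim : Tendsto (fun R : ℝ => (1 + (-M) / R) *
      ((Theta0 + c) + (-(2 * (M + L) * (M ^ 2 + 2 * L * M))) / R)) atTop
      (𝓝 (1 * (Theta0 + c))) := (tendsto_error _ _).mul (tendsto_error _ _)
  have hlim2 := hlim.eventually_const_lt (u := Theta0 + c / 2) (by linarith)
  refine ⟨c / 4, by positivity, ?_⟩
  filter_upwards [hlim2, eventually_ge_atTop (2 * M), eventually_ge_atTop (2 * L)]
    with R hR hRM hRL ξ F hF hN hE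
  have hR0 : 0 < R := by linarith
  by_contra! hξ
  rcases le_or_gt 0 ξ with h0 | h0
  · have h1 := Nm_add_le_En hR0 hF ξ
    have h2 : 0 ≤ ξ * F 0 ^ 2 := by positivity
    linarith
  rcases le_or_gt ξ (-L) with h1 | h1
  · have h2 := one_sub_mul_Nm_le_En hL0 hRL hF h1
    rw [hN, hL2] at h2
    linarith
  have hξL : |ξ| ≤ L := abs_le.2 ⟨h1.le, by linarith⟩
  have hμ : Theta0 + c ≤ muGen ξ := by
    have := hgap ξ hξL hξ
    linarith
  have hG : ∀ t, M ≤ t → chiIn K t * F t = 0 := fun t ht => by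
    rw [chiIn_of_ge hK ht, zero_mul]
  have hA := hF.mul (contDiff_chiIn K)
  have e1 := En_ge_of_vanish (ξ := ξ) (ζ := ξ) hM0.le hRM hR0 hA hG
  have e2 := muGen_mul_integral_le hA.contDiff hM0.le hG ξ
  have e3 := Nm_le_integral_of_vanish hM0.le (by linarith) hR0 hA hG
  have e4 := hsplit K R ξ F hK hR0 hF hN
  have e0 : 0 ≤ Nm R (fun t => chiIn K t * F t) := Nm_nonneg hR0 _
  have hNG := Nm_chiIn_le hR0 hF K
  rw [hN] at hNG
  rw [sub_self, abs_zero, zero_add] at e1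
  have hw := weight_pos hR0 (by linarith : M < R)
  have e5 : 2 * (M + |ξ|) * ((M ^ 2 + 2 * |ξ| * M) / R) ≤
      2 * (M + L) * ((M ^ 2 + 2 * L * M) / R) := by gcongr
  generalize (∫ t in (0 : ℝ)..M, (deriv (fun t => chiIn K t * F t) t ^ 2 +
    (t + ξ) ^ 2 * (chiIn K t * F t) ^ 2)) = J at *
  generalize (∫ t in (0 : ℝ)..M, (chiIn K t * F t) ^ 2) = I at *
  generalize En R ξ (fun t => chiIn K t * F t) = EG at *
  generalize Nm R (fun t => chiIn K t * F t) = NG at *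
  have hI : 0 ≤ I := e0.trans e3
  have e6 : (Theta0 + c / 2) * I ≤ EG := by
    refine le_trans ?_ e1
    calc (Theta0 + c / 2) * I ≤ ((1 + (-M) / R) *
          ((Theta0 + c) + (-(2 * (M + L) * (M ^ 2 + 2 * L * M))) / R)) * I := by gcongr
      _ = (1 - M / R) * ((Theta0 + c) * I - 2 * (M + L) * ((M ^ 2 + 2 * L * M) / R) * I) := by ring
      _ ≤ (1 - M / R) * (J - 2 * (M + |ξ|) * ((M ^ 2 + 2 * |ξ| * M) / R) * I) := by
        gcongr
        exact le_trans (by gcongr) e2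
  have hΘ0 := D.theta_lb
  have e7 : (Theta0 + c / 2) * NG ≤ (Theta0 + c / 2) * I := by gcongr
  nlinarith

/-- The ground state representation on the half-line. -/
theorem integral_ground_state {G : ℝ → ℝ} (hG : ContDiff ℝ 1 G) {M : ℝ} (hM : 0 ≤ M)
    (h : G M = 0) : ∫ t in (0 : ℝ)..M, (deriv G t ^ 2 + (t + D.ξ₀) ^ 2 * G t ^ 2) =
      Theta0 * (∫ t in (0 : ℝ)..M, G t ^ 2) +
        ∫ t in (0 : ℝ)..M, (deriv G t - D.V t / D.U t * G t) ^ 2 := by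
  have cG := hG.continuous
  have cG' := hG.continuous_deriv le_rfl
  have cV : Continuous fun t => D.V t / D.U t :=
    D.continuous_V.div D.continuous_U fun t => (D.U_pos t).ne'
  have hder : ∀ t ∈ Ioo 0 M, HasDerivAt (fun t => D.V t / D.U t * G t ^ 2)
      (((t + D.ξ₀) ^ 2 - Theta0 - (D.V t / D.U t) ^ 2) * G t ^ 2 +
        D.V t / D.U t * (2 * G t * deriv G t)) t := by
    intro t ht
    have h1 := (hG.differentiable one_ne_zero t).hasDerivAt
    have hU := (D.U_pos t).ne'
    convert! ((D.hasDerivAt_V ht.1.le).div (D.hasDerivAt_U t) hU).mul (h1.pow 2) using 1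
    simp only [Pi.pow_apply, Pi.div_apply, K]
    field_simp
    ring
  have key := intervalIntegral.integral_eq_sub_of_hasDerivAt_of_le hM
    (by fun_prop) hder (Continuous.intervalIntegrable (by fun_prop) _ _)
  rw [h, V_of_nonpos D le_rfl] at key
  rw [← intervalIntegral.integral_const_mul, ← intervalIntegral.integral_add
    (Continuous.intervalIntegrable (by fun_prop) _ _)
    (Continuous.intervalIntegrable (by fun_prop) _ _), ← sub_eq_zero,
    ← intervalIntegral.integral_sub
    (Continuous.intervalIntegrable (by fun_prop) _ _)
    (Continuous.intervalIntegrable (by fun_prop) _ _)]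
  refine Eq.trans ?_ (key.trans (by simp))
  congr 1
  ext t
  ring

end DeGennes

theorem abs_sub_le_of_integral_sq_le {w w' : ℝ → ℝ} {T κ : ℝ} (hT : 0 < T) (hκ : 0 < κ)
    (hw : ∀ t, HasDerivAt w (w' t) t) (hc : Continuous w')
    (h : ∫ t in (0 : ℝ)..T, w' t ^ 2 ≤ κ ^ 2 / T) {t : ℝ} (ht : t ∈ Icc 0 T) :
    |w t - w 0| ≤ κ := by
  rw [← intervalIntegral.integral_eq_sub_of_hasDerivAt (fun s _ => hw s)
    (hc.intervalIntegrable _ _)]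
  refine (intervalIntegral.abs_integral_le_integral_abs ht.1).trans ?_
  have h1 : ∫ s in (0 : ℝ)..t, |w' s| ≤ ∫ s in (0 : ℝ)..T, |w' s| := by
    refine intervalIntegral.integral_mono_interval le_rfl ht.1 ht.2
      (Eventually.of_forall fun s => abs_nonneg _) (hc.abs.intervalIntegrable _ _)
  refine h1.trans ?_
  have h2 : ∫ s in (0 : ℝ)..T, |w' s| ≤
      ∫ s in (0 : ℝ)..T, (κ / (2 * T) + T / (2 * κ) * w' s ^ 2) := by
    refine intervalIntegral.integral_mono_on hT.le (hc.abs.intervalIntegrable _ _)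
      (Continuous.intervalIntegrable (by fun_prop) _ _) fun s _ => ?_
    have h3 : κ / (2 * T) + T / (2 * κ) * w' s ^ 2 - |w' s| =
        T / (2 * κ) * (|w' s| - κ / T) ^ 2 := by
      rw [sub_sq, sq_abs]
      field_simp
      ring
    have h4 : 0 ≤ T / (2 * κ) * (|w' s| - κ / T) ^ 2 := by positivity
    linarith
  refine h2.trans ?_
  rw [intervalIntegral.integral_add (Continuous.intervalIntegrable (by fun_prop) _ _)
    (Continuous.intervalIntegrable (by fun_prop) _ _), intervalIntegral.integral_const,
    intervalIntegral.integral_const_mul, smul_eq_mul]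
  have h5 : T / (2 * κ) * (∫ s in (0 : ℝ)..T, w' s ^ 2) ≤ T / (2 * κ) * (κ ^ 2 / T) := by gcongr
  have h6 : (T - 0) * (κ / (2 * T)) + T / (2 * κ) * (κ ^ 2 / T) = κ := by
    field_simp
    ring
  linarith

theorem abs_sq_sub_le_of_abs_sub_le {x c κ : ℝ} (h : |x - c| ≤ κ) :
    |x ^ 2 - c ^ 2| ≤ κ * (2 * |c| + κ) := by
  have e : x ^ 2 - c ^ 2 = (x - c) * (2 * c + (x - c)) := by ring
  have hκ := (abs_nonneg _).trans h
  rw [e, abs_mul]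
  gcongr
  refine (abs_add_le _ _).trans ?_
  rw [abs_mul, abs_two]
  gcongr

theorem abs_sq_sub_one_le {w U : ℝ → ℝ} (hw : Continuous w) (hU : Continuous U) {T κ : ℝ}
    (hT : 0 < T) (hκ : 0 < κ) (hκ1 : κ ≤ 1 / 8) (h : ∀ t ∈ Icc 0 T, |w t - w 0| ≤ κ)
    (hU1 : 1 - κ ≤ ∫ t in (0 : ℝ)..T, U t ^ 2) (hU2 : ∫ t in (0 : ℝ)..T, U t ^ 2 ≤ 1)
    (hF1 : 1 - κ ≤ ∫ t in (0 : ℝ)..T, (w t * U t) ^ 2)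
    (hF2 : ∫ t in (0 : ℝ)..T, (w t * U t) ^ 2 ≤ 1 + κ) {t : ℝ} (ht : t ∈ Icc 0 T) :
    |w t ^ 2 - 1| ≤ 15 * κ := by
  have h2 := fun t ht => abs_le.1 (abs_sq_sub_le_of_abs_sub_le (h t ht))
  have hup : ∫ t in (0 : ℝ)..T, (w t * U t) ^ 2 ≤
      ∫ t in (0 : ℝ)..T, (w 0 ^ 2 + κ * (2 * |w 0| + κ)) * U t ^ 2 := by
    refine intervalIntegral.integral_mono_on hT.le (Continuous.intervalIntegrable (by fun_prop) _ _)
      (Continuous.intervalIntegrable (by fun_prop) _ _) fun s hs => ?_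
    rw [mul_pow]
    gcongr
    linarith [(h2 s hs).2]
  have hlow : ∫ t in (0 : ℝ)..T, (w 0 ^ 2 - κ * (2 * |w 0| + κ)) * U t ^ 2 ≤
      ∫ t in (0 : ℝ)..T, (w t * U t) ^ 2 := by
    refine intervalIntegral.integral_mono_on hT.le (Continuous.intervalIntegrable (by fun_prop) _ _)
      (Continuous.intervalIntegrable (by fun_prop) _ _) fun s hs => ?_
    rw [mul_pow]
    gcongr
    linarith [(h2 s hs).1]
  rw [intervalIntegral.integral_const_mul] at hup hlow
  have h3 := h2 t ht
  have ha : 0 ≤ |w 0| := abs_nonneg _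
  have ha2 : w 0 ^ 2 = |w 0| ^ 2 := (sq_abs _).symm
  rw [ha2] at hup hlow h3
  generalize |w 0| = a at *
  generalize (∫ t in (0 : ℝ)..T, U t ^ 2) = I at *
  generalize (∫ t in (0 : ℝ)..T, (w t * U t) ^ 2) = J at *
  generalize w t ^ 2 = x at *
  have hp : 0 ≤ κ * (2 * a + κ) := by positivity
  have hlow' : a ^ 2 * I ≤ 1 + κ + κ * (2 * a + κ) := by nlinarith
  have hlow2 : a ^ 2 * (1 - κ) ≤ 1 + κ + κ * (2 * a + κ) :=
    le_trans (by gcongr) hlow'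
  have haa : a ≤ 2 := by
    by_contra! hlt
    nlinarith
  have hup' : 1 - κ ≤ a ^ 2 + κ * (2 * a + κ) := by
    refine hF1.trans (hup.trans ?_)
    exact mul_le_of_le_one_right (by positivity) hU2
  have hq : κ * (2 * a + κ) ≤ 5 * κ := by nlinarith
  have hq2 : a ^ 2 * κ ≤ 4 * κ := by nlinarith
  rw [abs_le]
  constructor <;> nlinarith [h3.1, h3.2]

namespace DeGennes
variable (D : DeGennes)

theorem defect_aux {P I EG NG Θ q Q μ C e : ℝ} (hP : 0 ≤ P) (e0 : 0 ≤ NG) (hNG : NG ≤ 1)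
    (e3 : NG ≤ I) (e3' : (1 - μ) * I ≤ NG) (hμ : 0 ≤ μ) (hμ2 : μ ≤ 1 / 2) (hΘ0 : 1 / 2 ≤ Θ)
    (hΘ1 : Θ ≤ 1) (e5 : q ≤ Q) (hQ : 0 ≤ Q) (e6 : μ + 2 * Q ≤ e / 4 + e / 4)
    (e1 : (1 - μ) * (Θ * I + P - q * I) ≤ EG) (e4 : EG + (1 - NG) ≤ Θ + e / 2 + C) :
    P / 2 + (1 - Θ) * (1 - NG) ≤ C + e := by
  have hI0 : 0 ≤ I := e0.trans e3
  have hI2 : I ≤ 2 := by nlinarith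
  have g0 : q * I ≤ 2 * Q := by nlinarith
  have g1 : (1 - μ) * (q * I) ≤ 2 * Q := by nlinarith
  have g2 : Θ * NG - μ ≤ (1 - μ) * (Θ * I) := by
    have h1 : (1 - μ) * (Θ * NG) ≤ (1 - μ) * (Θ * I) := by gcongr; linarith
    have h2 : Θ * NG ≤ 1 := by nlinarith
    nlinarith
  have g3 : P / 2 ≤ (1 - μ) * P := by nlinarith
  linarith

theorem exists_eventually_defect_le : ∃ C, 0 < C ∧ ∀ K e : ℝ, 0 < K → 0 < e → ∃ δ, 0 < δ ∧
    ∀ᶠ R : ℝ in atTop, ∀ ξ F, Adm R F → Nm R F = 1 → En R ξ F ≤ Theta0 + δ →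
      (∫ t in (0 : ℝ)..(2 * K), (deriv (fun t => chiIn K t * F t) t -
        D.V t / D.U t * (chiIn K t * F t)) ^ 2) / 2 +
        (1 - Theta0) * (1 - Nm R (fun t => chiIn K t * F t)) ≤ C / K ^ 2 + e := by
  obtain ⟨C, hC, hsplit⟩ := exists_En_split
  refine ⟨C, hC, fun K e hK he => ?_⟩
  set M := 2 * K with hM
  have hM0 : 0 < M := by positivity
  obtain ⟨ε, hε, hε1, hεe⟩ : ∃ ε, 0 < ε ∧ ε ≤ 1 ∧ 4 * (M + 1) * ε ≤ e / 4 := by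
    refine ⟨min 1 (e / (16 * (M + 1))), by positivity, min_le_left _ _, ?_⟩
    calc 4 * (M + 1) * min 1 (e / (16 * (M + 1))) ≤ 4 * (M + 1) * (e / (16 * (M + 1))) := by
          gcongr
          exact min_le_right _ _
      _ = e / 4 := by field_simp; norm_num
  obtain ⟨δ, hδ, hev⟩ := D.eventually_abs_sub_lt hε
  have hlim := (tendsto_error 0 (M + 4 * (M + 1) * (M ^ 2 + 4 * M))).eventually_lt_const
    (u := e / 4) (by positivity)
  refine ⟨min δ (e / 4), by positivity, ?_⟩
  filter_upwards [hev, hlim, eventually_ge_atTop (2 * M)] with R hR1 hR2 hRM ξ F hF hN hE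
  have hR0 : 0 < R := by linarith
  have hξ := hR1 ξ F hF hN (hE.trans (by gcongr; exact min_le_left _ _))
  have hE' : En R ξ F ≤ Theta0 + e / 4 := hE.trans (by gcongr; exact min_le_right _ _)
  have hξ0 : |D.ξ₀| ≤ 1 := by
    rw [abs_le]
    exact ⟨D.ξ₀_mem.1.le, by linarith [D.ξ₀_mem.2]⟩
  have hξ2 : |ξ| ≤ 2 := by
    have h4 : |ξ| ≤ |ξ - D.ξ₀| + |D.ξ₀| := by simpa using abs_add_le (ξ - D.ξ₀) D.ξ₀
    linarith
  have hG : ∀ t, M ≤ t → chiIn K t * F t = 0 := fun t ht => by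
    rw [chiIn_of_ge hK ht, zero_mul]
  have hA := hF.mul (contDiff_chiIn K)
  have e1 := En_ge_of_vanish (ξ := ξ) (ζ := D.ξ₀) hM0.le hRM hR0 hA hG
  have e2 := D.integral_ground_state hA.contDiff hM0.le (hG M le_rfl)
  have e3 := Nm_le_integral_of_vanish hM0.le (by linarith) hR0 hA hG
  have e3' := mul_integral_le_Nm hM0.le (by linarith : M ≤ R) hR0 hA
  have e4 := hsplit K R ξ F hK hR0 hF hN
  have e0 : 0 ≤ Nm R (fun t => chiIn K t * F t) := Nm_nonneg hR0 _
  have hNG := Nm_chiIn_le hR0 hF K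
  have hP : 0 ≤ ∫ t in (0 : ℝ)..M, (deriv (fun t => chiIn K t * F t) t -
        D.V t / D.U t * (chiIn K t * F t)) ^ 2 :=
    intervalIntegral.integral_nonneg hM0.le fun t _ => sq_nonneg _
  rw [hN] at hNG
  rw [e2] at e1
  have hw := weight_pos hR0 (by linarith : M < R)
  have hw2 : M / R ≤ 1 / 2 := by
    rw [div_le_div_iff₀ hR0 two_pos]
    linarith
  have hMR : 0 ≤ M / R := by positivity
  have hΘ0 := D.theta_lb
  have hΘ1 := D.theta_ub
  have e5 : 2 * (M + |D.ξ₀|) * (|ξ - D.ξ₀| + (M ^ 2 + 2 * |ξ| * M) / R) ≤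
      2 * (M + 1) * (ε + (M ^ 2 + 2 * 2 * M) / R) := by gcongr
  have e6 : M / R + 2 * (2 * (M + 1) * (ε + (M ^ 2 + 2 * 2 * M) / R)) ≤ e / 4 + e / 4 := by
    have : 0 + (M + 4 * (M + 1) * (M ^ 2 + 4 * M)) / R =
      M / R + 4 * (M + 1) * ((M ^ 2 + 2 * 2 * M) / R) := by ring
    rw [this] at hR2
    linarith
  have hQ0 : 0 ≤ 2 * (M + 1) * (ε + (M ^ 2 + 2 * 2 * M) / R) := by positivity
  exact defect_aux hP e0 hNG e3 e3' hMR hw2 hΘ0.le hΘ1.le e5 hQ0 e6 e1 (by linarith)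

end DeGennes

namespace DeGennes
variable (D : DeGennes)

theorem exists_U_sq_le (N : ℝ) : ∃ A, 0 < A ∧ ∀ t ∈ Icc 0 N, D.U t ^ 2 ≤ A := by
  obtain ⟨A, hA⟩ := (isCompact_Icc (a := (0 : ℝ)) (b := N)).bddAbove_image
    (D.continuous_U.pow 2).continuousOn
  exact ⟨max A 1, by positivity, fun t ht => (hA ⟨t, ht, rfl⟩).trans (le_max_left _ _)⟩

theorem exists_le_U_sq (N : ℝ) : ∃ a, 0 < a ∧ ∀ t ∈ Icc 0 N, a ≤ D.U t ^ 2 := by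
  rcases (Icc (0 : ℝ) N).eq_empty_or_nonempty with h | h
  · exact ⟨1, one_pos, fun t ht => by simp [h] at ht⟩
  · obtain ⟨x, -, hx⟩ := isCompact_Icc.exists_isMinOn h (D.continuous_U.pow 2).continuousOn
    exact ⟨D.U x ^ 2, pow_pos (D.U_pos x) 2, fun t ht => hx ht⟩

theorem exists_div_sq_le (C : ℝ) {b : ℝ} (hb : 0 < b) (n : ℝ) :
    ∃ K, 0 < K ∧ n ≤ K ∧ ∀ K', K ≤ K' → C / K' ^ 2 ≤ b := by
  have h := ((tendsto_pow_atTop (α := ℝ) two_ne_zero).const_div_atTop C).eventually_le_const hb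
  obtain ⟨K, hK⟩ := (h.and ((eventually_ge_atTop n).and (eventually_gt_atTop 0))).exists_forall_of_atTop
  exact ⟨K, (hK K le_rfl).2.2, (hK K le_rfl).2.1, fun K' h => (hK K' h).1⟩

/-- Bound for the defect of `F` against the ground state on an inner interval. -/
theorem integral_deriv_div_sq_le {F : ℝ → ℝ} (hF : ContDiff ℝ 1 F) {T K a : ℝ} (hT : 0 < T)
    (hTK : T ≤ K) (hU : ∀ t ∈ Icc 0 T, a ≤ D.U t ^ 2) :
    a * (∫ t in (0 : ℝ)..T, ((deriv F t * D.U t - F t * D.V t) / D.U t ^ 2) ^ 2) ≤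
      ∫ t in (0 : ℝ)..(2 * K), (deriv (fun t => chiIn K t * F t) t -
        D.V t / D.U t * (chiIn K t * F t)) ^ 2 := by
  have hK : 0 < K := hT.trans_le hTK
  have cF := hF.continuous
  have cF' := hF.continuous_deriv le_rfl
  have cχ := (contDiff_chiIn K).continuous
  have cG' := ((contDiff_chiIn K).mul hF).continuous_deriv le_rfl
  have cU := D.continuous_U
  have cV := D.continuous_V
  have cVU : Continuous fun t => D.V t / D.U t := cV.div cU fun t => (D.U_pos t).ne'
  have c1 : Continuous fun t => (deriv F t * D.U t - F t * D.V t) / D.U t ^ 2 :=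
    Continuous.div (by fun_prop) (by fun_prop) fun t => pow_ne_zero 2 (D.U_pos t).ne'
  have c2 : Continuous fun t => (deriv (fun t => chiIn K t * F t) t -
        D.V t / D.U t * (chiIn K t * F t)) ^ 2 := by
    have : Continuous (deriv (fun t => chiIn K t * F t)) := cG'
    fun_prop
  refine le_trans ?_ (intervalIntegral.integral_mono_interval le_rfl hT.le (by linarith)
    (Eventually.of_forall fun t => sq_nonneg _) (c2.intervalIntegrable _ _))
  rw [← intervalIntegral.integral_const_mul]
  refine intervalIntegral.integral_mono_on_of_le_Ioo hT.le
    (Continuous.intervalIntegrable (by fun_prop) _ _) (c2.intervalIntegrable _ _) fun t ht => ?_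
  have h1 : deriv (fun t => chiIn K t * F t) t = deriv F t := by
    refine EventuallyEq.deriv_eq ?_
    filter_upwards [Iio_mem_nhds (ht.2.trans_le hTK)] with s hs
    rw [chiIn_of_le hK (le_of_lt hs), one_mul]
  rw [h1, chiIn_of_le hK (by linarith [ht.2]), one_mul]
  have hUt := D.U_pos t
  have e : (deriv F t - D.V t / D.U t * F t) ^ 2 =
      D.U t ^ 2 * ((deriv F t * D.U t - F t * D.V t) / D.U t ^ 2) ^ 2 := by
    field_simp
  rw [e]
  have := hU t (Ioo_subset_Icc_self ht)
  gcongr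

/-- Near-minimizers converge locally uniformly to the de Gennes ground state. -/
theorem eventually_abs_sq_sub_le {N ε : ℝ} (hε : 0 < ε) : ∃ δ, 0 < δ ∧
    ∀ᶠ R : ℝ in atTop, ∀ ξ F, Adm R F → Nm R F = 1 → En R ξ F ≤ Theta0 + δ →
      ∀ t ∈ Icc 0 N, |F t ^ 2 - D.U t ^ 2| ≤ ε := by
  obtain ⟨C, hC, hdef⟩ := D.exists_eventually_defect_le
  obtain ⟨A, hA, hUA⟩ := D.exists_U_sq_le N
  have hΘ : 0 < 1 - Theta0 := by linarith [D.theta_ub]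
  obtain ⟨κ, hκ, hκ1, hκ2⟩ : ∃ κ, 0 < κ ∧ κ ≤ 1 / 8 ∧ A * (15 * κ) ≤ ε := by
    refine ⟨min (1 / 8) (ε / (15 * A)), by positivity, min_le_left _ _, ?_⟩
    calc A * (15 * min (1 / 8) (ε / (15 * A))) ≤ A * (15 * (ε / (15 * A))) := by
          gcongr
          exact min_le_right _ _
      _ = ε := by field_simp
  obtain ⟨T₀, hT₀⟩ := (D.tendsto_integral_U_sq.eventually_const_le
    (by linarith : 1 - κ < 1)).exists_forall_of_atTop
  obtain ⟨K₁, hK₁, hK₁N, hK₁C⟩ := exists_div_sq_le C (by positivity : 0 < (1 - Theta0) * κ / 4)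
    (max N T₀)
  set T := 2 * K₁ with hT
  have hT0 : 0 < T := by positivity
  have hTN : N ≤ T := (le_max_left _ _).trans (hK₁N.trans (by linarith))
  have hTU : 1 - κ ≤ ∫ t in (0 : ℝ)..T, D.U t ^ 2 :=
    hT₀ T ((le_max_right _ _).trans (hK₁N.trans (by linarith)))
  obtain ⟨a, ha, haU⟩ := D.exists_le_U_sq T
  obtain ⟨K₂, hK₂, hTK, hK₂C⟩ := exists_div_sq_le C (by positivity : 0 < a * κ ^ 2 / T / 4) T
  obtain ⟨δ₁, hδ₁, hev₁⟩ := hdef K₁ ((1 - Theta0) * κ / 4) hK₁ (by positivity)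
  obtain ⟨δ₂, hδ₂, hev₂⟩ := hdef K₂ (a * κ ^ 2 / T / 4) hK₂ (by positivity)
  have hlim := (tendsto_error 0 T).eventually_lt_const (u := κ / 2) (by positivity)
  refine ⟨min δ₁ δ₂, lt_min hδ₁ hδ₂, ?_⟩
  filter_upwards [hev₁, hev₂, hlim, eventually_ge_atTop T] with R hR₁ hR₂ hRT hTR ξ F hF hN hE t ht
  have hR0 : 0 < R := by linarith
  have k1 := hR₁ ξ F hF hN (hE.trans (by gcongr; exact min_le_left _ _))
  have k2 := hR₂ ξ F hF hN (hE.trans (by gcongr; exact min_le_right _ _))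
  have hG : ∀ t, T ≤ t → chiIn K₁ t * F t = 0 := fun t ht => by
    rw [chiIn_of_ge hK₁ ht, zero_mul]
  have cF := hF.continuous
  have cχ := (contDiff_chiIn K₁).continuous
  have hUt : ∀ t, D.U t ≠ 0 := fun t => (D.U_pos t).ne'
  -- the mass of `F` on `[0, T]`
  have m1 : Nm R (fun t => chiIn K₁ t * F t) ≤ ∫ t in (0 : ℝ)..T, F t ^ 2 := by
    refine (Nm_le_integral_of_vanish hT0.le hTR hR0 (hF.mul (contDiff_chiIn K₁)) hG).trans ?_
    refine intervalIntegral.integral_mono_on hT0.le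
      (Continuous.intervalIntegrable (by fun_prop) _ _)
      (Continuous.intervalIntegrable (by fun_prop) _ _) fun t _ => ?_
    rw [mul_pow]
    refine mul_le_of_le_one_left (sq_nonneg _) ?_
    linarith [chi_sq_add K₁ t, sq_nonneg (chiOut K₁ t)]
  have m2 : 1 - κ ≤ ∫ t in (0 : ℝ)..T, F t ^ 2 := by
    have p1 : 0 ≤ ∫ t in (0 : ℝ)..T, (deriv (fun t => chiIn K₁ t * F t) t -
        D.V t / D.U t * (chiIn K₁ t * F t)) ^ 2 :=
      intervalIntegral.integral_nonneg hT0.le fun t _ => sq_nonneg _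
    have p2 := hK₁C K₁ le_rfl
    have p3 : (1 - Theta0) * (1 - Nm R (fun t => chiIn K₁ t * F t)) ≤ (1 - Theta0) * κ := by
      nlinarith
    have p4 := le_of_mul_le_mul_left p3 hΘ
    linarith
  have m3 : ∫ t in (0 : ℝ)..T, F t ^ 2 ≤ 1 + κ := by
    have p1 := mul_integral_le_Nm hT0.le hTR hR0 hF
    rw [hN] at p1
    rw [zero_add] at hRT
    have p0 : 0 ≤ T / R := by positivity
    by_contra! hlt
    nlinarith
  -- the quotient
  have hw : ∀ t, HasDerivAt (fun t => F t / D.U t)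
      ((deriv F t * D.U t - F t * D.V t) / D.U t ^ 2) t := fun t =>
    (hF.contDiff.differentiable one_ne_zero t).hasDerivAt.div (D.hasDerivAt_U t) (hUt t)
  have cU := D.continuous_U
  have cV := D.continuous_V
  have cF' := hF.continuous_deriv
  have c1 : Continuous fun t => (deriv F t * D.U t - F t * D.V t) / D.U t ^ 2 :=
    Continuous.div (by fun_prop) (by fun_prop) fun t => pow_ne_zero 2 (hUt t)
  have q1 : ∫ t in (0 : ℝ)..T, ((deriv F t * D.U t - F t * D.V t) / D.U t ^ 2) ^ 2 ≤
      κ ^ 2 / T := by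
    have p1 := D.integral_deriv_div_sq_le hF.contDiff hT0 hTK haU
    have p2 := hK₂C K₂ le_rfl
    have p3 : 0 ≤ (1 - Theta0) * (1 - Nm R (fun t => chiIn K₂ t * F t)) := by
      have := Nm_chiIn_le hR0 hF K₂
      rw [hN] at this
      exact mul_nonneg hΘ.le (by linarith)
    refine le_of_mul_le_mul_left ?_ ha
    rw [← mul_div_assoc]
    linarith
  have q2 := fun t ht => abs_sub_le_of_integral_sq_le hT0 hκ hw c1 q1 (t := t) ht
  have htT : t ∈ Icc 0 T := ⟨ht.1, ht.2.trans hTN⟩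
  have e : ∀ t, F t / D.U t * D.U t = F t := fun t => div_mul_cancel₀ _ (hUt t)
  have q3 := abs_sq_sub_one_le (w := fun t => F t / D.U t) (cF.div cU hUt) cU hT0 hκ hκ1 q2 hTU
    (D.integral_U_sq_le hT0.le) (by simpa only [e] using m2) (by simpa only [e] using m3) htT
  have e2 : F t ^ 2 - D.U t ^ 2 = D.U t ^ 2 * ((F t / D.U t) ^ 2 - 1) := by
    have := hUt t
    field_simp
  rw [e2, abs_mul, abs_of_nonneg (sq_nonneg _)]
  calc D.U t ^ 2 * |(F t / D.U t) ^ 2 - 1| ≤ A * (15 * κ) := by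
        have := hUA t ht
        gcongr
    _ ≤ ε := hκ2

end DeGennes

theorem En_one_sub_mul {R : ℝ} (hR : 0 < R) {F χ : ℝ → ℝ} (h : Adm R F) (hχ : ContDiff ℝ 1 χ)
    (ξ s : ℝ) : En R ξ (fun t => (1 - s * χ t ^ 2) * F t) + 2 * s * En R ξ (fun t => χ t * F t) =
      En R ξ F + s ^ 2 * En R ξ (fun t => χ t ^ 2 * F t) +
        2 * s * ∫ t in (0 : ℝ)..R, (deriv χ t * F t) ^ 2 * (1 - t / R) := by
  have cF := h.continuous
  have cχ' := hχ.continuous_deriv le_rfl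
  have c1 := (h.mul (χ := fun t => 1 - s * χ t ^ 2) (by fun_prop)).continuous_En hR ξ
  have c2 := (h.mul hχ).continuous_En hR ξ
  have c3 := h.continuous_En hR ξ
  have c4 := (h.mul (χ := fun t => χ t ^ 2) (by fun_prop)).continuous_En hR ξ
  have c5 : Continuous fun t => (deriv χ t * F t) ^ 2 * (1 - t / R) := by fun_prop
  have c34 : Continuous fun t => (deriv F t ^ 2 + (pot R ξ t * F t) ^ 2) * (1 - t / R) +
      s ^ 2 * ((deriv (fun t => χ t ^ 2 * F t) t ^ 2 + (pot R ξ t * (χ t ^ 2 * F t)) ^ 2) *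
        (1 - t / R)) := c3.add (c4.const_mul _)
  unfold En
  rw [← intervalIntegral.integral_const_mul, ← intervalIntegral.integral_const_mul,
    ← intervalIntegral.integral_const_mul,
    ← intervalIntegral.integral_add (c1.intervalIntegrable _ _)
      ((c2.const_mul _).intervalIntegrable _ _),
    ← intervalIntegral.integral_add (c3.intervalIntegrable _ _)
      ((c4.const_mul _).intervalIntegrable _ _),
    ← intervalIntegral.integral_add (c34.intervalIntegrable _ _)
      ((c5.const_mul _).intervalIntegrable _ _)]
  congr 1
  ext t
  have dF := (h.contDiff.differentiable one_ne_zero t).hasDerivAt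
  have dχ := (hχ.differentiable one_ne_zero t).hasDerivAt
  have e1 : deriv (fun t => (1 - s * χ t ^ 2) * F t) t =
      -(s * (2 * χ t * deriv χ t)) * F t + (1 - s * χ t ^ 2) * deriv F t := by
    refine HasDerivAt.deriv ?_
    convert! (((dχ.pow 2).const_mul s).const_sub 1).mul dF using 1
    simp
  have e2 : deriv (fun t => χ t * F t) t = deriv χ t * F t + χ t * deriv F t :=
    (dχ.mul dF).deriv
  have e3 : deriv (fun t => χ t ^ 2 * F t) t =
      2 * χ t * deriv χ t * F t + χ t ^ 2 * deriv F t := by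
    refine HasDerivAt.deriv ?_
    convert! (dχ.pow 2).mul dF using 1
    simp
  rw [e1, e2, e3]
  ring

theorem Nm_one_sub_mul {R : ℝ} {F χ : ℝ → ℝ} (h : Adm R F) (hχ : ContDiff ℝ 1 χ)
    (s : ℝ) : Nm R (fun t => (1 - s * χ t ^ 2) * F t) + 2 * s * Nm R (fun t => χ t * F t) =
      Nm R F + s ^ 2 * Nm R (fun t => χ t ^ 2 * F t) := by
  have c1 := (h.mul (χ := fun t => 1 - s * χ t ^ 2) (by fun_prop)).continuous_Nm
  have c2 := (h.mul hχ).continuous_Nm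
  have c3 := h.continuous_Nm
  have c4 := (h.mul (χ := fun t => χ t ^ 2) (by fun_prop)).continuous_Nm
  unfold Nm
  rw [← intervalIntegral.integral_const_mul, ← intervalIntegral.integral_const_mul,
    ← intervalIntegral.integral_add (c1.intervalIntegrable _ _)
      ((c2.const_mul _).intervalIntegrable _ _),
    ← intervalIntegral.integral_add (c3.intervalIntegrable _ _)
      ((c4.const_mul _).intervalIntegrable _ _)]
  congr 1
  ext t
  ring

theorem En_sq_mul_le {R : ℝ} (hR : 0 < R) {F χ : ℝ → ℝ} (h : Adm R F) (hχ : ContDiff ℝ 1 χ)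
    (ξ : ℝ) (h1 : ∀ t ∈ Icc 0 R, |χ t| ≤ 2)
    (h2 : ∀ t ∈ Icc 0 R, |deriv χ t| ≤ 1) :
    En R ξ (fun t => χ t ^ 2 * F t) ≤ 32 * (En R ξ F + Nm R F) := by
  have c3 := h.continuous_En hR ξ
  have c4 := (h.mul (χ := fun t => χ t ^ 2) (by fun_prop)).continuous_En hR ξ
  have c5 := h.continuous_Nm
  unfold En Nm
  rw [← intervalIntegral.integral_add (c3.intervalIntegrable _ _) (c5.intervalIntegrable _ _),
    ← intervalIntegral.integral_const_mul]
  refine intervalIntegral.integral_mono_on hR.le (c4.intervalIntegrable _ _)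
    (((c3.add c5).const_mul _).intervalIntegrable _ _) fun t ht => ?_
  have dF := (h.contDiff.differentiable one_ne_zero t).hasDerivAt
  have dχ := (hχ.differentiable one_ne_zero t).hasDerivAt
  have e3 : deriv (fun t => χ t ^ 2 * F t) t =
      2 * χ t * deriv χ t * F t + χ t ^ 2 * deriv F t := by
    refine HasDerivAt.deriv ?_
    convert! (dχ.pow 2).mul dF using 1
    simp
  rw [e3]
  have hρ := (weight_mem hR ht).1
  have b1 : χ t ^ 2 ≤ 4 := by
    have := sq_le_sq' (by linarith [abs_nonneg (χ t), h1 t ht] : -2 ≤ |χ t|) (h1 t ht)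
    rw [sq_abs] at this
    linarith
  have b2 : deriv χ t ^ 2 ≤ 1 := by
    have := sq_le_sq' (by linarith [abs_nonneg (deriv χ t), h2 t ht] : -1 ≤ |deriv χ t|) (h2 t ht)
    rw [sq_abs] at this
    linarith
  have b0 : 0 ≤ χ t ^ 2 := sq_nonneg _
  have b3 : (2 * χ t * deriv χ t * F t + χ t ^ 2 * deriv F t) ^ 2 ≤
      32 * F t ^ 2 + 32 * deriv F t ^ 2 := by
    have f1 : (2 * χ t * deriv χ t * F t) ^ 2 ≤ 16 * F t ^ 2 := by
      have : (2 * χ t * deriv χ t * F t) ^ 2 = 4 * (χ t ^ 2 * deriv χ t ^ 2) * F t ^ 2 := by ring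
      rw [this]
      have : χ t ^ 2 * deriv χ t ^ 2 ≤ 4 * 1 := by gcongr
      gcongr
      linarith
    have f2 : (χ t ^ 2 * deriv F t) ^ 2 ≤ 16 * deriv F t ^ 2 := by
      rw [mul_pow]
      gcongr
      nlinarith
    nlinarith [sq_nonneg (2 * χ t * deriv χ t * F t - χ t ^ 2 * deriv F t)]
  have b4 : (pot R ξ t * (χ t ^ 2 * F t)) ^ 2 ≤ 32 * (pot R ξ t * F t) ^ 2 := by
    have : (pot R ξ t * (χ t ^ 2 * F t)) ^ 2 = (χ t ^ 2) ^ 2 * (pot R ξ t * F t) ^ 2 := by ring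
    rw [this]
    gcongr
    nlinarith
  calc _ ≤ (32 * F t ^ 2 + 32 * deriv F t ^ 2 + 32 * (pot R ξ t * F t) ^ 2) * (1 - t / R) := by
        gcongr
    _ = _ := by ring

/-- Modulating a near-minimizer changes the energy excess only by the kinetic term. -/
theorem En_mul_sub_le {R : ℝ} (hR : 0 < R) {F χ : ℝ → ℝ} (h : Adm R F) (hχ : ContDiff ℝ 1 χ)
    {ξ E s : ℝ} (h1 : ∀ t ∈ Icc 0 R, |χ t| ≤ 2)
    (h2 : ∀ t ∈ Icc 0 R, |deriv χ t| ≤ 1) (hE0 : 0 ≤ E)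
    (hE : ∀ G, Adm R G → E * Nm R G ≤ En R ξ G) (hs : 0 < s) :
    En R ξ (fun t => χ t * F t) - E * Nm R (fun t => χ t * F t) ≤
      (∫ t in (0 : ℝ)..R, (deriv χ t * F t) ^ 2 * (1 - t / R)) +
        ((En R ξ F - E * Nm R F) / (2 * s) + 16 * s * (En R ξ F + Nm R F)) := by
  have a1 := En_one_sub_mul hR h hχ ξ s
  have a2 := Nm_one_sub_mul h hχ s
  have a3 := hE _ (h.mul (χ := fun t => 1 - s * χ t ^ 2) (by fun_prop))
  have a4 := En_sq_mul_le hR h hχ ξ h1 h2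
  have a5 : 0 ≤ E * Nm R (fun t => χ t ^ 2 * F t) := mul_nonneg hE0 (Nm_nonneg hR _)
  rw [← sub_le_iff_le_add']
  have e : (En R ξ F - E * Nm R F) / (2 * s) + 16 * s * (En R ξ F + Nm R F) =
      (En R ξ F - E * Nm R F + s ^ 2 * (32 * (En R ξ F + Nm R F))) / (2 * s) := by
    field_simp
    ring
  rw [e, le_div_iff₀ (by positivity)]
  have a6 := mul_le_mul_of_nonneg_left a4 (sq_nonneg s)
  have a7 := mul_nonneg (sq_nonneg s) a5
  generalize Nm R (fun t => (1 - s * χ t ^ 2) * F t) = x1 at *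
  have a8 : E * x1 = E * (Nm R F + s ^ 2 * Nm R (fun t => χ t ^ 2 * F t)
    - 2 * s * Nm R (fun t => χ t * F t)) := by rw [← a2]; ring
  linarith

theorem En_shift {R : ℝ} (hR : 0 < R) {G : ℝ → ℝ} (h : Adm R G) (ξ : ℝ) :
    En R (ξ - 1 / R) G = En R ξ G +
      ∫ t in (0 : ℝ)..R, (1 / R ^ 2 - 2 * bb R ξ t / R) * ((1 - t / R)⁻¹ * G t) ^ 2 *
        (1 - t / R) := by
  have c1 := h.continuous_En hR ξ
  have c2 := h.continuous_inv hR
  have c3 := continuous_bb R ξ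
  unfold En
  rw [← intervalIntegral.integral_add (c1.intervalIntegrable _ _)
    (Continuous.intervalIntegrable (by fun_prop) _ _)]
  congr 1
  ext t
  have : pot R (ξ - 1 / R) t = (bb R ξ t - 1 / R) * (1 - t / R)⁻¹ := by
    rw [pot, bb, bb]
    ring
  rw [this, pot]
  ring

/-- The defect density in the momentum inequality. -/
def shiftDensity (R ξ : ℝ) (ω F : ℝ → ℝ) (t : ℝ) : ℝ :=
  (deriv ω t * F t) ^ 2 * (1 - t / R) +
    (1 - 2 * R * bb R ξ t) * ((1 - t / R)⁻¹ * ((1 + ω t / R) * F t)) ^ 2 * (1 - t / R) +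
      (2 * R * bb R ξ t - 1) * F t ^ 2 * (1 - t / R)

theorem continuous_shiftDensity {R : ℝ} (hR : 0 < R) {F ω : ℝ → ℝ} (h : Adm R F)
    (hω : ContDiff ℝ 1 ω) (ξ : ℝ) : Continuous (shiftDensity R ξ ω F) := by
  have c1 := (h.mul (χ := fun t => 1 + ω t / R) (by fun_prop)).continuous_inv hR
  have c2 := hω.continuous_deriv le_rfl
  have c3 := h.continuous
  have c4 := continuous_bb R ξ
  unfold shiftDensity
  fun_prop

/-- Comparison of consecutive angular momenta. -/
theorem momentum_inequality {R : ℝ} (hR : 0 < R) {F ω : ℝ → ℝ} (h : Adm R F)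
    (hω : ContDiff ℝ 1 ω) {m : ℤ} {s : ℝ} (h1 : ∀ t ∈ Icc 0 R, |ω t| ≤ R)
    (h2 : ∀ t ∈ Icc 0 R, |deriv ω t| ≤ R) (hs : 0 < s) :
    0 ≤ 2 * (-R * mom R (xiOf R m) F) + Nm R F +
      (∫ t in (0 : ℝ)..R, shiftDensity R (xiOf R m) ω F t) +
      R ^ 2 * ((En R (xiOf R m) F - lam1 unitDisc (R ^ 2) / R ^ 2 * Nm R F) / (2 * s) +
        16 * s * (En R (xiOf R m) F + Nm R F)) := by
  have hχ : ContDiff ℝ 1 fun t => 1 + ω t / R := by fun_prop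
  have hχ' : ∀ t, deriv (fun t => 1 + ω t / R) t = deriv ω t / R := fun t => by simp
  have b1 : ∀ t ∈ Icc 0 R, |1 + ω t / R| ≤ 2 := fun t ht => by
    have : |ω t / R| ≤ 1 := by
      rw [abs_div, abs_of_pos hR, div_le_one hR]
      exact h1 t ht
    calc _ ≤ |(1 : ℝ)| + |ω t / R| := abs_add_le _ _
      _ ≤ 2 := by rw [abs_one]; linarith
  have b2 : ∀ t ∈ Icc 0 R, |deriv (fun t => 1 + ω t / R) t| ≤ 1 := fun t ht => by
    rw [hχ', abs_div, abs_of_pos hR, div_le_one hR]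
    exact h2 t ht
  have a1 := En_mul_sub_le hR h hχ (ξ := xiOf R m) b1 b2
    (div_nonneg (lam1_nonneg (R ^ 2)) (sq_nonneg R)) (fun G hG => lam1_div_mul_Nm_le hR m hG) hs
  have hadm := h.mul hχ
  have a2 := lam1_div_mul_Nm_le hR (m - 1) hadm
  have e : xiOf R (m - 1) = xiOf R m - 1 / R := by
    unfold xiOf
    push_cast
    ring
  rw [e, En_shift hR hadm] at a2
  set ξ := xiOf R m
  have c1 := hadm.continuous_inv hR
  have c2 := hω.continuous_deriv le_rfl
  have c3 := h.continuous
  have c4 := continuous_bb R ξ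
  have c5 := hω.continuous
  have key : R ^ 2 * ((∫ t in (0 : ℝ)..R, (deriv (fun t => 1 + ω t / R) t * F t) ^ 2 * (1 - t / R)) +
      ∫ t in (0 : ℝ)..R, (1 / R ^ 2 - 2 * bb R ξ t / R) *
        ((1 - t / R)⁻¹ * ((1 + ω t / R) * F t)) ^ 2 * (1 - t / R)) =
      2 * (-R * mom R ξ F) + Nm R F + ∫ t in (0 : ℝ)..R, shiftDensity R ξ ω F t := by
    have d1 : Continuous fun t => (deriv (fun t => 1 + ω t / R) t * F t) ^ 2 * (1 - t / R) := by
      simp only [hχ']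
      fun_prop
    have d2 : Continuous fun t => (1 / R ^ 2 - 2 * bb R ξ t / R) *
        ((1 - t / R)⁻¹ * ((1 + ω t / R) * F t)) ^ 2 * (1 - t / R) := by fun_prop
    have d3 : Continuous fun t => bb R ξ t * F t ^ 2 * (1 - t / R) := by fun_prop
    have d4 : Continuous fun t => (2 * -R) * (bb R ξ t * F t ^ 2 * (1 - t / R)) := by fun_prop
    have d5 : Continuous fun t => F t ^ 2 * (1 - t / R) := by fun_prop
    have d6 : Continuous fun t => (2 * -R) * (bb R ξ t * F t ^ 2 * (1 - t / R)) +
      F t ^ 2 * (1 - t / R) := by fun_prop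
    unfold mom Nm
    rw [← intervalIntegral.integral_add (d1.intervalIntegrable _ _) (d2.intervalIntegrable _ _),
      ← intervalIntegral.integral_const_mul, ← mul_assoc, ← intervalIntegral.integral_const_mul,
      ← intervalIntegral.integral_add (d4.intervalIntegrable _ _) (d5.intervalIntegrable _ _),
      ← intervalIntegral.integral_add (d6.intervalIntegrable _ _)
        ((continuous_shiftDensity hR h hω ξ).intervalIntegrable _ _)]
    congr 1
    ext t
    rw [hχ', shiftDensity]
    field_simp
    ring
  rw [← key, ← mul_add]
  refine mul_nonneg (sq_nonneg R) ?_
  linarith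

theorem shiftDensity_nonpos {R ξ : ℝ} (hR : 1 ≤ R) (hξ : -2 ≤ ξ) {F ω : ℝ → ℝ} {t : ℝ}
    (ht : t ∈ Icc 6 R) (h1 : ω t = 0) (h2 : deriv ω t = 0) : shiftDensity R ξ ω F t ≤ 0 := by
  have hR0 : 0 < R := by linarith
  rcases ht.2.eq_or_lt with h | h
  · simp [shiftDensity, h, hR0.ne']
  have hρ := weight_pos hR0 h
  have hb : 1 ≤ bb R ξ t := by
    have : t ^ 2 / (2 * R) ≤ t / 2 := by
      rw [div_le_div_iff₀ (by positivity) two_pos]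
      nlinarith [ht.1]
    rw [bb]
    linarith [ht.1]
  have e : shiftDensity R ξ ω F t = -((2 * R * bb R ξ t - 1) * (F t ^ 2 *
      ((1 - t / R)⁻¹ * (1 - (1 - t / R) ^ 2)))) := by
    rw [shiftDensity, h1, h2]
    generalize 1 - t / R = ρ at *
    field_simp
    ring
  have hρ1 : 1 - t / R ≤ 1 := (weight_mem hR0 ⟨by linarith [ht.1], ht.2⟩).2
  have : (1 - t / R) ^ 2 ≤ 1 := pow_le_one₀ hρ.le hρ1
  rw [e, neg_nonpos]
  refine mul_nonneg (by nlinarith) (mul_nonneg (sq_nonneg _) (mul_nonneg (by positivity) ?_))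
  linarith

theorem shiftDensity_eq {R : ℝ} (ξ : ℝ) (hR : 0 < R) {F ω : ℝ → ℝ} {t : ℝ} (ht : t < R) :
    shiftDensity R ξ ω F t = (deriv ω t ^ 2 + (1 / R - 2 * (t + ξ - t ^ 2 * (1 / R) / 2)) *
      (ω t + t) * (2 + (ω t - t) * (1 / R)) / (1 - t * (1 / R)) ^ 2) * F t ^ 2 *
        (1 - t * (1 / R)) := by
  have hρ := weight_pos hR ht
  have hρ' : (R - t) ≠ 0 := by linarith
  rw [shiftDensity, bb]
  have e : t / R = t * (1 / R) := by ring
  have e2 : 1 - t * (1 / R) ≠ 0 := by rw [← e]; exact hρ.ne'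
  rw [e]
  field_simp
  ring

namespace DeGennes
variable (D : DeGennes)

theorem exists_shiftDensity_bound {ω : ℝ → ℝ} (hω : ContDiff ℝ 1 ω) (N : ℝ) {ε : ℝ}
    (hε : 0 < ε) : ∃ r, 0 < r ∧ ∀ x ξ σ : ℝ, |x| < r → |ξ - D.ξ₀| < r → |σ| < r →
      ∀ t ∈ Icc 0 N, (deriv ω t ^ 2 + (x - 2 * (t + ξ - t ^ 2 * x / 2)) *
      (ω t + t) * (2 + (ω t - t) * x) / (1 - t * x) ^ 2) * (D.U t ^ 2 + σ) *
        (1 - t * x) < -(D.gain ω t * D.U t ^ 2) + ε := by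
  have c1 := hω.continuous
  have c2 := hω.continuous_deriv le_rfl
  have c3 := D.continuous_U
  let P : (ℝ × ℝ × ℝ) → ℝ → Prop := fun p t =>
    (deriv ω t ^ 2 + (p.1 - 2 * (t + p.2.1 - t ^ 2 * p.1 / 2)) *
      (ω t + t) * (2 + (ω t - t) * p.1) / (1 - t * p.1) ^ 2) * (D.U t ^ 2 + p.2.2) *
        (1 - t * p.1) < -(D.gain ω t * D.U t ^ 2) + ε
  have key : ∀ᶠ p : ℝ × ℝ × ℝ in 𝓝 (0, D.ξ₀, 0), ∀ t ∈ Icc 0 N, P p t := by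
    refine isCompact_Icc.eventually_forall_of_forall_eventually fun t ht => ?_
    refine ContinuousAt.eventually_lt
      (f := fun z : (ℝ × ℝ × ℝ) × ℝ => (deriv ω z.2 ^ 2 + (z.1.1 - 2 * (z.2 + z.1.2.1 - z.2 ^ 2 * z.1.1 / 2)) *
      (ω z.2 + z.2) * (2 + (ω z.2 - z.2) * z.1.1) / (1 - z.2 * z.1.1) ^ 2) * (D.U z.2 ^ 2 + z.1.2.2) *
        (1 - z.2 * z.1.1)) (g := fun z => -(D.gain ω z.2 * D.U z.2 ^ 2) + ε) ?_
      (by unfold gain; fun_prop) ?_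
    · refine ContinuousAt.mul (ContinuousAt.mul (ContinuousAt.add (by fun_prop)
        (ContinuousAt.div (by fun_prop) (by fun_prop) (by simp))) (by fun_prop)) (by fun_prop)
    · simp only [gain]
      ring_nf
      linarith
  obtain ⟨r, hr, hball⟩ := Metric.eventually_nhds_iff.1 key
  refine ⟨r, hr, fun x ξ σ hx hξ hσ t ht => hball (y := (x, ξ, σ)) ?_ t ht⟩
  simp only [Prod.dist_eq, Real.dist_eq, sub_zero, max_lt_iff]
  exact ⟨hx, hξ, hσ⟩

end DeGennes

theorem exists_bound_of_vanish {ω : ℝ → ℝ} (hω : ContDiff ℝ 1 ω) {N : ℝ}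
    (h0 : ∀ t, N ≤ t → ω t = 0) : ∃ W, 0 < W ∧ ∀ t, 0 ≤ t → |ω t| ≤ W ∧ |deriv ω t| ≤ W := by
  obtain ⟨A, hA⟩ := (isCompact_Icc (a := (0 : ℝ)) (b := N)).bddAbove_image
    hω.continuous.abs.continuousOn
  obtain ⟨B, hB⟩ := (isCompact_Icc (a := (0 : ℝ)) (b := N)).bddAbove_image
    (hω.continuous_deriv le_rfl).abs.continuousOn
  refine ⟨max 1 (max A B), by positivity, fun t ht => ?_⟩
  rcases le_or_gt t N with h | h
  · exact ⟨(hA ⟨t, ⟨ht, h⟩, rfl⟩).trans ((le_max_left _ _).trans (le_max_right _ _)),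
      (hB ⟨t, ⟨ht, h⟩, rfl⟩).trans ((le_max_right _ _).trans (le_max_right _ _))⟩
  · rw [h0 t h.le, deriv_eq_zero_of_vanish h0 h, abs_zero]
    constructor <;> positivity

namespace DeGennes
variable (D : DeGennes)

theorem integral_shiftDensity_le {R ξ N ε r : ℝ} {F ω : ℝ → ℝ} (h : Adm R F)
    (hω : ContDiff ℝ 1 ω) (hN : 6 ≤ N) (hNR : N < R) (hξ : -2 ≤ ξ)
    (h0 : ∀ t, N ≤ t → ω t = 0)
    (hr : ∀ x ξ σ : ℝ, |x| < r → |ξ - D.ξ₀| < r → |σ| < r →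
      ∀ t ∈ Icc 0 N, (deriv ω t ^ 2 + (x - 2 * (t + ξ - t ^ 2 * x / 2)) *
      (ω t + t) * (2 + (ω t - t) * x) / (1 - t * x) ^ 2) * (D.U t ^ 2 + σ) *
        (1 - t * x) < -(D.gain ω t * D.U t ^ 2) + ε)
    (hx : |1 / R| < r) (hξr : |ξ - D.ξ₀| < r) (hF : ∀ t ∈ Icc 0 N, |F t ^ 2 - D.U t ^ 2| < r) :
    ∫ t in (0 : ℝ)..R, shiftDensity R ξ ω F t ≤
      -(∫ t in (0 : ℝ)..N, D.gain ω t * D.U t ^ 2) + N * ε := by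
  have hR : 0 < R := by linarith
  have c := continuous_shiftDensity hR h hω ξ
  have c1 := hω.continuous
  have c2 := hω.continuous_deriv le_rfl
  have c3 := D.continuous_U
  have c4 : Continuous fun t => D.gain ω t * D.U t ^ 2 := by
    unfold gain
    fun_prop
  have c5 : Continuous fun t => -(D.gain ω t * D.U t ^ 2) := c4.neg
  rw [← intervalIntegral.integral_add_adjacent_intervals (c.intervalIntegrable 0 N)
    (c.intervalIntegrable N R)]
  have tail : ∫ t in N..R, shiftDensity R ξ ω F t ≤ 0 := by
    have : ∫ t in N..R, shiftDensity R ξ ω F t ≤ ∫ _ in N..R, (0 : ℝ) :=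
      intervalIntegral.integral_mono_on_of_le_Ioo hNR.le (c.intervalIntegrable N R)
        (by simp) fun t ht =>
        shiftDensity_nonpos (F := F) (by linarith : 1 ≤ R) hξ ⟨hN.trans ht.1.le, ht.2.le⟩
          (h0 t ht.1.le) (deriv_eq_zero_of_vanish h0 ht.1)
    simpa using this
  have head : ∫ t in (0 : ℝ)..N, shiftDensity R ξ ω F t ≤
      ∫ t in (0 : ℝ)..N, (-(D.gain ω t * D.U t ^ 2) + ε) := by
    refine intervalIntegral.integral_mono_on (by linarith) (c.intervalIntegrable _ _)
      (Continuous.intervalIntegrable (by fun_prop) _ _) fun t ht => ?_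
    rw [shiftDensity_eq ξ hR (ht.2.trans_lt hNR)]
    simpa only [add_sub_cancel] using (hr (1 / R) ξ (F t ^ 2 - D.U t ^ 2) hx hξr (hF t ht) t ht).le
  rw [intervalIntegral.integral_add (c5.intervalIntegrable _ _) intervalIntegrable_const,
    intervalIntegral.integral_neg, intervalIntegral.integral_const, smul_eq_mul, sub_zero] at head
  linarith

/-- Near-minimizers carry at least the expected boundary current. -/
theorem eventually_momentum_lower {ε : ℝ} (hε : 0 < ε) : ∀ᶠ R : ℝ in atTop, ∀ m F, Adm R F →
    Nm R F = 1 → En R (xiOf R m) F < lam1 unitDisc (R ^ 2) / R ^ 2 + 1 / R ^ 7 →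
      Theta0 - 3 / 2 * D.C1 * |D.ξ₀| - ε ≤ -R * mom R (xiOf R m) F := by
  obtain ⟨N, ω, hN, hω, h0, hgain⟩ := D.exists_corrector (half_pos hε)
  obtain ⟨W, hW, hbd⟩ := exists_bound_of_vanish hω h0
  have hN0 : 0 < N := by linarith
  obtain ⟨r, hr, hdens⟩ := D.exists_shiftDensity_bound hω N (div_pos (half_pos hε) hN0)
  obtain ⟨δ₁, hδ₁, ev1⟩ := D.eventually_abs_sub_lt (lt_min hr one_pos)
  obtain ⟨δ₂, hδ₂, ev2⟩ := D.eventually_abs_sq_sub_le (N := N) (half_pos hr)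
  have hδ : 0 < min (min δ₁ δ₂) 1 := by positivity
  have t1 : Tendsto (fun R : ℝ => 1 / R) atTop (𝓝 0) := tendsto_id.const_div_atTop 1
  have t2 : Tendsto (fun R : ℝ => 80 / R) atTop (𝓝 0) := tendsto_id.const_div_atTop 80
  filter_upwards [ev1, ev2, D.eventually_lam1_le (half_pos hδ),
    t1.eventually_lt_const (lt_min hr (half_pos hδ)), t2.eventually_lt_const (half_pos hε),
    eventually_gt_atTop N, eventually_ge_atTop W, eventually_ge_atTop 1]
    with R e1 e2 e3 e4 e5 hNR hWR hR1 m F hF hNm hEn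
  have hR : 0 < R := by linarith
  have hpow : 1 / R ^ 7 ≤ 1 / R := by
    gcongr
    exact le_self_pow₀ hR1 (by norm_num)
  obtain ⟨e41, e42⟩ := lt_min_iff.1 e4
  have hm1 : min (min δ₁ δ₂) 1 ≤ δ₁ := (min_le_left _ _).trans (min_le_left _ _)
  have hm2 : min (min δ₁ δ₂) 1 ≤ δ₂ := (min_le_left _ _).trans (min_le_right _ _)
  have hm3 : min (min δ₁ δ₂) 1 ≤ 1 := min_le_right _ _
  have f1 := e1 _ F hF hNm (by linarith)
  have f2 := e2 _ F hF hNm (by linarith)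
  obtain ⟨f11, f12⟩ := lt_min_iff.1 f1
  have hξ₀ := D.ξ₀_mem.1
  have hξ : -2 ≤ xiOf R m := by linarith [(abs_lt.1 f12).1]
  have hI := D.integral_shiftDensity_le hF hω hN hNR hξ h0 hdens
    (by rwa [abs_of_pos (by positivity)]) f11 fun t ht => (f2 t ht).trans_lt (by linarith)
  have hM := momentum_inequality hR hF hω (m := m) (s := 1 / R ^ 3)
    (fun t ht => (hbd t ht.1).1.trans hWR) (fun t ht => (hbd t ht.1).2.trans hWR) (by positivity)
  have hE2 : En R (xiOf R m) F ≤ 2 := by linarith [D.theta_ub]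
  have herr : R ^ 2 * ((En R (xiOf R m) F - lam1 unitDisc (R ^ 2) / R ^ 2 * Nm R F) /
      (2 * (1 / R ^ 3)) + 16 * (1 / R ^ 3) * (En R (xiOf R m) F + Nm R F)) ≤ 80 / R := by
    rw [hNm, mul_one]
    calc _ ≤ R ^ 2 * ((1 / R ^ 7) / (2 * (1 / R ^ 3)) + 16 * (1 / R ^ 3) * (2 + 1)) := by
          gcongr
          linarith
      _ = (1 / R / 2 + 48) / R := by
          field_simp
          ring
      _ ≤ 80 / R := by
          gcongr
          have : 1 / R ≤ 1 := by rw [div_le_one hR]; exact hR1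
          linarith
  rw [D.target_eq]
  have : N * (ε / 2 / N) = ε / 2 := by field_simp
  linarith

end DeGennes

theorem add_mul_sub_le_of_le_deriv_right {f f' : ℝ → ℝ} {a b c : ℝ} (hab : a ≤ b)
    (hf : ContinuousOn f (Icc a b)) (hf' : ∀ x ∈ Ico a b, HasDerivWithinAt f (f' x) (Ici x) x)
    (hc : ∀ x ∈ Ico a b, c ≤ f' x) : f a + c * (b - a) ≤ f b := by
  have hl : ∀ x, HasDerivWithinAt (fun x => f a + c * (x - a)) c (Ici x) x := fun x => by
    simpa using ((((hasDerivAt_id x).sub_const a).const_mul c).const_add (f a)).hasDerivWithinAt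
  exact image_le_of_deriv_right_le_deriv_boundary (f := fun x => f a + c * (x - a))
    (f' := fun _ => c) (by fun_prop) (fun x _ => hl x) (by simp) hf hf' hc (right_mem_Icc.2 hab)

theorem convexOn_neg_sub {f : ℝ → ℝ}
    (hf : ConcaveOn ℝ univ fun B => f B - B ^ 2 / 4) : ConvexOn ℝ univ fun B => B ^ 2 / 4 - f B := by
  have e : (fun B => B ^ 2 / 4 - f B) = -fun B => f B - B ^ 2 / 4 := by
    ext B
    simp
  rw [e]
  exact hf.neg

theorem hasDerivWithinAt_Ici_sub {f : ℝ → ℝ}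
    (hf : ConcaveOn ℝ univ fun B => f B - B ^ 2 / 4) (B : ℝ) : HasDerivWithinAt f
    (B / 2 - derivWithin (fun B => B ^ 2 / 4 - f B) (Ioi B) B) (Ici B) B := by
  have h := ((convexOn_neg_sub hf).hasDerivWithinAt_rightDeriv_of_mem_interior
    (x := B) (by simp)).Ici_of_Ioi
  have h2 : HasDerivWithinAt (fun B : ℝ => B ^ 2 / 4) (B / 2) (Ici B) B := by
    convert! (((hasDerivAt_id B).pow 2).div_const 4).hasDerivWithinAt using 1
    simp
    ring
  simpa using h2.fun_sub h

theorem hasDerivWithinAt_Iic_sub {f : ℝ → ℝ}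
    (hf : ConcaveOn ℝ univ fun B => f B - B ^ 2 / 4) (B : ℝ) : HasDerivWithinAt f
    (B / 2 - derivWithin (fun B => B ^ 2 / 4 - f B) (Iio B) B) (Iic B) B := by
  have h := ((convexOn_neg_sub hf).hasDerivWithinAt_leftDeriv_of_mem_interior
    (x := B) (by simp)).Iic_of_Iio
  have h2 : HasDerivWithinAt (fun B : ℝ => B ^ 2 / 4) (B / 2) (Iic B) B := by
    convert! (((hasDerivAt_id B).pow 2).div_const 4).hasDerivWithinAt using 1
    simp
    ring
  simpa using h2.fun_sub h

theorem derivWithin_Ici_eq {f : ℝ → ℝ}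
    (hf : ConcaveOn ℝ univ fun B => f B - B ^ 2 / 4) (B : ℝ) : derivWithin f (Ici B) B =
    B / 2 - derivWithin (fun B => B ^ 2 / 4 - f B) (Ioi B) B :=
  (hasDerivWithinAt_Ici_sub hf B).derivWithin (uniqueDiffOn_Ici B B self_mem_Ici)

theorem derivWithin_Iic_eq {f : ℝ → ℝ}
    (hf : ConcaveOn ℝ univ fun B => f B - B ^ 2 / 4) (B : ℝ) : derivWithin f (Iic B) B =
    B / 2 - derivWithin (fun B => B ^ 2 / 4 - f B) (Iio B) B :=
  (hasDerivWithinAt_Iic_sub hf B).derivWithin (uniqueDiffOn_Iic B B self_mem_Iic)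

theorem hasDerivWithinAt_Ici {f : ℝ → ℝ}
    (hf : ConcaveOn ℝ univ fun B => f B - B ^ 2 / 4) (B : ℝ) :
    HasDerivWithinAt f (derivWithin f (Ici B) B) (Ici B) B :=
  (hasDerivWithinAt_Ici_sub hf B).differentiableWithinAt.hasDerivWithinAt

theorem derivWithin_Ici_le_Iic {f : ℝ → ℝ}
    (hf : ConcaveOn ℝ univ fun B => f B - B ^ 2 / 4) (B : ℝ) :
    derivWithin f (Ici B) B ≤ derivWithin f (Iic B) B := by
  rw [derivWithin_Ici_eq hf, derivWithin_Iic_eq hf]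
  linarith [(convexOn_neg_sub hf).leftDeriv_le_rightDeriv_of_mem_interior (x := B) (by simp)]

theorem continuous_of_concaveOn_sub {f : ℝ → ℝ}
    (hf : ConcaveOn ℝ univ fun B => f B - B ^ 2 / 4) : Continuous f := by
  have h := (convexOn_neg_sub hf).continuousOn isOpen_univ
  rw [continuousOn_univ] at h
  have : f = fun B => B ^ 2 / 4 - (B ^ 2 / 4 - f B) := by ext; ring
  rw [this]
  fun_prop

theorem slope_sub_le_derivWithin_Ici {f : ℝ → ℝ}
    (hf : ConcaveOn ℝ univ fun B => f B - B ^ 2 / 4) (B : ℝ) {e : ℝ} (he : 0 < e) :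
    (f (B + e) - f B) / e - e / 4 ≤ derivWithin f (Ici B) B := by
  have h := (convexOn_neg_sub hf).rightDeriv_le_slope_of_mem_interior (x := B) (y := B + e)
    (by simp) (by simp) (by linarith)
  rw [derivWithin_Ici_eq hf]
  refine le_trans (le_of_eq ?_) (sub_le_sub_left h _)
  rw [slope_def_field, add_sub_cancel_left]
  field_simp
  ring

namespace DeGennes

theorem eventually_le_derivWithin (D : DeGennes) {κ : ℝ} (hκ : 0 < κ) : ∀ᶠ B : ℝ in atTop,
    Theta0 - 3 / 2 * D.C1 * |D.ξ₀| - κ ≤ derivWithin (lam1 unitDisc) (Ici B) B := by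
  have ht : Tendsto (fun B => √(B + κ / 2)) atTop atTop :=
    Real.tendsto_sqrt_atTop.comp (tendsto_atTop_add_const_right _ _ tendsto_id)
  have hc : 0 < κ / 4 * (κ / 2) := by positivity
  filter_upwards [ht.eventually (D.eventually_momentum_lower (show 0 < κ / 4 by positivity)),
    ht.eventually (eventually_ge_atTop 1),
    ht.eventually (((tendsto_id.const_div_atTop 1).eventually_le_const hc)),
    eventually_ge_atTop 0] with B h1 h2 h3 h4
  have hR2 : √(B + κ / 2) ^ 2 = B + κ / 2 := Real.sq_sqrt (by positivity)
  generalize √(B + κ / 2) = R at *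
  have hR : 0 < R := by linarith
  obtain ⟨m, F, hF, hNm, hEn⟩ := exists_near_min hR (show 0 < 1 / R ^ 7 by positivity)
  have hI := h1 m F hF hNm hEn
  have hl := lam1_mul_Nm_le hR B m hF
  have hs := slope_sub_le_derivWithin_Ici concaveOn_lam1 B (half_pos hκ)
  refine le_trans ?_ hs
  rw [hNm, mul_one, mul_one] at hl
  have hE := mul_lt_mul_of_pos_left hEn (show 0 < R ^ 2 by positivity)
  have e1 : R ^ 2 * (lam1 unitDisc (R ^ 2) / R ^ 2 + 1 / R ^ 7) =
      lam1 unitDisc (R ^ 2) + 1 / R ^ 5 := by field_simp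
  have e2 : 1 / R ^ 5 ≤ 1 / R := by
    gcongr
    exact le_self_pow₀ h2 (by norm_num)
  have e3 : B - R ^ 2 = -(κ / 2) := by rw [hR2]; ring
  rw [e1] at hE
  rw [e3] at hl
  rw [← hR2]
  rw [← sub_nonneg]
  have : (lam1 unitDisc (R ^ 2) - lam1 unitDisc B) / (κ / 2) ≥
      -R * mom R (xiOf R m) F - κ / 8 - κ / 4 := by
    rw [ge_iff_le, le_div_iff₀ (by positivity)]
    simp only [id] at h3
    nlinarith
  linarith

theorem eventually_lam1_le_two_mul (D : DeGennes) : ∀ᶠ B : ℝ in atTop, lam1 unitDisc B ≤ 2 * B := by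
  filter_upwards [Real.tendsto_sqrt_atTop.eventually (D.eventually_lam1_le one_pos),
    eventually_gt_atTop 0] with B h hB
  rw [Real.sq_sqrt hB.le, div_le_iff₀ hB] at h
  nlinarith [D.theta_ub]

theorem isCoboundedUnder_derivWithin (D : DeGennes) : IsCoboundedUnder (· ≥ ·) atTop
    fun B => derivWithin (lam1 unitDisc) (Ici B) B := by
  refine ⟨3, fun a ha => ?_⟩
  by_contra! hlt
  obtain ⟨B₀, hB₀⟩ := eventually_atTop.1 (eventually_map.1 ha)
  obtain ⟨b, hb1, hb2, hb3⟩ := (D.eventually_lam1_le_two_mul.and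
    ((eventually_ge_atTop B₀).and (eventually_gt_atTop (3 * B₀)))).exists
  have := add_mul_sub_le_of_le_deriv_right (c := 3) hb2
    (continuous_of_concaveOn_sub concaveOn_lam1).continuousOn
    (fun x _ => hasDerivWithinAt_Ici concaveOn_lam1 x)
    fun x hx => hlt.le.trans (hB₀ x hx.1)
  linarith [lam1_nonneg B₀]

theorem exists_strictMonoOn_lam1 (D : DeGennes) : ∃ B₀ > 0, StrictMonoOn (lam1 unitDisc) (Ici B₀) := by
  have hpos := half_pos D.target_pos
  obtain ⟨B₀, hB₀⟩ := eventually_atTop.1 (D.eventually_le_derivWithin hpos)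
  refine ⟨max B₀ 1, by positivity, fun a ha b _ hab => ?_⟩
  have := add_mul_sub_le_of_le_deriv_right hab.le
    (continuous_of_concaveOn_sub concaveOn_lam1).continuousOn
    (fun x _ => hasDerivWithinAt_Ici concaveOn_lam1 x)
    fun x hx => hB₀ x (((le_max_left _ _).trans ha).trans hx.1)
  rw [sub_half] at this
  nlinarith

end DeGennes

end SC

/-- Diamagnetism for the disc: `λ₁(B) - B²/4` is concave on `(0,∞)`,
the one-sided derivatives satisfy `λ₁'₊ ≤ λ₁'₋`, `liminf λ₁'₊ ≥ Θ₀ - (3/2)C₁|ξ₀| > 0`,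
and `λ₁` is eventually strictly increasing. -/
theorem lam1_disc_monotone (D : SC.DeGennes) :
    ConcaveOn ℝ (Set.Ioi 0) (fun B => SC.lam1 SC.unitDisc B - B ^ 2 / 4) ∧
    (∀ B : ℝ, 0 < B →
      DifferentiableWithinAt ℝ (SC.lam1 SC.unitDisc) (Set.Ici B) B ∧
      DifferentiableWithinAt ℝ (SC.lam1 SC.unitDisc) (Set.Iic B) B ∧
      derivWithin (SC.lam1 SC.unitDisc) (Set.Ici B) B
        ≤ derivWithin (SC.lam1 SC.unitDisc) (Set.Iic B) B) ∧
    SC.Theta0 - 3 / 2 * D.C1 * |D.ξ₀|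
      ≤ Filter.liminf (fun B => derivWithin (SC.lam1 SC.unitDisc) (Set.Ici B) B)
          Filter.atTop ∧
    0 < SC.Theta0 - 3 / 2 * D.C1 * |D.ξ₀| ∧
    ∃ B₀ > 0, StrictMonoOn (SC.lam1 SC.unitDisc) (Set.Ici B₀) := by
  refine ⟨SC.concaveOn_lam1.subset (subset_univ _) (convex_Ioi 0), fun B _ =>
    ⟨(SC.hasDerivWithinAt_Ici_sub SC.concaveOn_lam1 B).differentiableWithinAt,
      (SC.hasDerivWithinAt_Iic_sub SC.concaveOn_lam1 B).differentiableWithinAt,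
      SC.derivWithin_Ici_le_Iic SC.concaveOn_lam1 B⟩, ?_, D.target_pos,
    D.exists_strictMonoOn_lam1⟩
  exact le_of_forall_sub_le fun κ hκ =>
    le_liminf_of_le D.isCoboundedUnder_derivWithin (D.eventually_le_derivWithin hκ)
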